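/- Let Ω_0, Ω_1 ⊆ ℝ^d be bounded measurable sets with equal positive Lebesgue measure. Call a pair (ρ, v) admissible if ρ : ℝ^d × [0,1] → ℝ and v : ℝ^d × [0,1] → ℝ^d are measurable, ρ(x,t) ∈ {0,1} for a.e. (x,t), ρ is integrable on ℝ^d × [0,1], ∫_0^1 ∫_{ℝ^d} ρ |v|² dx dt < ∞, and for every smooth compactly supported test function q on ℝ^d × [0,1] one has ∫_0^1 ∫_{ℝ^d} ρ (∂_t q + v·∇q) dx dt = ∫_{Ω_1} q(x,1) dx − ∫_{Ω_0} q(x,0) dx. Then the infimum of the action 𝒜(ρ,v) = ∫_0^1 ∫_{ℝ^d} ρ |v|² dx dt over all admissible pairs equals d_W(1_{Ω_0} dx, 1_{Ω_1} dx)². (That is, the shape distance d_s(Ω_0, Ω_1) equals the Wasserstein distance d_W(1_{Ω_0}, 1_{Ω_1}).) -/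

import Mathlib

open Set MeasureTheory
open scoped ENNReal RealInnerProductSpace

/-- The space-time measure: Lebesgue measure on `ℝ^d` times Lebesgue measure
restricted to `[0,1]`. -/
noncomputable def spaceTime (d : ℕ) : Measure (EuclideanSpace ℝ (Fin d) × ℝ) :=
  (volume : Measure (EuclideanSpace ℝ (Fin d))).prod (volume.restrict (Icc (0:ℝ) 1))

/-- Admissibility of a pair `(ρ, v)` for the shape-distance problem between `Ω₀` and
`Ω₁`: `ρ` and `v` are measurable, `ρ(x,t) ∈ {0,1}` a.e., `ρ` is integrable on
`ℝ^d × [0,1]`, the action is finite, and the continuity equation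
`∂ₜρ + ∇·(ρv) = 0` holds weakly with endpoint data `1_{Ω₀}` at `t = 0` and `1_{Ω₁}` at
`t = 1`. -/
def ShapeAdmissible {d : ℕ} (Ω₀ Ω₁ : Set (EuclideanSpace ℝ (Fin d)))
    (ρ : EuclideanSpace ℝ (Fin d) → ℝ → ℝ)
    (v : EuclideanSpace ℝ (Fin d) → ℝ → EuclideanSpace ℝ (Fin d)) : Prop :=
  Measurable (fun q : EuclideanSpace ℝ (Fin d) × ℝ => ρ q.1 q.2) ∧
  Measurable (fun q : EuclideanSpace ℝ (Fin d) × ℝ => v q.1 q.2) ∧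
  (∀ᵐ q ∂(spaceTime d), ρ q.1 q.2 = 0 ∨ ρ q.1 q.2 = 1) ∧
  Integrable (fun q : EuclideanSpace ℝ (Fin d) × ℝ => ρ q.1 q.2) (spaceTime d) ∧
  (∫⁻ q, ENNReal.ofReal (ρ q.1 q.2 * ‖v q.1 q.2‖ ^ 2) ∂(spaceTime d)) < ⊤ ∧
  ∀ q : EuclideanSpace ℝ (Fin d) → ℝ → ℝ,
    ContDiff ℝ (⊤ : ℕ∞) (fun z : EuclideanSpace ℝ (Fin d) × ℝ => q z.1 z.2) →
    HasCompactSupport (fun z : EuclideanSpace ℝ (Fin d) × ℝ => q z.1 z.2) →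
    (∫ t in Icc (0:ℝ) 1, ∫ x, ρ x t *
        (deriv (fun s => q x s) t + ⟪v x t, gradient (fun y => q y t) x⟫)) =
      (∫ x in Ω₁, q x 1) - (∫ x in Ω₀, q x 0)

/-- The set of values of the action `𝒜(ρ,v) = ∫₀¹∫ ρ|v|² dx dt` over admissible pairs. -/
noncomputable def shapeActionSet {d : ℕ} (Ω₀ Ω₁ : Set (EuclideanSpace ℝ (Fin d))) :
    Set ℝ≥0∞ :=
  { A | ∃ ρ v, ShapeAdmissible Ω₀ Ω₁ ρ v ∧
      A = ∫⁻ q, ENNReal.ofReal (ρ q.1 q.2 * ‖v q.1 q.2‖ ^ 2) ∂(spaceTime d) }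

/-- The squared quadratic Wasserstein cost between two measures on `ℝ^d`: the infimum
over couplings of the integral of `|x − y|²`. -/
noncomputable def W2sq {d : ℕ}
    (μ ν : Measure (EuclideanSpace ℝ (Fin d))) : ℝ≥0∞ :=
  sInf { C | ∃ π : Measure (EuclideanSpace ℝ (Fin d) × EuclideanSpace ℝ (Fin d)),
    π.map Prod.fst = μ ∧ π.map Prod.snd = ν ∧
    C = ∫⁻ q, ENNReal.ofReal (‖q.1 - q.2‖ ^ 2) ∂π }


open scoped NNReal MeasureTheory


theorem kanto_primal {X : Type*} [MetricSpace X] [CompactSpace X] [Nonempty X]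
    [MeasurableSpace X] [BorelSpace X]
    (μ ν : Measure X) [IsFiniteMeasure μ] [IsFiniteMeasure ν] (hm : μ univ = ν univ)
    (hpos : μ univ ≠ 0) (c : C(X × X, ℝ)) :
    ∃ π : Measure (X × X), IsFiniteMeasure π ∧ π.map Prod.fst = μ ∧ π.map Prod.snd = ν ∧
      ∀ ε > 0, ∃ φ ψ : C(X, ℝ), (∀ x y, φ x + ψ y ≤ c (x, y)) ∧
        ∫ p, c p ∂π - ε ≤ ∫ x, φ x ∂μ + ∫ y, ψ y ∂ν := by
  classical
  have hmemTwoμ : ∀ φ : C(X, ℝ), Integrable φ μ := fun φ =>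
    φ.continuous.integrable_of_hasCompactSupport (HasCompactSupport.of_compactSpace _)
  have hmemTwoν : ∀ φ : C(X, ℝ), Integrable φ ν := fun φ =>
    φ.continuous.integrable_of_hasCompactSupport (HasCompactSupport.of_compactSpace _)
  set m : ℝ := μ.real univ with hmdef
  have hmν : ν.real univ = m := by simp [hmdef, Measure.real, hm]
  have hm0 : 0 < m := by
    rw [hmdef, Measure.real]; exact ENNReal.toReal_pos hpos (measure_ne_top _ _)
  let V : C(X × X, ℝ) → Set ℝ := fun h =>
    {a | ∃ φ ψ : C(X, ℝ), (∀ x y, h (x, y) ≤ φ x + ψ y) ∧ a = ∫ x, φ x ∂μ + ∫ y, ψ y ∂ν}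
  have hne : ∀ h, (V h).Nonempty := fun h => ⟨_, ContinuousMap.const X ‖h‖, 0, fun x y => by
    simpa using (le_abs_self _).trans (h.norm_coe_le_norm (x, y)), rfl⟩
  have hlow : ∀ (h : C(X × X, ℝ)) (k : ℝ), (∀ p, k ≤ h p) → ∀ a ∈ V h, k * m ≤ a := by
    rintro h k hk a ⟨φ, ψ, hle, rfl⟩
    have h1 : ∫ p, (φ p.1 + ψ p.2) ∂(μ.prod ν) = m * ∫ x, φ x ∂μ + m * ∫ y, ψ y ∂ν := by
      rw [integral_add]
      · rw [integral_fun_fst, integral_fun_snd]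
        simp only [smul_eq_mul, hmν]
        rfl
      · exact (hmemTwoμ φ).comp_fst ν
      · exact (hmemTwoν ψ).comp_snd μ
    have h2 : ∫ p, k ∂(μ.prod ν) ≤ ∫ p, (φ p.1 + ψ p.2) ∂(μ.prod ν) := by
      apply integral_mono (integrable_const _)
      · exact ((hmemTwoμ φ).comp_fst ν).add ((hmemTwoν ψ).comp_snd μ)
      · intro p; exact (hk p).trans (hle p.1 p.2)
    rw [h1] at h2
    have h3 : (μ.prod ν).real univ = m * m := by
      rw [← univ_prod_univ, measureReal_prod_prod, hmν]
    simp only [integral_const, smul_eq_mul, h3] at h2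
    have : m * (k * m) ≤ m * (∫ x, φ x ∂μ + ∫ y, ψ y ∂ν) := by nlinarith
    exact le_of_mul_le_mul_left this hm0
  have hbdd : ∀ h, BddBelow (V h) := fun h => ⟨-‖h‖ * m, fun a ha =>
    hlow h (-‖h‖) (fun p => (abs_le.1 (h.norm_coe_le_norm p)).1) a ha⟩
  let N : C(X × X, ℝ) → ℝ := fun h => sInf (V h)
  have N_le : ∀ (h : C(X × X, ℝ)) (φ ψ : C(X, ℝ)), (∀ x y, h (x, y) ≤ φ x + ψ y) →
      N h ≤ ∫ x, φ x ∂μ + ∫ y, ψ y ∂ν := fun h φ ψ hh => csInf_le (hbdd h) ⟨φ, ψ, hh, rfl⟩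
  have N_lt : ∀ h, ∀ ε > 0, ∃ φ ψ : C(X, ℝ), (∀ x y, h (x, y) ≤ φ x + ψ y) ∧
      ∫ x, φ x ∂μ + ∫ y, ψ y ∂ν < N h + ε := by
    intro h ε hε
    obtain ⟨a, ⟨φ, ψ, h1, rfl⟩, h2⟩ := exists_lt_of_csInf_lt (hne h) (show sInf (V h) < N h + ε by
      simp only [N]; linarith)
    exact ⟨φ, ψ, h1, h2⟩
  have N_homle : ∀ c : ℝ, 0 < c → ∀ x, N (c • x) ≤ c * N x := by
    intro k hk h
    apply le_of_forall_pos_le_add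
    intro ε hε
    obtain ⟨φ, ψ, h1, h2⟩ := N_lt h (ε / k) (by positivity)
    refine (N_le (k • h) (k • φ) (k • ψ) (fun x y => ?_)).trans ?_
    · simp only [ContinuousMap.smul_apply, smul_eq_mul]
      nlinarith [h1 x y]
    · simp only [ContinuousMap.smul_apply, smul_eq_mul, integral_const_mul]
      have : k * (∫ x, φ x ∂μ + ∫ y, ψ y ∂ν) ≤ k * (N h + ε / k) :=
        mul_le_mul_of_nonneg_left h2.le hk.le
      rw [mul_add k (N h), mul_div_cancel₀ _ hk.ne'] at this
      linarith
  have N_hom : ∀ c : ℝ, 0 < c → ∀ x, N (c • x) = c * N x := by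
    intro k hk h
    apply le_antisymm (N_homle k hk h)
    have := N_homle k⁻¹ (by positivity) (k • h)
    rw [smul_smul, inv_mul_cancel₀ hk.ne', one_smul] at this
    rwa [inv_mul_eq_div, le_div_iff₀ hk, mul_comm] at this
  have N_add : ∀ x y, N (x + y) ≤ N x + N y := by
    intro h h'
    apply le_of_forall_pos_le_add
    intro ε hε
    obtain ⟨φ, ψ, h1, h2⟩ := N_lt h (ε / 2) (by positivity)
    obtain ⟨φ', ψ', h1', h2'⟩ := N_lt h' (ε / 2) (by positivity)
    refine (N_le (h + h') (φ + φ') (ψ + ψ') (fun x y => ?_)).trans ?_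
    · simp only [ContinuousMap.add_apply]
      linarith [h1 x y, h1' x y]
    · simp only [ContinuousMap.add_apply]
      rw [integral_add (hmemTwoμ _) (hmemTwoμ _), integral_add (hmemTwoν _) (hmemTwoν _)]
      linarith
  have N_0 : N 0 = 0 := by
    have := N_hom 2 (by norm_num) 0
    rw [smul_zero] at this; linarith
  have hext : ∃ g : C(X × X, ℝ) →ₗ[ℝ] ℝ, g (-c) = N (-c) ∧ ∀ h, g h ≤ N h := by
    by_cases hc0 : -c = 0
    · obtain ⟨g, -, hg⟩ := exists_extension_of_le_sublinear ⟨⊥, 0⟩ N N_hom N_add (by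
        rintro ⟨x, hx⟩
        have hx0 : x = 0 := by simpa using hx
        subst hx0
        simp [N_0])
      exact ⟨g, by rw [hc0, map_zero, N_0], hg⟩
    · obtain ⟨g, hg1, hg⟩ := exists_extension_of_le_sublinear
        (LinearPMap.mkSpanSingleton (K := ℝ) (-c) (N (-c)) hc0) N N_hom N_add (by
        rintro ⟨x, hx⟩
        obtain ⟨k, rfl⟩ := Submodule.mem_span_singleton.1 hx
        have : (LinearPMap.mkSpanSingleton (K := ℝ) (-c) (N (-c)) hc0) ⟨k • (-c), hx⟩
            = k • N (-c) := LinearPMap.mkSpanSingleton'_apply _ _ _ _ _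
        rw [this, smul_eq_mul]
        rcases lt_trichotomy k 0 with hk | hk | hk
        · have h1 := N_hom (-k) (by linarith) (-c)
          have h2 := N_add (k • (-c)) ((-k) • (-c))
          rw [← add_smul, add_neg_cancel, zero_smul, N_0] at h2
          show k * N (-c) ≤ N (k • (-c))
          linarith
        · subst hk; simp [N_0]
        · exact (N_hom k hk (-c)).ge)
      refine ⟨g, ?_, hg⟩
      have h3 := hg1 ⟨-c, Submodule.mem_span_singleton_self _⟩
      rw [h3]
      exact LinearPMap.mkSpanSingleton_apply ℝ ℝ hc0 _
  obtain ⟨g, hgc, hg⟩ := hext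
  have gpos : ∀ h : C(X × X, ℝ), (∀ p, 0 ≤ h p) → 0 ≤ g h := by
    intro h hh
    have h1 := hg (-h)
    have h2 := N_le (-h) 0 0 (fun x y => by simpa using hh (x, y))
    simp at h1 h2
    linarith
  let Λ₀ : CompactlySupportedContinuousMap (X × X) ℝ →ₗ[ℝ] ℝ :=
    { toFun := fun f => g (f : C(X × X, ℝ))
      map_add' := fun f f' => by
        rw [← map_add]; rfl
      map_smul' := fun k f => by
        rw [RingHom.id_apply, ← map_smul]; rfl }
  let Λ : CompactlySupportedContinuousMap (X × X) ℝ →ₚ[ℝ] ℝ :=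
    PositiveLinearMap.mk₀ Λ₀ (fun f hf => gpos _ (fun p => hf p))
  let π := RealRMK.rieszMeasure Λ
  have hπ : ∀ h : C(X × X, ℝ), ∫ p, h p ∂π = g h := fun h =>
    RealRMK.integral_rieszMeasure Λ (CompactlySupportedContinuousMap.continuousMapEquiv h)
  have hfin : IsFiniteMeasure π := by infer_instance
  have hmargin : ∀ φ ψ : C(X, ℝ), ∀ h : C(X × X, ℝ), (∀ x y, h (x, y) = φ x + ψ y) →
      g h = ∫ x, φ x ∂μ + ∫ y, ψ y ∂ν := by
    intro φ ψ h hh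
    have h1 := (hg h).trans (N_le h φ ψ (fun x y => (hh x y).le))
    have h2 := (hg (-h)).trans (N_le (-h) (-φ) (-ψ) (fun x y => by simp [hh x y]))
    simp only [map_neg, ContinuousMap.neg_apply, integral_neg] at h2
    linarith
  refine ⟨π, hfin, ?_, ?_, ?_⟩
  · have : IsFiniteMeasure (π.map Prod.fst) := by infer_instance
    apply ext_of_forall_integral_eq_of_IsFiniteMeasure
    intro f
    rw [integral_map (by fun_prop) (by fun_prop)]
    have h1 := hπ ⟨fun p => f p.1, by fun_prop⟩
    rw [hmargin f.toContinuousMap 0 _ (fun x y => by simp)] at h1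
    simpa using h1
  · have : IsFiniteMeasure (π.map Prod.snd) := by infer_instance
    apply ext_of_forall_integral_eq_of_IsFiniteMeasure
    intro f
    rw [integral_map (by fun_prop) (by fun_prop)]
    have h1 := hπ ⟨fun p => f p.2, by fun_prop⟩
    rw [hmargin 0 f.toContinuousMap _ (fun x y => by simp)] at h1
    simpa using h1
  · intro ε hε
    obtain ⟨φ, ψ, h1, h2⟩ := N_lt (-c) ε hε
    refine ⟨-φ, -ψ, fun x y => ?_, ?_⟩
    · have := h1 x y
      simp only [ContinuousMap.neg_apply] at this ⊢
      linarith
    · rw [hπ c]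
      simp only [ContinuousMap.neg_apply, integral_neg]
      rw [map_neg] at hgc
      linarith

theorem lip_inf {X Y : Type*} [MetricSpace X] [Nonempty Y] (L : ℝ≥0) (F : Y → X → ℝ)
    (hF : ∀ y, LipschitzWith L (F y)) (hb : ∀ x, BddBelow (range fun y => F y x)) :
    LipschitzWith L (fun x => ⨅ y, F y x) := by
  apply LipschitzWith.of_le_add_mul
  intro x x'
  have : ⨅ y, F y x - L * dist x x' ≤ ⨅ y, F y x' := by
    apply le_ciInf
    intro y
    have h1 := ciInf_le (hb x) y
    have h2 := (hF y).le_add_mul x x'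
    have h3 : ⨅ y, F y x - L * dist x x' ≤ F y x - L * dist x x' := by
      apply ciInf_le _ y
      obtain ⟨b, hb⟩ := hb x
      exact ⟨b - L * dist x x', by rintro _ ⟨y, rfl⟩; have := hb ⟨y, rfl⟩; simp at this ⊢; linarith⟩
    linarith
  have h4 : ⨅ y, F y x - L * dist x x' = (⨅ y, F y x) - L * dist x x' := by
    rw [ciInf_sub (hb x)]
  linarith

theorem kantorovich {X : Type*} [MetricSpace X] [CompactSpace X] [Nonempty X]
    [MeasurableSpace X] [BorelSpace X]
    (μ ν : Measure X) [IsFiniteMeasure μ] [IsFiniteMeasure ν] (hm : μ univ = ν univ)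
    (hpos : μ univ ≠ 0) (c : C(X × X, ℝ)) (L : ℝ≥0)
    (hc1 : ∀ y, LipschitzWith L (fun x => c (x, y)))
    (hc2 : ∀ x, LipschitzWith L (fun y => c (x, y))) :
    ∃ (π : Measure (X × X)) (φ ψ : C(X, ℝ)), IsFiniteMeasure π ∧
      π.map Prod.fst = μ ∧ π.map Prod.snd = ν ∧ (∀ x y, φ x + ψ y ≤ c (x, y)) ∧
      ∀ᵐ p ∂π, φ p.1 + ψ p.2 = c p := by
  obtain ⟨π, hfin, hπ1, hπ2, hπ⟩ := kanto_primal μ ν hm hpos c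
  have x0 : X := Classical.arbitrary X
  set D := Metric.diam (univ : Set X)
  have hD : ∀ x y : X, dist x y ≤ D := fun x y =>
    Metric.dist_le_diam_of_mem isCompact_univ.isBounded (mem_univ _) (mem_univ _)
  have hD0 : 0 ≤ D := Metric.diam_nonneg
  set B : ℝ := ‖c‖ + 2 * L * D
  let P1 : Set (BoundedContinuousFunction X ℝ) := {f | LipschitzWith L f ∧ ∀ x, f x ∈ Icc (-B) B}
  have hP1 : IsCompact P1 := by
    apply BoundedContinuousFunction.arzela_ascoli₂ (Icc (-B) B) isCompact_Icc P1
    · have : P1 = (⋂ x, ⋂ y, {f | |f x - f y| ≤ L * dist x y}) ∩ ⋂ x, {f | f x ∈ Icc (-B) B} := by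
        ext f
        simp only [P1, mem_ofPred_eq, mem_inter_iff, mem_iInter, lipschitzWith_iff_dist_le_mul,
          Real.dist_eq]
      rw [this]
      apply IsClosed.inter
      · refine isClosed_iInter fun x => isClosed_iInter fun y => isClosed_le ?_ continuous_const
        exact ((continuous_eval_const _).sub
          (continuous_eval_const _)).abs
      · refine isClosed_iInter fun x => isClosed_Icc.preimage
          (continuous_eval_const _)
    · intro f x hf; exact hf.2 x
    · apply LipschitzWith.uniformEquicontinuous _ L (fun f => f.2.1) |>.equicontinuous
  let P : Set (BoundedContinuousFunction X ℝ × BoundedContinuousFunction X ℝ) :=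
    (P1 ×ˢ P1) ∩ {p | ∀ x y, p.1 x + p.2 y ≤ c (x, y)}
  have hP : IsCompact P := by
    apply (hP1.prod hP1).inter_right
    simp only [ofPred_forall]
    refine isClosed_iInter fun x => isClosed_iInter fun y => isClosed_le ?_ continuous_const
    exact ((continuous_eval_const _).comp continuous_fst).add
      ((continuous_eval_const _).comp continuous_snd)
  let I : BoundedContinuousFunction X ℝ × BoundedContinuousFunction X ℝ → ℝ := fun p =>
    ∫ x, p.1 x ∂μ + ∫ y, p.2 y ∂ν
  have hI : Continuous I := by
    have h1 : ∀ (μ : Measure X) [IsFiniteMeasure μ],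
        Continuous fun f : BoundedContinuousFunction X ℝ => ∫ x, f x ∂μ := by
      intro μ _
      have : LipschitzWith (μ.real univ).toNNReal
          (fun f : BoundedContinuousFunction X ℝ => ∫ x, f x ∂μ) := by
        apply LipschitzWith.of_dist_le_mul
        intro f f'
        rw [Real.dist_eq, ← integral_sub (f.integrable μ) (f'.integrable μ)]
        have := norm_integral_le_of_norm_le_const (μ := μ) (f := fun x => f x - f' x)
          (C := dist f f') (Filter.Eventually.of_forall fun x => by
            rw [← dist_eq_norm]; exact BoundedContinuousFunction.dist_coe_le_dist x)
        rw [Real.coe_toNNReal _ measureReal_nonneg, mul_comm]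
        exact this
      exact this.continuous
    exact ((h1 μ).comp continuous_fst).add ((h1 ν).comp continuous_snd)
  have hcB : ∀ p, |c p| ≤ ‖c‖ := fun p => c.norm_coe_le_norm p
  have hbd1 : ∀ (ψ : C(X, ℝ)) x, BddBelow (range fun y => c (x, y) - ψ y) := fun ψ x =>
    ⟨-‖c‖ - ‖ψ‖, by
      rintro _ ⟨y, rfl⟩
      have h1 := (abs_le.1 (hcB (x, y))).1
      have h2 := (abs_le.1 (ψ.norm_coe_le_norm y)).2
      simp only; linarith⟩
  have hbd2 : ∀ (φ : C(X, ℝ)) y, BddBelow (range fun x => c (x, y) - φ x) := fun φ y =>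
    ⟨-‖c‖ - ‖φ‖, by
      rintro _ ⟨x, rfl⟩
      have h1 := (abs_le.1 (hcB (x, y))).1
      have h2 := (abs_le.1 (φ.norm_coe_le_norm x)).2
      simp only; linarith⟩
  have himp : ∀ φ ψ : C(X, ℝ), (∀ x y, φ x + ψ y ≤ c (x, y)) → ∃ p ∈ P,
      ∫ x, φ x ∂μ + ∫ y, ψ y ∂ν ≤ I p := by
    intro φ ψ h
    have hφLipOne : LipschitzWith L (fun x => ⨅ y, (c (x, y) - ψ y)) := by
      apply lip_inf L (fun y x => c (x, y) - ψ y)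
      · intro y; simpa using (hc1 y).sub (LipschitzWith.const (ψ y))
      · exact hbd1 ψ
    let φ1 : C(X, ℝ) := ⟨fun x => ⨅ y, (c (x, y) - ψ y), hφLipOne.continuous⟩
    have hψLipOne : LipschitzWith L (fun y => ⨅ x, (c (x, y) - φ1 x)) := by
      apply lip_inf L (fun x y => c (x, y) - φ1 x)
      · intro x; simpa using (hc2 x).sub (LipschitzWith.const (φ1 x))
      · exact hbd2 φ1
    let ψ1 : C(X, ℝ) := ⟨fun y => ⨅ x, (c (x, y) - φ1 x), hψLipOne.continuous⟩
    have h1 : ∀ x, φ x ≤ φ1 x := fun x => le_ciInf fun y => by linarith [h x y]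
    have h12 : ∀ x y, φ1 x + ψ y ≤ c (x, y) := fun x y => by
      have := ciInf_le (hbd1 ψ x) y
      have h' : φ1 x ≤ c (x, y) - ψ y := this
      linarith
    have h2 : ∀ y, ψ y ≤ ψ1 y := fun y => le_ciInf fun x => by linarith [h12 x y]
    have h3 : ∀ x y, φ1 x + ψ1 y ≤ c (x, y) := fun x y => by
      have h' : ψ1 y ≤ c (x, y) - φ1 x := ciInf_le (hbd2 φ1 y) x
      linarith
    set k := φ1 x0
    have hφd : ∀ x, |φ1 x - k| ≤ L * D := fun x => by
      have := hφLipOne.dist_le_mul x x0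
      rw [Real.dist_eq] at this
      exact this.trans (mul_le_mul_of_nonneg_left (hD _ _) L.2)
    have hψlow : -‖c‖ - L * D ≤ ψ1 x0 + k := by
      have : -‖c‖ - L * D - k ≤ ψ1 x0 := le_ciInf fun x => by
        have h1 := (abs_le.1 (hcB (x, x0))).1
        have h2 := (abs_le.1 (hφd x)).2
        linarith
      linarith
    have hψup : ψ1 x0 + k ≤ ‖c‖ := by
      have := h3 x0 x0
      have h1 := (abs_le.1 (hcB (x0, x0))).2
      linarith
    have hψd : ∀ x, |ψ1 x - ψ1 x0| ≤ L * D := fun x => by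
      have := hψLipOne.dist_le_mul x x0
      rw [Real.dist_eq] at this
      exact this.trans (mul_le_mul_of_nonneg_left (hD _ _) L.2)
    have hLD : 0 ≤ L * D := mul_nonneg L.2 hD0
    have hc0 : 0 ≤ ‖c‖ := norm_nonneg _
    let φ2 : BoundedContinuousFunction X ℝ :=
      BoundedContinuousFunction.mkOfCompact (φ1 - ContinuousMap.const X k)
    let ψ2 : BoundedContinuousFunction X ℝ :=
      BoundedContinuousFunction.mkOfCompact (ψ1 + ContinuousMap.const X k)
    have e1 : ∀ x, φ2 x = φ1 x - k := fun x => rfl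
    have e2 : ∀ x, ψ2 x = ψ1 x + k := fun x => rfl
    refine ⟨(φ2, ψ2), ⟨⟨⟨?_, ?_⟩, ⟨?_, ?_⟩⟩, ?_⟩, ?_⟩
    · have := hφLipOne.sub (LipschitzWith.const k)
      rw [add_zero] at this
      exact this
    · intro x
      rw [e1]
      have := abs_le.1 (hφd x)
      constructor <;> simp only [B] <;> linarith
    · have := hψLipOne.add (LipschitzWith.const k)
      rw [add_zero] at this
      exact this
    · intro x
      rw [e2]
      have := abs_le.1 (hψd x)
      constructor <;> simp only [B] <;> linarith
    · intro x y
      show φ2 x + ψ2 y ≤ _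
      rw [e1, e2]; linarith [h3 x y]
    · simp only [I, e1, e2]
      have hi1 : ∀ f : C(X, ℝ), Integrable f μ := fun φ =>
        φ.continuous.integrable_of_hasCompactSupport (HasCompactSupport.of_compactSpace _)
      have hi2 : ∀ f : C(X, ℝ), Integrable f ν := fun φ =>
        φ.continuous.integrable_of_hasCompactSupport (HasCompactSupport.of_compactSpace _)
      rw [integral_sub (hi1 φ1) (integrable_const _), integral_add (hi2 ψ1) (integrable_const _)]
      have e3 : μ.real univ = ν.real univ := by simp [Measure.real, hm]
      simp only [integral_const, e3]
      have := integral_mono (hi1 φ) (hi1 φ1) h1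
      have := integral_mono (hi2 ψ) (hi2 ψ1) h2
      linarith
  have hPne : P.Nonempty := by
    obtain ⟨φ, ψ, h, -⟩ := hπ 1 one_pos
    obtain ⟨p, hp, -⟩ := himp φ ψ h
    exact ⟨p, hp⟩
  obtain ⟨⟨φ, ψ⟩, hpP, hmax⟩ := hP.exists_isMaxOn hPne hI.continuousOn
  refine ⟨π, φ.toContinuousMap, ψ.toContinuousMap, hfin, hπ1, hπ2, hpP.2, ?_⟩
  have hge : ∫ p, c p ∂π ≤ I (φ, ψ) := by
    apply le_of_forall_pos_le_add
    intro ε hε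
    obtain ⟨φ', ψ', h1, h2⟩ := hπ ε hε
    obtain ⟨p, hp, h3⟩ := himp φ' ψ' h1
    have := hmax hp
    simp only [mem_ofPred_eq] at this
    linarith
  have hcint : Integrable c π :=
    c.continuous.integrable_of_hasCompactSupport (HasCompactSupport.of_compactSpace _)
  have hi1 : Integrable (fun p : X × X => φ p.1) π :=
    (φ.continuous.comp continuous_fst).integrable_of_hasCompactSupport
      (HasCompactSupport.of_compactSpace _)
  have hi2 : Integrable (fun p : X × X => ψ p.2) π :=
    (ψ.continuous.comp continuous_snd).integrable_of_hasCompactSupport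
      (HasCompactSupport.of_compactSpace _)
  have hi12 : Integrable (fun p : X × X => φ p.1 + ψ p.2) π := hi1.add hi2
  have hIeq : I (φ, ψ) = ∫ p, (φ p.1 + ψ p.2) ∂π := by
    rw [integral_add hi1 hi2]
    simp only [I]
    rw [← hπ1, ← hπ2, integral_map (by fun_prop) (by fun_prop),
      integral_map (by fun_prop) (by fun_prop)]
  have h0 : ∫ p, (c p - (φ p.1 + ψ p.2)) ∂π = 0 := by
    apply le_antisymm
    · rw [integral_sub hcint hi12]
      linarith
    · apply integral_nonneg
      intro p
      have := hpP.2 p.1 p.2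
      simpa using this
  have h1 := (integral_eq_zero_iff_of_nonneg (fun p => by
    have := hpP.2 p.1 p.2
    simpa using this) (hcint.sub hi12)).1 h0
  filter_upwards [h1] with p hp
  simp only [Pi.zero_apply] at hp
  have : c p - (φ p.1 + ψ p.2) = 0 := hp
  show φ p.1 + ψ p.2 = c p
  linarith


theorem kanto_E {E : Type*} [NormedAddCommGroup E] [InnerProductSpace ℝ E]
    [FiniteDimensional ℝ E] [MeasureSpace E] [BorelSpace E]
    [(volume : Measure E).IsAddHaarMeasure] (Ω₀ Ω₁ : Set (E))
    (h₀meas : MeasurableSet Ω₀) (h₁meas : MeasurableSet Ω₁) (R : ℝ)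
    (h₀R : Ω₀ ⊆ Metric.closedBall 0 R) (h₁R : Ω₁ ⊆ Metric.closedBall 0 R)
    (hvol : volume Ω₀ = volume Ω₁) (hpos : 0 < volume Ω₀) :
    ∃ (π : Measure (E × E))
      (φ ψ : C(E, ℝ)), IsFiniteMeasure π ∧
      π.map Prod.fst = volume.restrict Ω₀ ∧ π.map Prod.snd = volume.restrict Ω₁ ∧
      (∀ x ∈ Metric.closedBall 0 R, ∀ y ∈ Metric.closedBall 0 R,
        φ x + ψ y ≤ ‖x - y‖ ^ 2) ∧
      (∀ᵐ p ∂π, p.1 ∈ Metric.closedBall (0 : E) R ∧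
        p.2 ∈ Metric.closedBall (0 : E) R ∧
        φ p.1 + ψ p.2 = ‖p.1 - p.2‖ ^ 2) := by
  set K : Set E := Metric.closedBall 0 R with hK
  have hKc : IsCompact K := isCompact_closedBall 0 R
  have hKm : MeasurableSet K := Metric.isClosed_closedBall.measurableSet
  have : CompactSpace K := isCompact_iff_compactSpace.1 hKc
  have hne : Ω₀.Nonempty := by
    rw [nonempty_iff_ne_empty]; rintro rfl; simp at hpos
  obtain ⟨x0, hx0⟩ := hne
  have : Nonempty K := ⟨⟨x0, h₀R hx0⟩⟩
  have hR : 0 ≤ R := by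
    have := h₀R hx0
    simp [hK] at this
    exact (norm_nonneg _).trans this
  set μ : Measure K := (volume.restrict Ω₀).comap Subtype.val with hμ
  set ν : Measure K := (volume.restrict Ω₁).comap Subtype.val with hν
  have hemb : MeasurableEmbedding (Subtype.val : K → E) := MeasurableEmbedding.subtype_coe hKm
  have hmap : ∀ Ω : Set E, MeasurableSet Ω → Ω ⊆ K →
      ((volume.restrict Ω).comap (Subtype.val : K → E)).map Subtype.val = volume.restrict Ω := by
    intro Ω hΩ hs
    rw [hemb.map_comap, Subtype.range_coe, Measure.restrict_restrict hKm,
      inter_eq_self_of_subset_right hs]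
  have huniv : ∀ Ω : Set E, MeasurableSet Ω → Ω ⊆ K →
      ((volume.restrict Ω).comap (Subtype.val : K → E)) univ = volume Ω := by
    intro Ω hΩ hs
    rw [hemb.comap_apply, image_univ, Subtype.range_coe, Measure.restrict_apply hKm,
      inter_eq_self_of_subset_right hs]
  have hfinv : ∀ Ω : Set E, Ω ⊆ K → volume Ω < ⊤ := fun Ω hs =>
    (measure_mono hs).trans_lt hKc.measure_lt_top
  have : IsFiniteMeasure μ := ⟨by rw [hμ, huniv _ h₀meas h₀R]; exact hfinv _ h₀R⟩
  have : IsFiniteMeasure ν := ⟨by rw [hν, huniv _ h₁meas h₁R]; exact hfinv _ h₁R⟩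
  let c : C(K × K, ℝ) := ⟨fun p => ‖(p.1 : E) - p.2‖ ^ 2, by fun_prop⟩
  have hlip : ∀ a b y : K, |‖(a : E) - y‖ ^ 2 - ‖(b : E) - y‖ ^ 2| ≤ (4 * R) * dist a b := by
    intro a b y
    have h1 : ‖(a : E) - y‖ ≤ 2 * R := by
      have h1 := a.2; have h2 := y.2
      simp only [hK, Metric.mem_closedBall, dist_zero_right] at h1 h2
      exact (norm_sub_le _ _).trans (by linarith)
    have h2 : ‖(b : E) - y‖ ≤ 2 * R := by
      have h1 := b.2; have h2 := y.2
      simp only [hK, Metric.mem_closedBall, dist_zero_right] at h1 h2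
      exact (norm_sub_le _ _).trans (by linarith)
    have h3 : |‖(a : E) - y‖ - ‖(b : E) - y‖| ≤ dist a b := by
      have := abs_norm_sub_norm_le ((a : E) - y) (b - y)
      rw [sub_sub_sub_cancel_right] at this
      rwa [Subtype.dist_eq, dist_eq_norm]
    have h4 : ‖(a : E) - y‖ ^ 2 - ‖(b : E) - y‖ ^ 2
      = (‖(a : E) - y‖ + ‖(b : E) - y‖) * (‖(a : E) - y‖ - ‖(b : E) - y‖) := by ring
    rw [h4, abs_mul]
    have h5 : |‖(a : E) - y‖ + ‖(b : E) - y‖| ≤ 4 * R := by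
      rw [abs_of_nonneg (by positivity)]; linarith
    exact mul_le_mul h5 h3 (abs_nonneg _) (by linarith)
  have hc1 : ∀ y, LipschitzWith (Real.toNNReal (4 * R)) (fun x => c (x, y)) := by
    intro y
    apply LipschitzWith.of_dist_le_mul
    intro a b
    rw [Real.coe_toNNReal _ (by linarith), Real.dist_eq]
    exact hlip a b y
  have hc2 : ∀ x, LipschitzWith (Real.toNNReal (4 * R)) (fun y => c (x, y)) := by
    intro y
    apply LipschitzWith.of_dist_le_mul
    intro a b
    rw [Real.coe_toNNReal _ (by linarith), Real.dist_eq]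
    have := hlip a b y
    rw [norm_sub_rev (a : E), norm_sub_rev (b : E)] at this
    exact this
  obtain ⟨π, φ, ψ, hfin, hπ1, hπ2, hle, heq⟩ := kantorovich μ ν
    (by rw [hμ, hν, huniv _ h₀meas h₀R, huniv _ h₁meas h₁R, hvol])
    (by rw [hμ, huniv _ h₀meas h₀R]; exact hpos.ne') c _ hc1 hc2
  obtain ⟨Φ, hΦ⟩ := φ.exists_restrict_eq (Metric.isClosed_closedBall)
  obtain ⟨Ψ, hΨ⟩ := ψ.exists_restrict_eq (Metric.isClosed_closedBall)
  have hΦ' : ∀ x : K, Φ x = φ x := fun x => by rw [← hΦ]; rfl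
  have hΨ' : ∀ x : K, Ψ x = ψ x := fun x => by rw [← hΨ]; rfl
  have hjm : Measurable (fun p : K × K => ((p.1 : E), (p.2 : E))) := by fun_prop
  have hje : MeasurableEmbedding (fun p : K × K => ((p.1 : E), (p.2 : E))) :=
    hemb.prodMap hemb
  refine ⟨π.map (fun p => ((p.1 : E), (p.2 : E))), Φ, Ψ, inferInstance, ?_, ?_, ?_, ?_⟩
  · rw [Measure.map_map measurable_fst hjm, ← hmap _ h₀meas h₀R, ← hμ, ← hπ1,
      Measure.map_map (by fun_prop) (by fun_prop)]
    rfl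
  · rw [Measure.map_map measurable_snd hjm, ← hmap _ h₁meas h₁R, ← hν, ← hπ2,
      Measure.map_map (by fun_prop) (by fun_prop)]
    rfl
  · intro x hx y hy
    have := hle ⟨x, hx⟩ ⟨y, hy⟩
    rw [← hΦ', ← hΨ'] at this
    exact this
  · rw [hje.ae_map_iff]
    filter_upwards [heq] with p hp
    refine ⟨p.1.2, p.2.2, ?_⟩
    rw [hΦ', hΨ', hp]
    rfl


theorem weak_fderiv {d : ℕ} (q : EuclideanSpace ℝ (Fin d) → ℝ → ℝ)
    (x : EuclideanSpace ℝ (Fin d)) (t : ℝ)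
    (hq : DifferentiableAt ℝ (fun z : EuclideanSpace ℝ (Fin d) × ℝ => q z.1 z.2) (x, t))
    (w : EuclideanSpace ℝ (Fin d)) :
    deriv (fun s => q x s) t + ⟪w, gradient (fun y => q y t) x⟫ =
      fderiv ℝ (fun z : EuclideanSpace ℝ (Fin d) × ℝ => q z.1 z.2) (x, t) (w, 1) := by
  have h := hq.hasFDerivAt
  set D := fderiv ℝ (fun z : EuclideanSpace ℝ (Fin d) × ℝ => q z.1 z.2) (x, t)
  have h1 : HasFDerivAt (fun s => q x s) (D.comp (ContinuousLinearMap.inr ℝ _ _)) t :=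
    HasFDerivAt.comp (f := fun s => (x, s)) t h (hasFDerivAt_prodMk_right x t)
  have h2 : HasFDerivAt (fun y => q y t) (D.comp (ContinuousLinearMap.inl ℝ _ _)) x :=
    HasFDerivAt.comp (f := fun y => (y, t)) x h (hasFDerivAt_prodMk_left x t)
  rw [h1.hasDerivAt.deriv, real_inner_comm, gradient, InnerProductSpace.toDual_symm_apply,
    h2.fderiv]
  simp only [ContinuousLinearMap.coe_comp, Function.comp_apply, ContinuousLinearMap.inr_apply,
    ContinuousLinearMap.inl_apply]
  rw [← map_add]
  simp

/-- The integrand in the weak formulation is integrable on the product. -/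
theorem weak_integrable {d : ℕ} {ρ : EuclideanSpace ℝ (Fin d) → ℝ → ℝ}
    {v : EuclideanSpace ℝ (Fin d) → ℝ → EuclideanSpace ℝ (Fin d)}
    (hρm : Measurable (fun q : EuclideanSpace ℝ (Fin d) × ℝ => ρ q.1 q.2))
    (hvm : Measurable (fun q : EuclideanSpace ℝ (Fin d) × ℝ => v q.1 q.2))
    (hρ : ∀ᵐ q ∂(spaceTime d), ρ q.1 q.2 = 0 ∨ ρ q.1 q.2 = 1)
    (hρi : Integrable (fun q : EuclideanSpace ℝ (Fin d) × ℝ => ρ q.1 q.2) (spaceTime d))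
    (hA : Integrable (fun q : EuclideanSpace ℝ (Fin d) × ℝ => ρ q.1 q.2 * ‖v q.1 q.2‖ ^ 2)
      (spaceTime d))
    (q : EuclideanSpace ℝ (Fin d) → ℝ → ℝ)
    (hq : ContDiff ℝ (⊤ : ℕ∞) (fun z : EuclideanSpace ℝ (Fin d) × ℝ => q z.1 z.2))
    (hqc : HasCompactSupport (fun z : EuclideanSpace ℝ (Fin d) × ℝ => q z.1 z.2)) :
    Integrable (fun z => ρ z.1 z.2 *
      fderiv ℝ (fun z : EuclideanSpace ℝ (Fin d) × ℝ => q z.1 z.2) z (v z.1 z.2, 1))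
      (spaceTime d) := by
  set D := fderiv ℝ (fun z : EuclideanSpace ℝ (Fin d) × ℝ => q z.1 z.2)
  have hDc : Continuous D := hq.continuous_fderiv (by simp)
  obtain ⟨C, hC⟩ := (hqc.fderiv (𝕜 := ℝ)).exists_bound_of_continuous hDc
  have hC0 : 0 ≤ C := (norm_nonneg _).trans (hC 0)
  apply Integrable.mono' (g := fun z => C * (2 * ρ z.1 z.2 + ρ z.1 z.2 * ‖v z.1 z.2‖ ^ 2))
  · exact ((hρi.const_mul 2).add hA).const_mul C
  · apply Measurable.aestronglyMeasurable
    apply hρm.mul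
    have : Continuous fun p : (EuclideanSpace ℝ (Fin d) × ℝ →L[ℝ] ℝ) ×
      (EuclideanSpace ℝ (Fin d) × ℝ) => p.1 p.2 := by fun_prop
    exact this.measurable.comp (hDc.measurable.prodMk (hvm.prodMk measurable_const))
  · filter_upwards [hρ] with z hz
    rcases hz with hz | hz
    · simp [hz]
    · rw [hz]
      simp only [one_mul, mul_one]
      refine ((D z).le_opNorm _).trans (mul_le_mul (hC z) ?_ (norm_nonneg _) hC0)
      rw [Prod.norm_def]
      apply max_le
      · nlinarith [sq_nonneg (‖v z.1 z.2‖ - 1)]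
      · simp; nlinarith [sq_nonneg (‖v z.1 z.2‖)]

theorem action_integrable {d : ℕ} {ρ : EuclideanSpace ℝ (Fin d) → ℝ → ℝ}
    {v : EuclideanSpace ℝ (Fin d) → ℝ → EuclideanSpace ℝ (Fin d)}
    (hρm : Measurable (fun q : EuclideanSpace ℝ (Fin d) × ℝ => ρ q.1 q.2))
    (hvm : Measurable (fun q : EuclideanSpace ℝ (Fin d) × ℝ => v q.1 q.2))
    (hρ : ∀ᵐ q ∂(spaceTime d), ρ q.1 q.2 = 0 ∨ ρ q.1 q.2 = 1)
    (hA : (∫⁻ q, ENNReal.ofReal (ρ q.1 q.2 * ‖v q.1 q.2‖ ^ 2) ∂(spaceTime d)) < ⊤) :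
    Integrable (fun q : EuclideanSpace ℝ (Fin d) × ℝ => ρ q.1 q.2 * ‖v q.1 q.2‖ ^ 2)
      (spaceTime d) := by
  refine ⟨(hρm.mul (hvm.norm.pow_const 2)).aestronglyMeasurable, ?_⟩
  rw [hasFiniteIntegral_iff_ofReal]
  · exact hA
  · filter_upwards [hρ] with z hz
    rcases hz with hz | hz <;> simp [hz]

theorem weak_bound {d : ℕ} {Ω₀ Ω₁ : Set (EuclideanSpace ℝ (Fin d))}
    {ρ : EuclideanSpace ℝ (Fin d) → ℝ → ℝ}
    {v : EuclideanSpace ℝ (Fin d) → ℝ → EuclideanSpace ℝ (Fin d)}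
    (h : ShapeAdmissible Ω₀ Ω₁ ρ v) (R : ℝ)
    (h₀meas : MeasurableSet Ω₀) (h₁meas : MeasurableSet Ω₁)
    (h₀R : Ω₀ ⊆ Metric.closedBall 0 R) (h₁R : Ω₁ ⊆ Metric.closedBall 0 R)
    (Q : EuclideanSpace ℝ (Fin d) × ℝ → ℝ) (δ C : ℝ) (hδ : 0 < δ)
    (hQ : ∀ z : EuclideanSpace ℝ (Fin d) × ℝ, -δ < z.2 → ContDiffAt ℝ (⊤ : ℕ∞) Q z)
    (hC : ∀ x, ∀ t ∈ Icc (0:ℝ) 1, |Q (x, t)| ≤ C)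
    (hD : ∀ x, ∀ t ∈ Icc (0:ℝ) 1, ∀ w, fderiv ℝ Q (x, t) (w, 1) ≤ ‖w‖ ^ 2) :
    (∫ x in Ω₁, Q (x, 1)) - (∫ x in Ω₀, Q (x, 0)) ≤
      ∫ z, ρ z.1 z.2 * ‖v z.1 z.2‖ ^ 2 ∂(spaceTime d) := by
  obtain ⟨hρm, hvm, hρ, hρi, hA, hw⟩ := h
  have hAi := action_integrable hρm hvm hρ hA
  set A := ∫ z, ρ z.1 z.2 * ‖v z.1 z.2‖ ^ 2 ∂(spaceTime d) with hAdef
  set B := ∫ z, ρ z.1 z.2 ∂(spaceTime d) with hBdef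
  have hC0 : 0 ≤ C := (abs_nonneg _).trans (hC 0 0 (by simp))
  let f : ContDiffBump (1/2 : ℝ) := ⟨1/2 + δ/4, 1/2 + δ/2, by positivity, by linarith⟩
  let χ : ContDiffBump (0 : EuclideanSpace ℝ (Fin d)) := ⟨1, 2, by norm_num, by norm_num⟩
  have hχd : ContDiff ℝ (⊤ : ℕ∞) χ := χ.contDiff
  obtain ⟨C', hC'⟩ := (χ.hasCompactSupport.fderiv (𝕜 := ℝ)).exists_bound_of_continuous
    (hχd.continuous_fderiv (by simp))
  have hC'0 : 0 ≤ C' := (norm_nonneg _).trans (hC' 0)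
  -- the estimate for each cutoff
  have key : ∀ n : ℕ, R ≤ n → 1 ≤ n →
      (∫ x in Ω₁, Q (x, 1)) - (∫ x in Ω₀, Q (x, 0)) ≤ A + (1 / (n:ℝ)) * (C * C' * (B + A)) := by
    intro n hn hn1
    have hnpos : (0:ℝ) < n := by exact_mod_cast hn1
    let q : EuclideanSpace ℝ (Fin d) → ℝ → ℝ := fun x t => Q (x, t) * χ ((1 / (n:ℝ)) • x) * f t
    have hχn : ContDiff ℝ (⊤ : ℕ∞) (fun x : EuclideanSpace ℝ (Fin d) => χ ((1 / (n:ℝ)) • x)) :=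
      hχd.comp (by fun_prop)
    have hqd : ContDiff ℝ (⊤ : ℕ∞) (fun z : EuclideanSpace ℝ (Fin d) × ℝ => q z.1 z.2) := by
      rw [contDiff_iff_contDiffAt]
      intro z
      by_cases hz : -δ < z.2
      · exact ((hQ z hz).mul (hχn.comp contDiff_fst).contDiffAt).mul
          (f.contDiff.comp contDiff_snd).contDiffAt
      · have : (fun z : EuclideanSpace ℝ (Fin d) × ℝ => q z.1 z.2) =ᶠ[nhds z] fun _ => 0 := by
          have : ∀ᶠ y : EuclideanSpace ℝ (Fin d) × ℝ in nhds z, y.2 < -δ/2 :=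
            continuousAt_snd.eventually_lt continuousAt_const (by linarith)
          filter_upwards [this] with y hy
          have : f y.2 = 0 := by
            apply f.zero_of_le_dist
            rw [Real.dist_eq, abs_of_neg (by linarith)]
            show 1/2 + δ/2 ≤ _
            linarith
          simp only [q, this, mul_zero]
        exact contDiffAt_const.congr_of_eventuallyEq this
    have hqc : HasCompactSupport (fun z : EuclideanSpace ℝ (Fin d) × ℝ => q z.1 z.2) := by
      apply HasCompactSupport.intro
        ((isCompact_closedBall (0 : EuclideanSpace ℝ (Fin d)) (2 * n)).prod
          (isCompact_closedBall (1/2 : ℝ) (1/2 + δ/2)))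
      intro z hz
      rw [mem_prod, not_and_or] at hz
      rcases hz with hz | hz
      · have : χ ((1 / (n:ℝ)) • z.1) = 0 := by
          apply χ.zero_of_le_dist
          rw [dist_zero_right, norm_smul, Real.norm_of_nonneg (by positivity)]
          simp only [Metric.mem_closedBall, dist_zero_right, not_le] at hz
          show (2:ℝ) ≤ _
          rw [one_div, inv_mul_eq_div, le_div_iff₀ hnpos]
          exact hz.le
        simp only [q, this, mul_zero, zero_mul]
      · have : f z.2 = 0 := by
          apply f.zero_of_le_dist
          simp only [Metric.mem_closedBall, not_le] at hz
          exact hz.le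
        simp [q, this]
    have hmemTwo := weak_integrable hρm hvm hρ hρi hAi q hqd hqc
    have hw' := hw q hqd hqc
    have e1 : (∫ t in Icc (0:ℝ) 1, ∫ x, ρ x t *
        (deriv (fun s => q x s) t + ⟪v x t, gradient (fun y => q y t) x⟫)) =
        ∫ z, ρ z.1 z.2 *
      fderiv ℝ (fun z : EuclideanSpace ℝ (Fin d) × ℝ => q z.1 z.2) z (v z.1 z.2, 1)
        ∂(spaceTime d) := by
      rw [spaceTime, integral_prod_symm _ hmemTwo]
      apply integral_congr_ae
      refine Filter.Eventually.of_forall fun t => ?_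
      apply integral_congr_ae
      refine Filter.Eventually.of_forall fun x => ?_
      simp only
      rw [weak_fderiv q x t (hqd.differentiable (by simp)).differentiableAt]
    have hf1 : ∀ t : ℝ, |t - 1/2| ≤ 1/2 + δ/4 → f t = 1 := fun t ht =>
      f.one_of_mem_closedBall (by rw [Metric.mem_closedBall, Real.dist_eq]; exact ht)
    have hχ1 : ∀ x ∈ Metric.closedBall (0 : EuclideanSpace ℝ (Fin d)) R,
        χ ((1 / (n:ℝ)) • x) = 1 := by
      intro x hx
      apply χ.one_of_mem_closedBall
      rw [Metric.mem_closedBall, dist_zero_right, norm_smul,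
        Real.norm_of_nonneg (by positivity)]
      rw [Metric.mem_closedBall, dist_zero_right] at hx
      show _ ≤ (1:ℝ)
      rw [one_div, inv_mul_eq_div, div_le_one hnpos]
      linarith
    have e2 : ∫ x in Ω₁, q x 1 = ∫ x in Ω₁, Q (x, 1) := by
      apply setIntegral_congr_fun h₁meas
      intro x hx
      simp only [q]
      rw [hχ1 x (h₁R hx), hf1 1 (by rw [abs_of_pos] <;> linarith)]
      ring
    have e3 : ∫ x in Ω₀, q x 0 = ∫ x in Ω₀, Q (x, 0) := by
      apply setIntegral_congr_fun h₀meas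
      intro x hx
      simp only [q]
      rw [hχ1 x (h₀R hx), hf1 0 (by rw [abs_of_neg] <;> linarith)]
      ring
    rw [e1, e2, e3] at hw'
    rw [← hw']
    have htime : ∀ᵐ z ∂(spaceTime d), z.2 ∈ Icc (0:ℝ) 1 := by
      rw [spaceTime]
      apply Measure.quasiMeasurePreserving_snd.ae
      exact ae_restrict_mem measurableSet_Icc
    have hmono : ∀ᵐ z ∂(spaceTime d), ρ z.1 z.2 *
        fderiv ℝ (fun z : EuclideanSpace ℝ (Fin d) × ℝ => q z.1 z.2) z (v z.1 z.2, 1) ≤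
        ρ z.1 z.2 * ‖v z.1 z.2‖ ^ 2 + (1 / (n:ℝ)) * (C * C' * (ρ z.1 z.2 +
          ρ z.1 z.2 * ‖v z.1 z.2‖ ^ 2)) := by
      filter_upwards [hρ, htime] with z hz hzt
      rcases hz with hz | hz
      · simp [hz]
      rw [hz]
      simp only [one_mul]
      set w := v z.1 z.2
      have heq : (fun z : EuclideanSpace ℝ (Fin d) × ℝ => q z.1 z.2) =ᶠ[nhds z]
          fun z => Q z * χ ((1 / (n:ℝ)) • z.1) := by
        have h1 : ∀ᶠ y : EuclideanSpace ℝ (Fin d) × ℝ in nhds z, -(δ/4) < y.2 :=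
            continuousAt_const.eventually_lt continuousAt_snd (by linarith [hzt.1])
        have h2 : ∀ᶠ y : EuclideanSpace ℝ (Fin d) × ℝ in nhds z, y.2 < 1 + δ/4 :=
            continuousAt_snd.eventually_lt continuousAt_const (by linarith [hzt.2])
        filter_upwards [h1, h2] with y hy1 hy2
        simp only [q]
        rw [hf1 y.2 (by rw [abs_le]; constructor <;> linarith), mul_one]
      rw [heq.fderiv_eq]
      have hQz : HasFDerivAt Q (fderiv ℝ Q z) z :=
        ((hQ z (by linarith [hzt.1])).differentiableAt (by simp)).hasFDerivAt
      have hχz : HasFDerivAt (fun x : EuclideanSpace ℝ (Fin d) => χ ((1 / (n:ℝ)) • x))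
          ((1 / (n:ℝ)) • fderiv ℝ χ ((1 / (n:ℝ)) • z.1)) z.1 := by
        have h1 : HasFDerivAt χ (fderiv ℝ χ ((1 / (n:ℝ)) • z.1)) ((1 / (n:ℝ)) • z.1) :=
          (hχd.differentiable (by simp)).differentiableAt.hasFDerivAt
        have h2 := HasFDerivAt.comp (f := fun x : EuclideanSpace ℝ (Fin d) => (1 / (n:ℝ)) • x)
          z.1 h1 ((hasFDerivAt_id z.1).const_smul (1 / (n:ℝ)))
        refine h2.congr_fderiv ?_
        ext y
        simp
      have hχz' : HasFDerivAt (fun y : EuclideanSpace ℝ (Fin d) × ℝ => χ ((1 / (n:ℝ)) • y.1))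
          (((1 / (n:ℝ)) • fderiv ℝ χ ((1 / (n:ℝ)) • z.1)).comp
            (ContinuousLinearMap.fst ℝ _ _)) z :=
        hχz.comp z hasFDerivAt_fst
      have hprod : HasFDerivAt (fun z => Q z * χ ((1 / (n:ℝ)) • z.1)) _ z := hQz.mul hχz'
      rw [hprod.fderiv]
      simp only [add_apply, smul_apply,
        ContinuousLinearMap.comp_apply, ContinuousLinearMap.coe_fst', smul_eq_mul]
      have hd1 := hD z.1 z.2 hzt w
      have hχ01 : 0 ≤ χ ((1 / (n:ℝ)) • z.1) ∧ χ ((1 / (n:ℝ)) • z.1) ≤ 1 :=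
        ⟨χ.nonneg, χ.le_one⟩
      have hb1 : χ ((1 / (n:ℝ)) • z.1) * fderiv ℝ Q z (w, 1) ≤ ‖w‖ ^ 2 := by
        calc _ ≤ χ ((1 / (n:ℝ)) • z.1) * ‖w‖ ^ 2 := mul_le_mul_of_nonneg_left hd1 hχ01.1
          _ ≤ 1 * ‖w‖ ^ 2 := mul_le_mul_of_nonneg_right hχ01.2 (by positivity)
          _ = _ := one_mul _
      have hb2 : |fderiv ℝ χ ((1 / (n:ℝ)) • z.1) w| ≤ C' * (1 + ‖w‖ ^ 2) := by
        refine ((fderiv ℝ χ ((1 / (n:ℝ)) • z.1)).le_opNorm w).trans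
          (mul_le_mul (hC' _) ?_ (norm_nonneg _) hC'0)
        nlinarith [sq_nonneg (‖w‖ - 1)]
      have hb3 : Q z * fderiv ℝ χ ((1 / (n:ℝ)) • z.1) w ≤ C * (C' * (1 + ‖w‖ ^ 2)) := by
        refine (le_abs_self _).trans ?_
        rw [abs_mul]
        exact mul_le_mul (hC z.1 z.2 hzt) hb2 (abs_nonneg _) hC0
      have hb4 : (1 / (n:ℝ)) * (Q z * fderiv ℝ χ ((1 / (n:ℝ)) • z.1) w) ≤
          (1 / (n:ℝ)) * (C * (C' * (1 + ‖w‖ ^ 2))) :=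
        mul_le_mul_of_nonneg_left hb3 (by positivity)
      linarith
    have hr : Integrable (fun z : EuclideanSpace ℝ (Fin d) × ℝ =>
        (1 / (n:ℝ)) * (C * C' * (ρ z.1 z.2 +
          ρ z.1 z.2 * ‖v z.1 z.2‖ ^ 2))) (spaceTime d) :=
      ((hρi.add hAi).const_mul _).const_mul _
    calc _ ≤ ∫ z, (ρ z.1 z.2 * ‖v z.1 z.2‖ ^ 2 + (1 / (n:ℝ)) * (C * C' * (ρ z.1 z.2 +
          ρ z.1 z.2 * ‖v z.1 z.2‖ ^ 2))) ∂(spaceTime d) :=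
        integral_mono_ae hmemTwo (hAi.add hr) hmono
      _ = _ := by
        rw [integral_add hAi hr, integral_const_mul, integral_const_mul, integral_add hρi hAi]
  have hlim : Filter.Tendsto (fun n : ℕ => A + (1 / (n:ℝ)) * (C * C' * (B + A))) Filter.atTop
      (nhds (A + 0 * (C * C' * (B + A)))) :=
    tendsto_const_nhds.add (tendsto_one_div_atTop_nhds_zero_nat.mul_const _)
  rw [zero_mul, add_zero] at hlim
  refine ge_of_tendsto hlim ?_
  obtain ⟨n0, hn0⟩ := exists_nat_ge R
  filter_upwards [Filter.eventually_ge_atTop n0, Filter.eventually_ge_atTop 1] with n h1 h2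
  exact key n (hn0.trans (by exact_mod_cast h1)) h2


/-- quadratic inequality -/
theorem quad_ineq {E : Type*} [NormedAddCommGroup E] [InnerProductSpace ℝ E] (a w : E) (s : ℝ)
    (hs : 0 < s) : -(‖a‖ ^ 2) / s ^ 2 + 2 * ⟪a, w⟫ / s ≤ ‖w‖ ^ 2 := by
  have h := real_inner_le_norm a w
  have h0 : 0 ≤ (‖a‖ / s - ‖w‖) ^ 2 := sq_nonneg _
  have h1 : 2 * ⟪a, w⟫ / s ≤ 2 * (‖a‖ * ‖w‖) / s := by gcongr
  have h2 : (‖a‖ / s - ‖w‖) ^ 2 = ‖a‖ ^ 2 / s ^ 2 - 2 * (‖a‖ * ‖w‖) / s + ‖w‖ ^ 2 := by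
    field_simp
    ring
  rw [neg_div]
  linarith

theorem qi_hasFDerivAt {E : Type*} [NormedAddCommGroup E] [InnerProductSpace ℝ E] (y : E)
    (c δ : ℝ) (z : E × ℝ) (hz : -δ < z.2) :
    ∃ D : E × ℝ →L[ℝ] ℝ,
      HasFDerivAt (fun z : E × ℝ => c + ‖z.1 - y‖ ^ 2 / (z.2 + δ)) D z ∧
      ∀ w, D (w, 1) ≤ ‖w‖ ^ 2 := by
  have hpos : 0 < z.2 + δ := by linarith
  have h1 : HasFDerivAt (fun z : E × ℝ => ‖z.1 - y‖ ^ 2) _ z :=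
    ((hasFDerivAt_fst (𝕜 := ℝ) (E := E) (F := ℝ) (p := z)).sub_const y).norm_sq
  have h2 : HasFDerivAt (fun z : E × ℝ => (z.2 + δ)⁻¹) _ z :=
    (hasDerivAt_inv hpos.ne').comp_hasFDerivAt (f := fun z : E × ℝ => z.2 + δ) z
      ((hasFDerivAt_snd (𝕜 := ℝ) (E := E) (F := ℝ) (p := z)).add_const δ)
  have h3 : HasFDerivAt (fun z : E × ℝ => ‖z.1 - y‖ ^ 2 * (z.2 + δ)⁻¹) _ z := h1.mul h2
  refine ⟨_, (h3.const_add c), ?_⟩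
  intro w
  have := quad_ineq (z.1 - y) w _ hpos
  refine le_trans (le_of_eq ?_) this
  simp
  field_simp
  rw [inner_sub_left]

theorem softmin {E : Type*} [NormedAddCommGroup E] [InnerProductSpace ℝ E] (s : Finset E)
    (φ : E → ℝ) (δ ε K₀ : ℝ) (hδ : 0 < δ) (hε : 0 < ε) :
    ∃ (Q : E × ℝ → ℝ) (C : ℝ),
      (∀ z : E × ℝ, -δ < z.2 → ContDiffAt ℝ (⊤ : ℕ∞) Q z) ∧
      (∀ x, ∀ t ∈ Icc (0:ℝ) 1, |Q (x, t)| ≤ C) ∧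
      (∀ x, ∀ t ∈ Icc (0:ℝ) 1, ∀ w, fderiv ℝ Q (x, t) (w, 1) ≤ ‖w‖ ^ 2) ∧
      (∀ x, ∀ y ∈ s, Q (x, 0) ≤ -φ y + ‖x - y‖ ^ 2 / δ) ∧
      (∀ x m, (∀ y ∈ s, m ≤ -φ y + ‖x - y‖ ^ 2 / (1 + δ)) → m ≤ K₀ →
        m - ε * Real.log (s.card + 1) ≤ Q (x, 1)) := by
  let g : E → E × ℝ → ℝ := fun y z => -φ y + ‖z.1 - y‖ ^ 2 / (z.2 + δ)
  let S : E × ℝ → ℝ := fun z => ∑ y ∈ s, Real.exp (-(g y z) / ε) + Real.exp (-K₀ / ε)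
  have hSK : ∀ z, Real.exp (-K₀ / ε) ≤ S z := fun z => by
    have : 0 ≤ ∑ y ∈ s, Real.exp (-(g y z) / ε) := Finset.sum_nonneg fun _ _ => (Real.exp_pos _).le
    simp only [S]; linarith
  have hSpos : ∀ z, 0 < S z := fun z => (Real.exp_pos _).trans_le (hSK z)
  have hlow : ∀ z m, Real.exp (-m / ε) ≤ S z → -ε * Real.log (S z) ≤ m := by
    intro z m h
    have := Real.log_le_log (Real.exp_pos _) h
    rw [Real.log_exp, div_le_iff₀ hε] at this
    linarith
  let B := ∑ y ∈ s, Real.exp (φ y / ε) + Real.exp (-K₀ / ε)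
  refine ⟨fun z => -ε * Real.log (S z), max |K₀| |ε * Real.log B|, ?_, ?_, ?_, ?_, ?_⟩
  · intro z hz
    have hg : ∀ y, ContDiffAt ℝ (⊤ : ℕ∞) (g y) z := by
      intro y
      apply contDiffAt_const.add
      apply ContDiffAt.div
      · exact (contDiffAt_fst.sub contDiffAt_const).norm_sq ℝ
      · exact contDiffAt_snd.add contDiffAt_const
      · linarith
    apply contDiffAt_const.mul
    apply ContDiffAt.log _ (hSpos z).ne'
    apply ContDiffAt.add _ contDiffAt_const
    apply ContDiffAt.sum
    intro y _
    exact ((hg y).neg.div_const ε).exp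
  · intro x t ht
    have hSB : S (x, t) ≤ B := by
      simp only [S, B]
      gcongr with y hy
      simp only [g]
      have : 0 ≤ ‖x - y‖ ^ 2 / (t + δ) := div_nonneg (by positivity) (by linarith [ht.1])
      linarith
    have h1 := hlow (x, t) K₀ (hSK _)
    have h2 := Real.log_le_log (hSpos _) hSB
    have h3 : ε * Real.log (S (x,t)) ≤ ε * Real.log B := mul_le_mul_of_nonneg_left h2 hε.le
    have h4 := le_abs_self K₀
    have h5 := le_abs_self (ε * Real.log B)
    have h6 := le_max_left |K₀| |ε * Real.log B|
    have h7 := le_max_right |K₀| |ε * Real.log B|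
    rw [abs_le]
    constructor <;> linarith
  · intro x t ht w
    have hz : -δ < (x, t).2 := by have := ht.1; show -δ < t; linarith
    choose D hD hDw using fun y => qi_hasFDerivAt y (-φ y) δ (x, t) hz
    have h1 : ∀ y, HasFDerivAt (fun z => Real.exp (-(g y z) / ε))
        (Real.exp (-(g y (x,t)) / ε) • ((-ε⁻¹) • D y)) (x, t) := by
      intro y
      have := ((hD y).const_mul (-ε⁻¹)).exp
      refine (this.congr_of_eventuallyEq ?_).congr_fderiv ?_
      · refine Filter.Eventually.of_forall fun z => ?_
        simp only [g]
        congr 1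
        field_simp
      · congr 2
        simp only [g]
        field_simp
    have h2 : HasFDerivAt S (∑ y ∈ s, Real.exp (-(g y (x,t)) / ε) • ((-ε⁻¹) • D y)) (x, t) :=
      (HasFDerivAt.fun_sum fun y _ => h1 y).add_const _
    have h3 := (h2.log (hSpos _).ne').const_mul (-ε)
    rw [h3.fderiv]
    have hS := hSpos (x, t)
    have e : ((-ε) • (S (x, t))⁻¹ • ∑ y ∈ s, Real.exp (-(g y (x,t)) / ε) • ((-ε⁻¹) • D y)) (w, 1)
        = (S (x,t))⁻¹ * ∑ y ∈ s, Real.exp (-(g y (x,t)) / ε) * D y (w, 1) := by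
      simp only [smul_apply, sum_apply, smul_eq_mul, Finset.mul_sum]
      apply Finset.sum_congr rfl
      intro y _
      field_simp
    rw [e, inv_mul_le_iff₀ hS]
    calc _ ≤ ∑ y ∈ s, Real.exp (-(g y (x,t)) / ε) * ‖w‖ ^ 2 := by
          gcongr with y hy
          exact hDw y w
      _ = (∑ y ∈ s, Real.exp (-(g y (x,t)) / ε)) * ‖w‖ ^ 2 := by rw [Finset.sum_mul]
      _ ≤ S (x, t) * ‖w‖ ^ 2 := by
          gcongr
          simp only [S]
          linarith [Real.exp_pos (-K₀ / ε)]
  · intro x y hy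
    apply hlow
    have e : -(-φ y + ‖x - y‖ ^ 2 / δ) / ε = -(g y (x, 0)) / ε := by simp [g]
    rw [e]
    have := Finset.single_le_sum (f := fun y => Real.exp (-(g y (x, 0)) / ε))
      (fun _ _ => (Real.exp_pos _).le) hy
    simp only [S]
    linarith [Real.exp_pos (-K₀ / ε)]
  · intro x m hm hK
    have h1 : S (x, 1) ≤ (s.card + 1) * Real.exp (-m / ε) := by
      have : ∑ y ∈ s, Real.exp (-(g y (x,1)) / ε) ≤ s.card • Real.exp (-m / ε) := by
        apply Finset.sum_le_card_nsmul
        intro y hy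
        have := hm y hy
        gcongr
      have h2 : Real.exp (-K₀ / ε) ≤ Real.exp (-m / ε) := by gcongr
      rw [nsmul_eq_mul] at this
      simp only [S]
      linarith
    have h2 := Real.log_le_log (hSpos _) h1
    rw [Real.log_mul (by positivity) (Real.exp_pos _).ne', Real.log_exp] at h2
    have h3 := mul_le_mul_of_nonneg_left h2 hε.le
    have h4 : ε * (Real.log (s.card + 1) + -m / ε) = ε * Real.log (s.card + 1) - m := by
      field_simp
      ring
    linarith

theorem dir1 {d : ℕ} {Ω₀ Ω₁ : Set (EuclideanSpace ℝ (Fin d))}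
    {ρ : EuclideanSpace ℝ (Fin d) → ℝ → ℝ}
    {v : EuclideanSpace ℝ (Fin d) → ℝ → EuclideanSpace ℝ (Fin d)}
    (h : ShapeAdmissible Ω₀ Ω₁ ρ v) (R : ℝ)
    (h₀meas : MeasurableSet Ω₀) (h₁meas : MeasurableSet Ω₁)
    (h₀R : Ω₀ ⊆ Metric.closedBall 0 R) (h₁R : Ω₁ ⊆ Metric.closedBall 0 R)
    (φ ψ : C(EuclideanSpace ℝ (Fin d), ℝ))
    (hle : ∀ x ∈ Metric.closedBall 0 R, ∀ y ∈ Metric.closedBall 0 R,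
        φ x + ψ y ≤ ‖x - y‖ ^ 2) :
    (∫ x in Ω₀, φ x) + (∫ x in Ω₁, ψ x) ≤
      ∫ z, ρ z.1 z.2 * ‖v z.1 z.2‖ ^ 2 ∂(spaceTime d) := by
  set A := ∫ z, ρ z.1 z.2 * ‖v z.1 z.2‖ ^ 2 ∂(spaceTime d)
  have hKc : IsCompact (Metric.closedBall (0 : EuclideanSpace ℝ (Fin d)) R) :=
    isCompact_closedBall 0 R
  set K := Metric.closedBall (0 : EuclideanSpace ℝ (Fin d)) R with hK
  have hf0 : volume Ω₀ ≠ ⊤ := ((measure_mono h₀R).trans_lt hKc.measure_lt_top).ne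
  have hf1 : volume Ω₁ ≠ ⊤ := ((measure_mono h₁R).trans_lt hKc.measure_lt_top).ne
  have main : ∀ η : ℝ, 0 < η → (∫ x in Ω₀, φ x) + (∫ x in Ω₁, ψ x) ≤
      A + η * (2 * (volume.real Ω₀ + volume.real Ω₁)) := by
    intro η hη
    obtain ⟨δ, hδ, hδR⟩ : ∃ δ : ℝ, 0 < δ ∧ δ * (4 * R ^ 2) ≤ η := by
      refine ⟨η / (4 * R ^ 2 + 1), by positivity, ?_⟩
      rw [div_mul_eq_mul_div, div_le_iff₀ (by positivity)]
      nlinarith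
    obtain ⟨h1, hh1, hφ⟩ := Metric.uniformContinuousOn_iff.1
      (hKc.uniformContinuousOn_of_continuous φ.continuous.continuousOn) η hη
    obtain ⟨h2, hh2, hh2'⟩ : ∃ h : ℝ, 0 < h ∧ h ^ 2 / δ ≤ η := by
      refine ⟨Real.sqrt (η * δ), Real.sqrt_pos.2 (by positivity), ?_⟩
      rw [Real.sq_sqrt (by positivity), mul_div_cancel_right₀ _ hδ.ne']
    obtain ⟨s, hsK, hs⟩ := hKc.elim_nhds_subcover (fun x => Metric.ball x (min h1 h2))
      (fun x _ => Metric.ball_mem_nhds _ (lt_min hh1 hh2))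
    obtain ⟨K₀, hK₀⟩ := hKc.bddAbove_image ψ.continuous.continuousOn
    have hlogpos : 0 ≤ Real.log (s.card + 1) := Real.log_nonneg (by simp)
    obtain ⟨ε, hε, hεl⟩ : ∃ ε : ℝ, 0 < ε ∧ ε * Real.log (s.card + 1) ≤ η := by
      refine ⟨η / (Real.log (s.card + 1) + 1), by positivity, ?_⟩
      rw [div_mul_eq_mul_div, div_le_iff₀ (by positivity)]
      nlinarith
    obtain ⟨Q, C, hQ1, hQ2, hQ3, hQ4, hQ5⟩ := softmin s φ δ ε K₀ hδ hε
    have hb := weak_bound h R h₀meas h₁meas h₀R h₁R Q δ C hδ hQ1 hQ2 hQ3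
    have hub : ∀ x ∈ Ω₀, Q (x, 0) ≤ -φ x + 2 * η := by
      intro x hx
      have hxK := h₀R hx
      obtain ⟨y, hy, hxy⟩ := mem_iUnion₂.1 (hs hxK)
      rw [Metric.mem_ball] at hxy
      have a1 := hφ x hxK y (hsK y hy) (hxy.trans_le (min_le_left _ _))
      have a2 := hxy.trans_le (min_le_right _ _)
      rw [dist_eq_norm] at a2
      rw [Real.dist_eq, abs_lt] at a1
      have a3 := hQ4 x y hy
      have a4 : ‖x - y‖ ^ 2 / δ ≤ h2 ^ 2 / δ := by gcongr
      linarith [a1.1, a1.2]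
    have hlb : ∀ x ∈ Ω₁, ψ x - 2 * η ≤ Q (x, 1) := by
      intro x hx
      have hxK := h₁R hx
      have := hQ5 x (ψ x - η) (fun y hy => by
        have b1 := hle y (hsK y hy) x hxK
        have b2 : ‖x - y‖ ≤ 2 * R := by
          have c1 := hsK y hy
          have c2 := hxK
          simp only [hK, Metric.mem_closedBall, dist_zero_right] at c1 c2
          exact (norm_sub_le _ _).trans (by linarith)
        have b3 : ‖x - y‖ ^ 2 - δ * ‖x - y‖ ^ 2 ≤ ‖x - y‖ ^ 2 / (1 + δ) := by
          rw [le_div_iff₀ (by positivity)]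
          nlinarith [mul_nonneg (sq_nonneg δ) (sq_nonneg ‖x - y‖)]
        have b4 : ‖x - y‖ ^ 2 ≤ 4 * R ^ 2 := by
          have := norm_nonneg (x - y)
          nlinarith
        have b5 : δ * ‖x - y‖ ^ 2 ≤ δ * (4 * R ^ 2) := by gcongr
        rw [norm_sub_rev] at b1
        linarith) (by
        have := hK₀ (mem_image_of_mem ψ hxK)
        linarith)
      linarith
    have iφ : IntegrableOn φ Ω₀ := (φ.continuous.continuousOn.integrableOn_compact hKc).mono_set h₀R
    have iψ : IntegrableOn ψ Ω₁ := (ψ.continuous.continuousOn.integrableOn_compact hKc).mono_set h₁R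
    have hQc : ∀ t ∈ Icc (0:ℝ) 1, Continuous fun x => Q (x, t) := by
      intro t ht
      rw [continuous_iff_continuousAt]
      intro x
      exact ContinuousAt.comp (f := fun x => (x, t)) (g := Q)
        ((hQ1 (x, t) (by have := ht.1; show -δ < t; linarith)).continuousAt) (by fun_prop)
    have iQ0 : IntegrableOn (fun x => Q (x, 0)) Ω₀ :=
      ((hQc 0 (by simp)).continuousOn.integrableOn_compact hKc).mono_set h₀R
    have iQ1 : IntegrableOn (fun x => Q (x, 1)) Ω₁ :=
      ((hQc 1 (by simp)).continuousOn.integrableOn_compact hKc).mono_set h₁R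
    have i0 : IntegrableOn (fun _ : EuclideanSpace ℝ (Fin d) => 2 * η) Ω₀ :=
      integrableOn_const hf0
    have i1 : IntegrableOn (fun _ : EuclideanSpace ℝ (Fin d) => 2 * η) Ω₁ :=
      integrableOn_const hf1
    have c0 : ∫ x in Ω₀, Q (x, 0) ≤ -(∫ x in Ω₀, φ x) + 2 * η * volume.real Ω₀ := by
      calc _ ≤ ∫ x in Ω₀, (-φ x + 2 * η) := setIntegral_mono_on iQ0 (iφ.neg.add i0) h₀meas hub
        _ = _ := by
          have iφn : IntegrableOn (fun x => -φ x) Ω₀ := iφ.neg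
          rw [integral_add iφn i0, setIntegral_const, smul_eq_mul]
          rw [integral_neg]; ring
    have c1 : (∫ x in Ω₁, ψ x) - 2 * η * volume.real Ω₁ ≤ ∫ x in Ω₁, Q (x, 1) := by
      calc _ = ∫ x in Ω₁, (ψ x - 2 * η) := by
            rw [integral_sub iψ i1, setIntegral_const, smul_eq_mul]; ring
        _ ≤ _ := setIntegral_mono_on (iψ.sub i1) iQ1 h₁meas hlb
    linarith
  set B := 2 * (volume.real Ω₀ + volume.real Ω₁)
  have hB : 0 ≤ B := by positivity
  apply le_of_forall_pos_le_add
  intro η hη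
  refine (main (η / (B + 1)) (by positivity)).trans ?_
  gcongr
  rw [div_mul_eq_mul_div, div_le_iff₀ (by positivity)]
  nlinarith


theorem riesz_abs {T H : Type*} [AddCommGroup T] [Module ℝ T] [NormedAddCommGroup H]
    [InnerProductSpace ℝ H] [CompleteSpace H] (G : T →ₗ[ℝ] H) (L : T →ₗ[ℝ] ℝ) (C : ℝ)
    (hC : 0 ≤ C) (h : ∀ q, |L q| ≤ C * ‖G q‖) :
    ∃ V : H, ‖V‖ ≤ C ∧ ∀ q, ⟪V, G q⟫ = L q := by
  have hker : LinearMap.ker G ≤ LinearMap.ker L := by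
    intro q hq
    rw [LinearMap.mem_ker] at hq ⊢
    have := h q
    rw [hq, norm_zero, mul_zero] at this
    exact abs_eq_zero.1 (le_antisymm this (abs_nonneg _))
  let F : (LinearMap.range G) →ₗ[ℝ] ℝ :=
    ((LinearMap.ker G).liftQ L hker).comp (G.quotKerEquivRange.symm : _ →ₗ[ℝ] _)
  have hF : ∀ q, F ⟨G q, LinearMap.mem_range_self G q⟩ = L q := by
    intro q
    have : G.quotKerEquivRange.symm ⟨G q, LinearMap.mem_range_self G q⟩
        = (LinearMap.ker G).mkQ q := by
      rw [LinearEquiv.symm_apply_eq]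
      rfl
    simp only [F, LinearMap.comp_apply, LinearEquiv.coe_coe]
    rw [this]
    simp
  have hFb : ∀ x, ‖F x‖ ≤ C * ‖x‖ := by
    rintro ⟨x, q, rfl⟩
    rw [hF]
    exact h q
  obtain ⟨g, hg, hgn⟩ := exists_extension_norm_eq (LinearMap.range G) (F.mkContinuous C hFb)
  refine ⟨(InnerProductSpace.toDual ℝ H).symm g, ?_, ?_⟩
  · rw [LinearIsometryEquiv.norm_map, hgn]
    exact F.mkContinuous_norm_le hC hFb
  · intro q
    rw [InnerProductSpace.toDual_symm_apply]
    have := hg ⟨G q, LinearMap.mem_range_self G q⟩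
    rw [this]
    exact hF q

theorem path_bound {E : Type*} [NormedAddCommGroup E] [NormedSpace ℝ E] [FiniteDimensional ℝ E]
    (q : E × ℝ → ℝ) (hq : ContDiff ℝ (⊤ : ℕ∞) q) (hqc : HasCompactSupport q)
    (y : ℝ → E) (k : ℝ≥0) (hy : LipschitzWith k y) :
    |q (y 1, 1) - q (y 0, 0) - ∫ t in Icc (0:ℝ) 1, fderiv ℝ q (y t, t) (0, 1)| ≤
      ∫ t in Icc (0:ℝ) 1, k * ‖(fderiv ℝ q (y t, t)).comp (ContinuousLinearMap.inl ℝ E ℝ)‖ := by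
  have hDc : Continuous (fderiv ℝ q) := hq.continuous_fderiv (by simp)
  have hyc := hy.continuous
  obtain ⟨C, hC⟩ := hq.lipschitzWith_of_hasCompactSupport hqc (by simp)
  have hp : LipschitzWith _ (fun t => q (y t, t)) := hC.comp (hy.prodMk LipschitzWith.id)
  have hac : AbsolutelyContinuousOnInterval (fun t => q (y t, t)) 0 1 :=
    hp.lipschitzOnWith.absolutelyContinuousOnInterval
  have hftc := hac.integral_deriv_eq_sub
  have hii := hac.intervalIntegrable_deriv
  rw [intervalIntegral.integral_of_le zero_le_one, ← integral_Icc_eq_integral_Ioc] at hftc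
  rw [intervalIntegrable_iff_integrableOn_Icc_of_le zero_le_one] at hii
  have hc1 : Continuous fun t => fderiv ℝ q (y t, t) (0, 1) := by fun_prop
  have hc2 : Continuous fun t => (k:ℝ) * ‖(fderiv ℝ q (y t, t)).comp
    (ContinuousLinearMap.inl ℝ E ℝ)‖ := by fun_prop
  rw [← hftc, ← integral_sub hii hc1.integrableOn_Icc, ← Real.norm_eq_abs]
  apply norm_integral_le_of_norm_le hc2.integrableOn_Icc
  apply ae_restrict_of_ae
  filter_upwards [hy.ae_differentiableAt_real] with t ht
  have h1 : HasDerivAt (fun t => (y t, t)) (deriv y t, 1) t :=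
    ht.hasDerivAt.prodMk (hasDerivAt_id t)
  have h2 : HasFDerivAt q (fderiv ℝ q (y t, t)) (y t, t) :=
    (hq.differentiable (by simp)).differentiableAt.hasFDerivAt
  have h3 : HasDerivAt (fun t => q (y t, t)) (fderiv ℝ q (y t, t) (deriv y t, 1)) t :=
    h2.comp_hasDerivAt (f := fun t => (y t, t)) t h1
  rw [h3.deriv, ← map_sub]
  have h4 : ((deriv y t, (1:ℝ)) - (0, 1) : E × ℝ) = ContinuousLinearMap.inl ℝ E ℝ (deriv y t) := by
    simp
  rw [h4, ← ContinuousLinearMap.comp_apply, mul_comm]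
  refine (ContinuousLinearMap.le_opNorm _ _).trans ?_
  gcongr
  exact norm_deriv_le_of_lipschitz hy

theorem cauchy_schwarz {α : Type*} [MeasurableSpace α] {μ : Measure α} {f g : α → ℝ}
    (hf : MemLp f 2 μ) (hg : MemLp g 2 μ) :
    ∫ a, f a * g a ∂μ ≤ Real.sqrt (∫ a, f a ^ 2 ∂μ) * Real.sqrt (∫ a, g a ^ 2 ∂μ) := by
  have h := real_inner_le_norm (hg.toLp g) (hf.toLp f)
  have e1 : ⟪hg.toLp g, hf.toLp f⟫ = ∫ a, f a * g a ∂μ := by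
    rw [L2.inner_def]
    apply integral_congr_ae
    filter_upwards [hf.coeFn_toLp, hg.coeFn_toLp] with a h1 h2
    rw [h1, h2]; rfl
  have e2 : ∀ {f : α → ℝ} (hf : MemLp f 2 μ), ‖hf.toLp f‖ = Real.sqrt (∫ a, f a ^ 2 ∂μ) := by
    intro f hf
    rw [← Real.sqrt_sq (norm_nonneg _), ← real_inner_self_eq_norm_sq, L2.inner_def]
    congr 1
    apply integral_congr_ae
    filter_upwards [hf.coeFn_toLp] with a h1
    rw [h1, real_inner_self_eq_norm_sq, Real.norm_eq_abs, sq_abs]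
  rw [e1, e2 hf, e2 hg] at h
  linarith [mul_comm (Real.sqrt (∫ a, g a ^ 2 ∂μ)) (Real.sqrt (∫ a, f a ^ 2 ∂μ))]

/-- Space of smooth compactly supported test functions. -/
def TestSp (E : Type*) [NormedAddCommGroup E] [InnerProductSpace ℝ E] :
    Submodule ℝ (E × ℝ → ℝ) where
  carrier := {q | ContDiff ℝ (⊤ : ℕ∞) q ∧ HasCompactSupport q}
  zero_mem' := ⟨contDiff_const, HasCompactSupport.zero⟩
  add_mem' := fun ha hb => ⟨ha.1.add hb.1, ha.2.add hb.2⟩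
  smul_mem' := fun c _ hq => ⟨contDiff_const.smul hq.1, hq.2.smul_left (f := fun _ => c)⟩

/-- Spatial gradient. -/
noncomputable def sgrad {E : Type*} [NormedAddCommGroup E] [InnerProductSpace ℝ E]
    [FiniteDimensional ℝ E] (q : E × ℝ → ℝ) (z : E × ℝ) : E :=
  (InnerProductSpace.toDual ℝ E).symm ((fderiv ℝ q z).comp (ContinuousLinearMap.inl ℝ E ℝ))

/-- The gradient as a linear map to square-integrable fields. -/
noncomputable def Gmap {E : Type*} [NormedAddCommGroup E] [InnerProductSpace ℝ E]
    [FiniteDimensional ℝ E] [MeasurableSpace E] [BorelSpace E] (m : Measure (E × ℝ))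
    (hgrL : ∀ q : TestSp E, MemLp (sgrad (q : E × ℝ → ℝ)) 2 m)
    (hdiff : ∀ (q : TestSp E) z, DifferentiableAt ℝ (q : E × ℝ → ℝ) z) :
    TestSp E →ₗ[ℝ] Lp E 2 m where
  toFun := fun q => (hgrL q).toLp (sgrad (q : E × ℝ → ℝ))
  map_add' := by
    intro a b
    rw [← MemLp.toLp_add]
    congr 1
    ext1 z
    simp only [sgrad, Submodule.coe_add, Pi.add_apply]
    rw [fderiv_add (hdiff a z) (hdiff b z), ContinuousLinearMap.add_comp, map_add]
  map_smul' := by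
    intro c a
    simp only [RingHom.id_apply]
    rw [← MemLp.toLp_const_smul]
    congr 1
    ext1 z
    simp only [sgrad, Submodule.coe_smul, Pi.smul_apply]
    rw [fderiv_const_smul (hdiff a z), ContinuousLinearMap.smul_comp, map_smulₛₗ]
    simp

/-- The functional to be represented. -/
noncomputable def Lmap {E : Type*} [NormedAddCommGroup E] [InnerProductSpace ℝ E]
    [FiniteDimensional ℝ E] [MeasurableSpace E] [BorelSpace E] (m : Measure (E × ℝ))
    (μ₀ μ₁ : Measure E)
    (hvolfin0 : IsFiniteMeasure μ₀) (hvolfin1 : IsFiniteMeasure μ₁)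
    (hdiff : ∀ (q : TestSp E) z, DifferentiableAt ℝ (q : E × ℝ → ℝ) z)
    (hi : ∀ (q : TestSp E) (t : ℝ) (μ : Measure E), IsFiniteMeasure μ →
      Integrable (fun x => (q : E × ℝ → ℝ) (x, t)) μ)
    (hit : ∀ q : TestSp E, Integrable (fun z => fderiv ℝ (q : E × ℝ → ℝ) z (0, 1)) m) :
    TestSp E →ₗ[ℝ] ℝ where
  toFun := fun q => (∫ x, (q : E × ℝ → ℝ) (x, 1) ∂μ₁) - (∫ x, (q : E × ℝ → ℝ) (x, 0) ∂μ₀)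
    - ∫ z, fderiv ℝ (q : E × ℝ → ℝ) z (0, 1) ∂m
  map_add' := by
    intro a b
    have e : ∀ z, fderiv ℝ ((a + b : TestSp E) : E × ℝ → ℝ) z (0, 1) =
        fderiv ℝ (a : E × ℝ → ℝ) z (0, 1) + fderiv ℝ (b : E × ℝ → ℝ) z (0, 1) := by
      intro z
      rw [Submodule.coe_add, fderiv_add (hdiff a z) (hdiff b z)]; rfl
    simp only [e]
    simp only [Submodule.coe_add, Pi.add_apply]
    rw [integral_add (hi a 1 μ₁ hvolfin1) (hi b 1 μ₁ hvolfin1),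
      integral_add (hi a 0 μ₀ hvolfin0) (hi b 0 μ₀ hvolfin0), integral_add (hit a) (hit b)]
    ring
  map_smul' := by
    intro c a
    have e : ∀ z, fderiv ℝ ((c • a : TestSp E) : E × ℝ → ℝ) z (0, 1) =
        c * fderiv ℝ (a : E × ℝ → ℝ) z (0, 1) := by
      intro z
      rw [Submodule.coe_smul, fderiv_const_smul (hdiff a z)]; rfl
    simp only [e]
    simp only [Submodule.coe_smul, Pi.smul_apply, smul_eq_mul, RingHom.id_apply]
    rw [integral_const_mul, integral_const_mul, integral_const_mul]
    ring

theorem fderiv_bdd {E : Type*} [NormedAddCommGroup E] [NormedSpace ℝ E]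
    (q : E → ℝ) (h1 : ContDiff ℝ (⊤ : ℕ∞) q) (h2 : HasCompactSupport q) :
    ∃ C, ∀ z, ‖fderiv ℝ q z‖ ≤ C := by
  have h3 : HasCompactSupport (fderiv ℝ q) := h2.fderiv (𝕜 := ℝ)
  have h4 : Continuous (fderiv ℝ q) := h1.continuous_fderiv (by simp)
  exact h3.exists_bound_of_continuous h4

theorem lagrange_core {E : Type*} [NormedAddCommGroup E] [InnerProductSpace ℝ E]
    [FiniteDimensional ℝ E] [MeasurableSpace E] [BorelSpace E]
    {Λ : Type*} [MeasurableSpace Λ] (lam : Measure Λ) [IsFiniteMeasure lam]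
    (y : Λ → ℝ → E)
    (hym : Measurable (fun p : Λ × ℝ => y p.1 p.2)) (k : Λ → ℝ≥0) (hkm : Measurable k)
    (hlip : ∀ᵐ l ∂lam, ∀ s ∈ Icc (0:ℝ) 1, ∀ t ∈ Icc (0:ℝ) 1, ‖y l s - y l t‖ ≤ k l * |s - t|)
    (hk2 : Integrable (fun l => (k l : ℝ) ^ 2) lam) (μ₀ μ₁ : Measure E)
    (h0 : lam.map (fun l => y l 0) = μ₀)
    (h1 : lam.map (fun l => y l 1) = μ₁) (m : Measure (E × ℝ))
    (hS : (lam.prod (volume.restrict (Icc (0:ℝ) 1))).map (fun p => (y p.1 p.2, p.2)) = m) :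
    ∃ w : E × ℝ → E, Measurable w ∧
      Integrable (fun z => ‖w z‖ ^ 2) m ∧
      ∫ z, ‖w z‖ ^ 2 ∂m ≤ ∫ l, (k l : ℝ) ^ 2 ∂lam ∧
      ∀ q : E × ℝ → ℝ, ContDiff ℝ (⊤ : ℕ∞) q → HasCompactSupport q →
        ∫ z, fderiv ℝ q z (w z, 1) ∂m = (∫ x, q (x, 1) ∂μ₁) - ∫ x, q (x, 0) ∂μ₀ := by
  set P := lam.prod (volume.restrict (Icc (0:ℝ) 1)) with hP
  have hΦm : Measurable (fun p : Λ × ℝ => (y p.1 p.2, p.2)) := hym.prodMk measurable_snd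
  have hfinm : IsFiniteMeasure m := by rw [← hS]; infer_instance
  have hym1 : Measurable (fun l => y l 1) := hym.comp (measurable_id.prodMk measurable_const)
  have hym0 : Measurable (fun l => y l 0) := hym.comp (measurable_id.prodMk measurable_const)
  set A := ∫ l, (k l : ℝ) ^ 2 ∂lam with hA
  have hA0 : 0 ≤ A := integral_nonneg fun l => by positivity
  have hgrn : ∀ q z, ‖sgrad (q : E × ℝ → ℝ) z‖ = ‖(fderiv ℝ q z).comp (ContinuousLinearMap.inl ℝ E ℝ)‖ :=
    fun q z => LinearIsometryEquiv.norm_map _ _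
  have hDc : ∀ q : TestSp E, Continuous (fderiv ℝ (q : E × ℝ → ℝ)) := fun q =>
    q.2.1.continuous_fderiv (by simp)
  have hgrc : ∀ q : TestSp E, Continuous (sgrad (q : E × ℝ → ℝ)) := by
    intro q
    have := hDc q
    apply (InnerProductSpace.toDual ℝ E).symm.continuous.comp
    fun_prop
  have hDb : ∀ q : TestSp E, ∃ C, ∀ z, ‖fderiv ℝ (q : E × ℝ → ℝ) z‖ ≤ C := fun q =>
    fderiv_bdd (E := E × ℝ) (q : E × ℝ → ℝ) q.2.1 q.2.2
  have hgrb : ∀ q : TestSp E, ∃ C, ∀ z, ‖sgrad (q : E × ℝ → ℝ) z‖ ≤ C := by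
    intro q
    obtain ⟨C, hC⟩ := hDb q
    refine ⟨C, fun z => ?_⟩
    rw [hgrn]
    refine (ContinuousLinearMap.opNorm_comp_le _ _).trans ?_
    refine (mul_le_of_le_one_right (norm_nonneg _) ?_).trans (hC z)
    exact ContinuousLinearMap.norm_inl_le_one ℝ E ℝ
  have hgrL : ∀ q : TestSp E, MemLp (sgrad (q : E × ℝ → ℝ)) 2 m := by
    intro q
    obtain ⟨C, hC⟩ := hgrb q
    exact MemLp.of_bound (hgrc q).measurable.aestronglyMeasurable C (Filter.Eventually.of_forall hC)
  have hdiff : ∀ (q : TestSp E) z, DifferentiableAt ℝ (q : E × ℝ → ℝ) z := fun q z =>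
    (q.2.1.differentiable (by simp)).differentiableAt
  let G := Gmap m hgrL hdiff
  have hvolfin0 : IsFiniteMeasure μ₀ := by
    rw [← h0]; infer_instance
  have hvolfin1 : IsFiniteMeasure μ₁ := by
    rw [← h1]; infer_instance
  have hqb : ∀ q : TestSp E, ∃ C, ∀ z, ‖(q : E × ℝ → ℝ) z‖ ≤ C := fun q =>
    q.2.2.exists_bound_of_continuous q.2.1.continuous
  have hi : ∀ (q : TestSp E) (t : ℝ) (μ : Measure E), IsFiniteMeasure μ →
      Integrable (fun x => (q : E × ℝ → ℝ) (x, t)) μ := by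
    intro q t μ _
    obtain ⟨C, hC⟩ := hqb q
    have := q.2.1.continuous
    exact Integrable.of_bound (by fun_prop) C (Filter.Eventually.of_forall fun x => hC _)
  have hit : ∀ q : TestSp E, Integrable (fun z => fderiv ℝ (q : E × ℝ → ℝ) z (0, 1)) m := by
    intro q
    obtain ⟨C, hC⟩ := hDb q
    have := hDc q
    refine Integrable.of_bound (by fun_prop) (C * ‖((0, 1) : E × ℝ)‖)
      (Filter.Eventually.of_forall fun x => ?_)
    exact ((fderiv ℝ (q : E × ℝ → ℝ) x).le_opNorm _).trans (by gcongr; exact hC x)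
  let L := Lmap m μ₀ μ₁ hvolfin0 hvolfin1 hdiff hi hit
  have hkP : MemLp (fun p : Λ × ℝ => (k p.1 : ℝ)) 2 P := by
    have hkm2 : Measurable (fun p : Λ × ℝ => (k p.1 : ℝ)) :=
      measurable_coe_nnreal_real.comp (hkm.comp measurable_fst)
    rw [memLp_two_iff_integrable_sq hkm2.aestronglyMeasurable]
    have := Integrable.comp_fst (ν := volume.restrict (Icc (0:ℝ) 1)) hk2
    exact this
  have hLG : ∀ q, |L q| ≤ Real.sqrt A * ‖G q‖ := by
    intro q
    have hqc := q.2.1.continuous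
    have hDqc := hDc q
    have hgqc := hgrc q
    have e1 : ∫ x, (q : E × ℝ → ℝ) (x, 1) ∂μ₁ = ∫ l, (q : E × ℝ → ℝ) (y l 1, 1) ∂lam := by
      rw [← h1, integral_map (by fun_prop) (by fun_prop)]
    have e0 : ∫ x, (q : E × ℝ → ℝ) (x, 0) ∂μ₀ = ∫ l, (q : E × ℝ → ℝ) (y l 0, 0) ∂lam := by
      rw [← h0, integral_map (by fun_prop) (by fun_prop)]
    have hitP : Integrable (fun p : Λ × ℝ => fderiv ℝ (q : E × ℝ → ℝ) (y p.1 p.2, p.2) (0, 1)) P := by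
      have := hit q
      rw [← hS] at this
      exact this.comp_measurable hΦm
    have e2 : ∫ z, fderiv ℝ (q : E × ℝ → ℝ) z (0, 1) ∂m =
        ∫ l, (∫ t in Icc (0:ℝ) 1, fderiv ℝ (q : E × ℝ → ℝ) (y l t, t) (0, 1)) ∂lam := by
      rw [← hS, integral_map hΦm.aemeasurable (by fun_prop), integral_prod _ hitP]
    have i1 : Integrable (fun l => (q : E × ℝ → ℝ) (y l 1, 1)) lam := by
      obtain ⟨C, hC⟩ := hqb q
      refine Integrable.of_bound ?_ C (Filter.Eventually.of_forall fun x => hC _)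
      apply Measurable.aestronglyMeasurable
      fun_prop
    have i0 : Integrable (fun l => (q : E × ℝ → ℝ) (y l 0, 0)) lam := by
      obtain ⟨C, hC⟩ := hqb q
      refine Integrable.of_bound ?_ C (Filter.Eventually.of_forall fun x => hC _)
      apply Measurable.aestronglyMeasurable
      fun_prop
    have hgP : MemLp (fun p : Λ × ℝ => ‖sgrad (q : E × ℝ → ℝ) (y p.1 p.2, p.2)‖) 2 P := by
      obtain ⟨C, hC⟩ := hgrb q
      refine MemLp.of_bound ?_ C (Filter.Eventually.of_forall fun p => ?_)
      · apply Measurable.aestronglyMeasurable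
        fun_prop
      · rw [norm_norm]; exact hC _
    have hkg : Integrable (fun p : Λ × ℝ => (k p.1 : ℝ) * ‖sgrad (q : E × ℝ → ℝ) (y p.1 p.2, p.2)‖) P :=
      hkP.integrable_mul hgP
    have hLq : L q = ∫ l, ((q : E × ℝ → ℝ) (y l 1, 1) - (q : E × ℝ → ℝ) (y l 0, 0) -
        ∫ t in Icc (0:ℝ) 1, fderiv ℝ (q : E × ℝ → ℝ) (y l t, t) (0, 1)) ∂lam := by
      have i10 : Integrable (fun l => (q : E × ℝ → ℝ) (y l 1, 1) - (q : E × ℝ → ℝ) (y l 0, 0)) lam :=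
        i1.sub i0
      have hitl : Integrable (fun l => ∫ t in Icc (0:ℝ) 1,
        fderiv ℝ (q : E × ℝ → ℝ) (y l t, t) (0, 1)) lam := hitP.integral_prod_left
      rw [integral_sub i10 hitl, integral_sub i1 i0, ← e1, ← e0, ← e2]
      rfl
    have hbd : |L q| ≤ ∫ p, (k p.1 : ℝ) * ‖sgrad (q : E × ℝ → ℝ) (y p.1 p.2, p.2)‖ ∂P := by
      rw [hLq, integral_prod _ hkg, ← Real.norm_eq_abs]
      apply norm_integral_le_of_norm_le hkg.integral_prod_left
      filter_upwards [hlip] with l hl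
      rw [Real.norm_eq_abs]
      simp only [hgrn]
      let Y : ℝ → E := fun t => y l (projIcc (0:ℝ) 1 zero_le_one t)
      have hY : LipschitzWith (k l) Y := by
        apply LipschitzWith.of_dist_le_mul
        intro s t
        rw [dist_eq_norm]
        refine (hl _ (projIcc _ _ _ s).2 _ (projIcc _ _ _ t).2).trans ?_
        gcongr
        rw [Real.dist_eq]
        exact abs_projIcc_sub_projIcc _
      have hYy : ∀ t ∈ Icc (0:ℝ) 1, Y t = y l t := fun t ht => by
        simp only [Y, projIcc_of_mem zero_le_one ht]
      have := path_bound q q.2.1 q.2.2 Y (k l) hY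
      rw [hYy 1 (by simp), hYy 0 (by simp)] at this
      rw [setIntegral_congr_fun (g := fun t => fderiv ℝ (q : E × ℝ → ℝ) (y l t, t) (0, 1))
        measurableSet_Icc (fun t ht => by simp only [hYy t ht])] at this
      refine this.trans (le_of_eq ?_)
      exact setIntegral_congr_fun measurableSet_Icc (fun t ht => by simp only [hYy t ht])
    refine hbd.trans ((cauchy_schwarz hkP hgP).trans (le_of_eq ?_))
    congr 1
    · congr 1
      have := integral_fun_fst (μ := lam) (ν := volume.restrict (Icc (0:ℝ) 1))
        (fun l => (k l : ℝ) ^ 2)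
      rw [hP, this]
      simp [hA]
    · rw [← Real.sqrt_sq (norm_nonneg (G q)), ← real_inner_self_eq_norm_sq, L2.inner_def]
      congr 1
      have : ∫ a, ⟪(G q : E × ℝ → E) a, (G q : E × ℝ → E) a⟫ ∂m = ∫ a, ‖sgrad (q : E × ℝ → ℝ) a‖ ^ 2 ∂m := by
        apply integral_congr_ae
        filter_upwards [(hgrL q).coeFn_toLp] with a ha
        have ha' : (G q : E × ℝ → E) a = sgrad (q : E × ℝ → ℝ) a := ha
        rw [ha', real_inner_self_eq_norm_sq]
      rw [this, ← hS, integral_map hΦm.aemeasurable (by fun_prop)]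
  obtain ⟨V, hVn, hV⟩ := riesz_abs G L _ (Real.sqrt_nonneg A) hLG
  obtain ⟨w, hwm, hwV⟩ := (Lp.aestronglyMeasurable V)
  have hwm := hwm.measurable
  have hnorm : ‖V‖ ^ 2 = ∫ z, ‖w z‖ ^ 2 ∂m := by
    rw [← real_inner_self_eq_norm_sq, L2.inner_def]
    apply integral_congr_ae
    filter_upwards [hwV] with a ha
    rw [ha, real_inner_self_eq_norm_sq]
  have hwi : Integrable (fun z => ‖w z‖ ^ 2) m := by
    refine ((Lp.memLp V).integrable_norm_pow (by norm_num)).congr ?_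
    filter_upwards [hwV] with a ha
    rw [ha]
  refine ⟨w, hwm, hwi, ?_, ?_⟩
  · rw [← hnorm]
    calc ‖V‖ ^ 2 ≤ Real.sqrt A ^ 2 := by gcongr
      _ = A := Real.sq_sqrt hA0
  · intro q hq hqc
    have := hV ⟨q, hq, hqc⟩
    have e1 : ⟪V, G ⟨q, hq, hqc⟩⟫ = ∫ z, fderiv ℝ q z (w z, 0) ∂m := by
      rw [L2.inner_def]
      apply integral_congr_ae
      filter_upwards [hwV, (hgrL ⟨q, hq, hqc⟩).coeFn_toLp] with a ha hb
      have hb' : (G ⟨q, hq, hqc⟩ : E × ℝ → E) a = sgrad (q : E × ℝ → ℝ) a := hb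
      rw [ha, hb', real_inner_comm]
      unfold sgrad
      rw [InnerProductSpace.toDual_symm_apply]
      simp
    have e2 : L ⟨q, hq, hqc⟩ = (∫ x, q (x, 1) ∂μ₁) - (∫ x, q (x, 0) ∂μ₀)
        - ∫ z, fderiv ℝ q z (0, 1) ∂m := rfl
    have hiw : Integrable (fun z => fderiv ℝ q z (w z, 0)) m := by
      refine (L2.integrable_inner (𝕜 := ℝ) V (G ⟨q, hq, hqc⟩)).congr ?_
      filter_upwards [hwV, (hgrL ⟨q, hq, hqc⟩).coeFn_toLp] with a ha hb
      have hb' : (G ⟨q, hq, hqc⟩ : E × ℝ → E) a = sgrad (q : E × ℝ → ℝ) a := hb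
      rw [ha, hb', real_inner_comm]
      unfold sgrad
      rw [InnerProductSpace.toDual_symm_apply]
      simp
    have hadd : ∀ z, fderiv ℝ q z (w z, 1) = fderiv ℝ q z (w z, 0) + fderiv ℝ q z (0, 1) := by
      intro z
      rw [← map_add]
      simp
    simp only [hadd]
    rw [integral_add hiw (hit ⟨q, hq, hqc⟩), ← e1, this, e2]
    ring

theorem lagrange_to_euler {d : ℕ} (Ω₀ Ω₁ : Set (EuclideanSpace ℝ (Fin d)))
    {Λ : Type*} [MeasurableSpace Λ] (lam : Measure Λ) [IsFiniteMeasure lam]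
    (y : Λ → ℝ → EuclideanSpace ℝ (Fin d))
    (hym : Measurable (fun p : Λ × ℝ => y p.1 p.2)) (k : Λ → ℝ≥0) (hkm : Measurable k)
    (hlip : ∀ᵐ l ∂lam, ∀ s ∈ Icc (0:ℝ) 1, ∀ t ∈ Icc (0:ℝ) 1, ‖y l s - y l t‖ ≤ k l * |s - t|)
    (hk2 : Integrable (fun l => (k l : ℝ) ^ 2) lam)
    (h0 : lam.map (fun l => y l 0) = volume.restrict Ω₀)
    (h1 : lam.map (fun l => y l 1) = volume.restrict Ω₁)
    (S : Set (EuclideanSpace ℝ (Fin d) × ℝ)) (hSm : MeasurableSet S)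
    (hS : (lam.prod (volume.restrict (Icc (0:ℝ) 1))).map (fun p => (y p.1 p.2, p.2)) =
      (spaceTime d).restrict S) :
    sInf (shapeActionSet Ω₀ Ω₁) ≤ ENNReal.ofReal (∫ l, (k l : ℝ) ^ 2 ∂lam) := by
  obtain ⟨w, hwm, hwi, hwle, hwq⟩ := lagrange_core lam y hym k hkm hlip hk2 _ _ h0 h1 _ hS
  have hfin : IsFiniteMeasure ((spaceTime d).restrict S) := by rw [← hS]; infer_instance
  have hSfin : spaceTime d S < ⊤ := by
    have := hfin.measure_univ_lt_top
    rwa [Measure.restrict_apply_univ] at this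
  let ρ : EuclideanSpace ℝ (Fin d) → ℝ → ℝ := fun x t => S.indicator (fun _ => (1:ℝ)) (x, t)
  let v : EuclideanSpace ℝ (Fin d) → ℝ → EuclideanSpace ℝ (Fin d) := fun x t => w (x, t)
  have hρm : Measurable (fun q : EuclideanSpace ℝ (Fin d) × ℝ => ρ q.1 q.2) :=
    measurable_const.indicator hSm
  have hvm : Measurable (fun q : EuclideanSpace ℝ (Fin d) × ℝ => v q.1 q.2) := hwm
  have hρ : ∀ᵐ q ∂(spaceTime d), ρ q.1 q.2 = 0 ∨ ρ q.1 q.2 = 1 := by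
    refine Filter.Eventually.of_forall fun q => ?_
    by_cases hq : q ∈ S <;> simp [ρ, hq]
  have hρi : Integrable (fun q : EuclideanSpace ℝ (Fin d) × ℝ => ρ q.1 q.2) (spaceTime d) :=
    (integrable_indicator_iff hSm).2 (integrable_const 1)
  have emul : ∀ F : EuclideanSpace ℝ (Fin d) × ℝ → ℝ,
      (fun z : EuclideanSpace ℝ (Fin d) × ℝ => ρ z.1 z.2 * F z) = S.indicator F := by
    intro F
    ext z
    by_cases hz : z ∈ S <;> simp [ρ, hz]
  have hAi : Integrable (fun q : EuclideanSpace ℝ (Fin d) × ℝ => ρ q.1 q.2 * ‖v q.1 q.2‖ ^ 2)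
      (spaceTime d) := by
    rw [emul (fun q => ‖v q.1 q.2‖ ^ 2)]
    exact (integrable_indicator_iff hSm).2 hwi
  have hact : (∫⁻ q, ENNReal.ofReal (ρ q.1 q.2 * ‖v q.1 q.2‖ ^ 2) ∂(spaceTime d)) =
      ENNReal.ofReal (∫ z, ‖w z‖ ^ 2 ∂((spaceTime d).restrict S)) := by
    rw [← ofReal_integral_eq_lintegral_ofReal hAi]
    · rw [emul (fun q => ‖v q.1 q.2‖ ^ 2), integral_indicator hSm]
    · refine Filter.Eventually.of_forall fun q => ?_
      by_cases hq : q ∈ S <;> simp [ρ, hq]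
  have hadm : ShapeAdmissible Ω₀ Ω₁ ρ v := by
    refine ⟨hρm, hvm, hρ, hρi, ?_, ?_⟩
    · rw [hact]; exact ENNReal.ofReal_lt_top
    · intro q hqd hqc
      have hmemTwo := weak_integrable hρm hvm hρ hρi hAi q hqd hqc
      have e1 : (∫ t in Icc (0:ℝ) 1, ∫ x, ρ x t *
          (deriv (fun s => q x s) t + ⟪v x t, gradient (fun y => q y t) x⟫)) =
          ∫ z, ρ z.1 z.2 *
        fderiv ℝ (fun z : EuclideanSpace ℝ (Fin d) × ℝ => q z.1 z.2) z (v z.1 z.2, 1)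
          ∂(spaceTime d) := by
        rw [spaceTime, integral_prod_symm _ hmemTwo]
        apply integral_congr_ae
        refine Filter.Eventually.of_forall fun t => ?_
        apply integral_congr_ae
        refine Filter.Eventually.of_forall fun x => ?_
        simp only
        rw [weak_fderiv q x t (hqd.differentiable (by simp)).differentiableAt]
      rw [e1, emul (fun z => fderiv ℝ (fun z : EuclideanSpace ℝ (Fin d) × ℝ => q z.1 z.2) z
        (v z.1 z.2, 1)), integral_indicator hSm]
      exact hwq _ hqd hqc
  have hmem : (∫⁻ q, ENNReal.ofReal (ρ q.1 q.2 * ‖v q.1 q.2‖ ^ 2) ∂(spaceTime d)) ∈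
      shapeActionSet Ω₀ Ω₁ := ⟨ρ, v, hadm, rfl⟩
  refine (sInf_le hmem).trans ?_
  rw [hact]
  exact ENNReal.ofReal_le_ofReal hwle


theorem prox_abs {E : Type*} [NormedAddCommGroup E] [InnerProductSpace ℝ E]
    [FiniteDimensional ℝ E] (K : Set E) (hK : IsCompact K) (hKc : Convex ℝ K) (hKn : K.Nonempty)
    (u : E → ℝ) (huc : Continuous u) (hconv : ConvexOn ℝ univ u) :
    ∃ (f : E → E) (N : E → ℝ), (∀ z, f z ∈ K) ∧
      (∀ z, ∀ x ∈ K, 2 * ⟪z, x⟫ - (u x + ‖x‖ ^ 2 / 2) + ‖x - f z‖ ^ 2 / 2 ≤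
        2 * ⟪z, f z⟫ - (u (f z) + ‖f z‖ ^ 2 / 2)) ∧
      (∀ z z', ‖f z - f z'‖ ^ 2 ≤ 2 * ⟪z - z', f z - f z'⟫) ∧
      LipschitzWith 2 f ∧ (∀ z, HasFDerivAt N ((2 : ℝ) • innerSL ℝ (f z)) z) := by
  have hex : ∀ z, ∃ x ∈ K, ∀ x' ∈ K, 2 * ⟪z, x'⟫ - (u x' + ‖x'‖ ^ 2 / 2) ≤
      2 * ⟪z, x⟫ - (u x + ‖x‖ ^ 2 / 2) := by
    intro z
    have hc : Continuous fun x => 2 * ⟪z, x⟫ - (u x + ‖x‖ ^ 2 / 2) := by fun_prop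
    obtain ⟨x, hx, hmax⟩ := hK.exists_isMaxOn hKn hc.continuousOn
    exact ⟨x, hx, fun x' hx' => hmax hx'⟩
  choose f hfK hfmax using hex
  have hstrong : ∀ z, ∀ x ∈ K, 2 * ⟪z, x⟫ - (u x + ‖x‖ ^ 2 / 2) + ‖x - f z‖ ^ 2 / 2 ≤
        2 * ⟪z, f z⟫ - (u (f z) + ‖f z‖ ^ 2 / 2) := by
    intro z x hx
    set x0 := f z with hx0
    have hlam : ∀ l : ℝ, 0 < l → l < 1 → 2 * ⟪z, x⟫ - (u x + ‖x‖ ^ 2 / 2)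
        + (1 - l) * (‖x - x0‖ ^ 2 / 2) ≤ 2 * ⟪z, x0⟫ - (u x0 + ‖x0‖ ^ 2 / 2) := by
      intro l hl0 hl1
      have hmem : (1 - l) • x0 + l • x ∈ K :=
        hKc (hfK z) hx (by linarith) hl0.le (by ring)
      have h1 := hfmax z _ hmem
      have h2 := hconv.2 (mem_univ x0) (mem_univ x) (by linarith : 0 ≤ 1 - l) hl0.le (by ring)
      have h3 : ‖(1 - l) • x0 + l • x‖ ^ 2 =
          (1 - l) * ‖x0‖ ^ 2 + l * ‖x‖ ^ 2 - l * (1 - l) * ‖x - x0‖ ^ 2 := by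
        rw [← real_inner_self_eq_norm_sq, ← real_inner_self_eq_norm_sq,
          ← real_inner_self_eq_norm_sq, ← real_inner_self_eq_norm_sq]
        simp only [inner_add_left, inner_add_right, inner_sub_left, inner_sub_right,
          inner_smul_left, inner_smul_right, real_inner_comm x0 x, conj_trivial]
        ring
      have h4 : ⟪z, (1 - l) • x0 + l • x⟫ = (1 - l) * ⟪z, x0⟫ + l * ⟪z, x⟫ := by
        simp only [inner_add_right, inner_smul_right]
      simp only [smul_eq_mul] at h2
      rw [h3, h4, ← hx0] at h1
      have h5 : l * (2 * ⟪z, x⟫ - (u x + ‖x‖ ^ 2 / 2) + (1 - l) * (‖x - x0‖ ^ 2 / 2)) ≤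
          l * (2 * ⟪z, x0⟫ - (u x0 + ‖x0‖ ^ 2 / 2)) := by nlinarith
      exact le_of_mul_le_mul_left h5 hl0
    by_contra hcon
    push Not at hcon
    set D := ‖x - x0‖ ^ 2 / 2 with hD
    have hD0 : 0 ≤ D := by positivity
    set δ := 2 * ⟪z, x⟫ - (u x + ‖x‖ ^ 2 / 2) + D - (2 * ⟪z, x0⟫ - (u x0 + ‖x0‖ ^ 2 / 2)) with hδ
    have hδ0 : 0 < δ := by linarith
    have := hlam (min (1/2) (δ / (2 * (D + 1)))) (by positivity) (by
      exact (min_le_left _ _).trans_lt (by norm_num))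
    have h6 : min (1/2) (δ / (2 * (D + 1))) * D ≤ δ / 2 := by
      calc _ ≤ (δ / (2 * (D + 1))) * D := by gcongr; exact min_le_right _ _
        _ = δ / 2 * (D / (D + 1)) := by field_simp
        _ ≤ δ / 2 * 1 := by gcongr; rw [div_le_one (by positivity)]; linarith
        _ = _ := mul_one _
    nlinarith
  have hmono : ∀ z z', ‖f z - f z'‖ ^ 2 ≤ 2 * ⟪z - z', f z - f z'⟫ := by
    intro z z'
    have h1 := hstrong z (f z') (hfK z')
    have h2 := hstrong z' (f z) (hfK z)
    rw [norm_sub_rev] at h1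
    simp only [inner_sub_left, inner_sub_right]
    linarith
  have hlip : ∀ z z', ‖f z - f z'‖ ≤ 2 * ‖z - z'‖ := by
    intro z z'
    have h1 := hmono z z'
    have h2 := real_inner_le_norm (z - z') (f z - f z')
    rcases eq_or_lt_of_le (norm_nonneg (f z - f z')) with h | h
    · rw [← h]; positivity
    · nlinarith
  refine ⟨f, fun z => 2 * ⟪z, f z⟫ - (u (f z) + ‖f z‖ ^ 2 / 2), hfK, hstrong, hmono, ?_, ?_⟩
  · apply LipschitzWith.of_dist_le_mul
    intro z z'
    rw [dist_eq_norm, dist_eq_norm]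
    exact hlip z z'
  · intro z
    rw [hasFDerivAt_iff_isLittleO]
    refine Asymptotics.IsBigO.trans_isLittleO (g := fun z' => ‖z' - z‖ ^ 2) ?_
      (Asymptotics.isLittleO_pow_sub_sub z (by norm_num))
    apply Asymptotics.IsBigO.of_bound 4
    refine Filter.Eventually.of_forall fun z' => ?_
    have h1 := hfmax z' (f z) (hfK z)
    have h2 := hfmax z (f z') (hfK z')
    have h3 : ((2:ℝ) • innerSL ℝ (f z)) (z' - z) = 2 * ⟪z' - z, f z⟫ := by
      simp [real_inner_comm]
    have h4 : 2 * ⟪z' - z, f z' - f z⟫ ≤ 4 * ‖z' - z‖ ^ 2 := by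
      have := real_inner_le_norm (z' - z) (f z' - f z)
      have := hlip z' z
      nlinarith [norm_nonneg (z' - z)]
    rw [h3, Real.norm_eq_abs, Real.norm_of_nonneg (by positivity), abs_le]
    simp only [inner_sub_left, inner_sub_right] at h4 ⊢
    constructor <;> nlinarith [sq_nonneg ‖z' - z‖]

theorem potential {E : Type*} [NormedAddCommGroup E] [InnerProductSpace ℝ E]
    [FiniteDimensional ℝ E] (R : ℝ) (hR : 0 ≤ R) (φ ψ : C(E, ℝ))
    (hle : ∀ x ∈ Metric.closedBall (0:E) R, ∀ y ∈ Metric.closedBall (0:E) R,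
      φ x + ψ y ≤ ‖x - y‖ ^ 2) :
    ∃ (f : E → E) (N : E → ℝ),
      (∀ z z', ‖f z - f z'‖ ^ 2 ≤ 2 * ⟪z - z', f z - f z'⟫) ∧
      LipschitzWith 2 f ∧ (∀ z, HasFDerivAt N ((2 : ℝ) • innerSL ℝ (f z)) z) ∧
      ∀ x ∈ Metric.closedBall (0:E) R, ∀ y ∈ Metric.closedBall (0:E) R,
        φ x + ψ y = ‖x - y‖ ^ 2 → f ((1/2 : ℝ) • (x + y)) = x := by
  set K := Metric.closedBall (0:E) R with hKdef
  have hK : IsCompact K := isCompact_closedBall _ _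
  have hKn : K.Nonempty := ⟨0, by simp [K, hR]⟩
  let w : E → ℝ := fun y => (‖y‖ ^ 2 - ψ y) / 2
  have hwc : Continuous w := by fun_prop
  let F : E → E → ℝ := fun x y => ⟪x, y⟫ - w y
  have hFc : Continuous (Function.uncurry F) := by
    simp only [F, Function.uncurry_def]
    fun_prop
  let u : E → ℝ := fun x => sSup (F x '' K)
  have huc : Continuous u := hK.continuous_sSup hFc
  have hbdd : ∀ x, BddAbove (F x '' K) := fun x =>
    (hK.image (hFc.comp (Continuous.prodMk_right x))).bddAbove
  have hge : ∀ x, ∀ y ∈ K, F x y ≤ u x := fun x y hy =>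
    le_csSup (hbdd x) (mem_image_of_mem _ hy)
  have hle' : ∀ x c, (∀ y ∈ K, F x y ≤ c) → u x ≤ c := fun x c hc =>
    csSup_le (hKn.image _) (by rintro _ ⟨y, hy, rfl⟩; exact hc y hy)
  have hconv : ConvexOn ℝ univ u := by
    refine ⟨convex_univ, fun x _ x' _ a b ha hb hab => ?_⟩
    apply hle'
    intro y hy
    have h1 := hge x y hy
    have h2 := hge x' y hy
    have : F (a • x + b • x') y = a * F x y + b * F x' y := by
      simp only [F, inner_add_left, inner_smul_left, conj_trivial]
      have : b = 1 - a := by linarith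
      rw [this]; ring
    rw [this, smul_eq_mul, smul_eq_mul]
    gcongr
  obtain ⟨f, N, hfK, hstrong, hmono, hlip, hN⟩ :=
    prox_abs K hK (convex_closedBall _ _) hKn u huc hconv
  refine ⟨f, N, hmono, hlip, hN, ?_⟩
  intro x hx y hy hxy
  have hnorm : ∀ a b : E, ‖a - b‖ ^ 2 = ‖a‖ ^ 2 - 2 * ⟪a, b⟫ + ‖b‖ ^ 2 := norm_sub_sq_real
  have hux : u x = F x y := by
    apply le_antisymm _ (hge x y hy)
    apply hle'
    intro y' hy'
    have h1 := hle x hx y' hy'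
    rw [hnorm] at h1 hxy
    simp only [F, w]
    linarith
  set z := (1/2 : ℝ) • (x + y) with hz
  have h2 := hstrong z x hx
  have h3 := hge (f z) y hy
  have hzi : ∀ a, 2 * ⟪z, a⟫ = ⟪x, a⟫ + ⟪y, a⟫ := by
    intro a
    simp only [hz, inner_smul_left, inner_add_left, conj_trivial]; ring
  rw [hzi, hzi, hux, hnorm, real_inner_self_eq_norm_sq] at h2
  simp only [F] at h2 h3
  have h4 := hnorm x (f z)
  have h5 : ‖x - f z‖ ^ 2 ≤ 0 := by
    rw [real_inner_comm x y] at h2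
    rw [real_inner_comm y (f z)] at h3
    nlinarith
  have h6 : ‖x - f z‖ = 0 := by
    have := sq_nonneg ‖x - f z‖
    exact pow_eq_zero_iff (two_ne_zero) |>.1 (le_antisymm h5 this)
  exact (sub_eq_zero.1 (norm_eq_zero.1 h6)).symm


/-- The Jacobian determinant of the interpolated map. -/
noncomputable def Jdet {E : Type*} [NormedAddCommGroup E] [InnerProductSpace ℝ E]
    (A : E →L[ℝ] E) (t : ℝ) : ℝ :=
  ((1 - 2 * t) • A + (2 * t) • ContinuousLinearMap.id ℝ E).det

theorem det_affine {E : Type*} [NormedAddCommGroup E] [InnerProductSpace ℝ E]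
    [FiniteDimensional ℝ E] (A : E →L[ℝ] E) (hsym : ∀ v w, ⟪A v, w⟫ = ⟪v, A w⟫)
    (h0 : ∀ v, 0 ≤ ⟪A v, v⟫) (h2 : ∀ v, ⟪A v, v⟫ ≤ 2 * ‖v‖ ^ 2) :
    ∃ l : Fin (Module.finrank ℝ E) → ℝ, (∀ i, 0 ≤ l i ∧ l i ≤ 2) ∧
      ∀ a b : ℝ, (a • A + b • ContinuousLinearMap.id ℝ E).det = ∏ i, (a * l i + b) := by
  have hT : (A : E →ₗ[ℝ] E).IsSymmetric := hsym
  let b := hT.eigenvectorBasis rfl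
  have hap : ∀ i, A (b i) = hT.eigenvalues rfl i • b i := fun i => hT.apply_eigenvectorBasis rfl i
  have hinn : ∀ i, ⟪A (b i), b i⟫ = hT.eigenvalues rfl i := by
    intro i
    rw [hap, inner_smul_left, real_inner_self_eq_norm_sq, b.norm_eq_one]
    simp
  refine ⟨hT.eigenvalues rfl, fun i => ?_, fun a c => ?_⟩
  · have e1 := h0 (b i)
    have e2 := h2 (b i)
    rw [hinn] at e1 e2
    rw [b.norm_eq_one] at e2
    constructor <;> linarith
  · rw [ContinuousLinearMap.det, ← LinearMap.det_toMatrix b.toBasis]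
    have : LinearMap.toMatrix b.toBasis b.toBasis
        ((a • A + c • ContinuousLinearMap.id ℝ E : E →L[ℝ] E) : E →ₗ[ℝ] E) =
        Matrix.diagonal fun i => a * hT.eigenvalues rfl i + c := by
      have hm := hT.toMatrix_eigenvectorBasis rfl
      have e : ((a • A + c • ContinuousLinearMap.id ℝ E : E →L[ℝ] E) : E →ₗ[ℝ] E) =
        a • (A : E →ₗ[ℝ] E) + c • LinearMap.id := rfl
      rw [e, map_add, map_smul, map_smul, LinearMap.toMatrix_id]
      have hm' : LinearMap.toMatrix b.toBasis b.toBasis (A : E →ₗ[ℝ] E) =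
        Matrix.diagonal (hT.eigenvalues rfl) := hm
      rw [hm']
      ext i j
      by_cases hij : i = j
      · subst hij; simp
      · simp [hij]
    rw [this, Matrix.det_diagonal]

theorem prod_lip {ι : Type*} (s : Finset ι) (a b : ι → ℝ) (δ : ℝ) 
    (ha : ∀ i, |a i| ≤ 2) (hb : ∀ i, |b i| ≤ 2) (hab : ∀ i, |a i - b i| ≤ δ) :
    |∏ i ∈ s, a i - ∏ i ∈ s, b i| ≤ s.card * 2 ^ s.card * δ := by
  classical
  induction s using Finset.induction_on with
  | empty => simp
  | insert j s hj ih =>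
    rw [Finset.prod_insert hj, Finset.prod_insert hj, Finset.card_insert_of_notMem hj]
    have hδ : 0 ≤ δ := (abs_nonneg _).trans (hab j)
    have hp : |∏ i ∈ s, a i| ≤ 2 ^ s.card := by
      rw [Finset.abs_prod]
      exact (Finset.prod_le_prod (fun i _ => abs_nonneg _) (fun i _ => ha i)).trans (by simp)
    have e : a j * ∏ i ∈ s, a i - b j * ∏ i ∈ s, b i =
      (a j - b j) * ∏ i ∈ s, a i + b j * (∏ i ∈ s, a i - ∏ i ∈ s, b i) := by ring
    rw [e]
    refine (abs_add_le _ _).trans ?_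
    rw [abs_mul, abs_mul]
    calc _ ≤ δ * 2 ^ s.card + 2 * (s.card * 2 ^ s.card * δ) := by
          gcongr
          · exact hab j
          · exact hb j
      _ ≤ _ := by
        push_cast
        rw [pow_succ]
        nlinarith [pow_pos (two_pos : (0:ℝ) < 2) s.card, mul_nonneg hδ (pow_pos (two_pos : (0:ℝ) < 2) s.card).le]

theorem Jdet_facts {E : Type*} [NormedAddCommGroup E] [InnerProductSpace ℝ E]
    [FiniteDimensional ℝ E] (A : E →L[ℝ] E) (hsym : ∀ v w, ⟪A v, w⟫ = ⟪v, A w⟫)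
    (h0 : ∀ v, 0 ≤ ⟪A v, v⟫) (h2 : ∀ v, ⟪A v, v⟫ ≤ 2 * ‖v‖ ^ 2) :
    (∀ t ∈ Icc (0:ℝ) 1, (t * (1 - t)) ^ (Module.finrank ℝ E) ≤ Jdet A t) ∧
    (∀ t ∈ Icc (0:ℝ) 1, Jdet A t ≤ 2 ^ (Module.finrank ℝ E)) ∧
    (∀ t ∈ Icc (0:ℝ) 1, ∀ t' ∈ Icc (0:ℝ) 1, |Jdet A t - Jdet A t'| ≤
      (Module.finrank ℝ E) * 2 ^ (Module.finrank ℝ E) * (2 * |t - t'|)) ∧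
    (∀ s, 0 ≤ s → s ≤ A.det → s ≤ ((2:ℝ) • ContinuousLinearMap.id ℝ E - A).det →
      ∀ t ∈ Icc (0:ℝ) 1, s ≤ Jdet A t) := by
  obtain ⟨l, hl, hdet⟩ := det_affine A hsym h0 h2
  have hJ : ∀ t, Jdet A t = ∏ i, ((1 - t) * l i + t * (2 - l i)) := by
    intro t
    rw [Jdet, hdet]
    exact Finset.prod_congr rfl fun i _ => by ring
  have hn : ∀ t ∈ Icc (0:ℝ) 1, ∀ i, 0 ≤ (1 - t) * l i + t * (2 - l i) := by
    intro t ht i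
    exact add_nonneg (mul_nonneg (by linarith [ht.2]) (hl i).1)
      (mul_nonneg ht.1 (by linarith [(hl i).2]))
  have hu : ∀ t ∈ Icc (0:ℝ) 1, ∀ i, (1 - t) * l i + t * (2 - l i) ≤ 2 := by
    intro t ht i
    nlinarith [ht.1, ht.2, (hl i).1, (hl i).2, mul_nonneg ht.1 (hl i).1,
      mul_nonneg (sub_nonneg.2 ht.2) (sub_nonneg.2 (hl i).2)]
  refine ⟨fun t ht => ?_, fun t ht => ?_, fun t ht t' ht' => ?_, fun s hs hs1 hs2 t ht => ?_⟩
  · rw [hJ]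
    calc (t * (1 - t)) ^ (Module.finrank ℝ E) = ∏ i : Fin (Module.finrank ℝ E), (t * (1 - t)) := by
          simp
      _ ≤ _ := by
        apply Finset.prod_le_prod
        · intro i _; exact mul_nonneg ht.1 (by linarith [ht.2])
        · intro i _
          have h1 := mul_nonneg (mul_nonneg (sub_nonneg.2 ht.2) (sub_nonneg.2 ht.2)) (hl i).1
          have h3 := mul_nonneg (mul_nonneg ht.1 ht.1) (sub_nonneg.2 (hl i).2)
          have h4 := mul_nonneg ht.1 (sub_nonneg.2 ht.2)
          nlinarith
  · rw [hJ]
    calc _ ≤ ∏ i : Fin (Module.finrank ℝ E), (2:ℝ) :=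
          Finset.prod_le_prod (fun i _ => hn t ht i) (fun i _ => hu t ht i)
      _ = _ := by simp
  · rw [hJ, hJ]
    have := prod_lip (Finset.univ : Finset (Fin (Module.finrank ℝ E)))
      (fun i => (1 - t) * l i + t * (2 - l i)) (fun i => (1 - t') * l i + t' * (2 - l i))
      (2 * |t - t'|) (fun i => by rw [abs_of_nonneg (hn t ht i)]; exact hu t ht i)
      (fun i => by rw [abs_of_nonneg (hn t' ht' i)]; exact hu t' ht' i) (fun i => by
        have : (1 - t) * l i + t * (2 - l i) - ((1 - t') * l i + t' * (2 - l i)) =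
          (2 - 2 * l i) * (t - t') := by ring
        rw [this, abs_mul]
        gcongr
        rw [abs_le]
        constructor <;> linarith [(hl i).1, (hl i).2])
    simpa using this
  · rw [hJ]
    have e1 : A.det = ∏ i, l i := by
      have := hdet 1 0
      simpa using this
    have e2 : ((2:ℝ) • ContinuousLinearMap.id ℝ E - A).det = ∏ i, (2 - l i) := by
      have := hdet (-1) 2
      rw [show ((2:ℝ) • ContinuousLinearMap.id ℝ E - A) =
        (-1:ℝ) • A + (2:ℝ) • ContinuousLinearMap.id ℝ E by rw [neg_one_smul]; abel, this]
      exact Finset.prod_congr rfl fun i _ => by ring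
    rw [e1] at hs1
    rw [e2] at hs2
    have ht1 : 0 ≤ 1 - t := by linarith [ht.2]
    calc s = s ^ (1 - t) * s ^ t := by
          rcases hs.eq_or_lt with h | h
          · rw [← h]
            by_cases h1 : t = 0
            · subst h1; simp
            · rw [Real.zero_rpow h1, mul_zero]
          · rw [← Real.rpow_add h]; simp
      _ ≤ (∏ i, l i) ^ (1 - t) * (∏ i, (2 - l i)) ^ t := by
          have := ht.1
          have hp : 0 ≤ ∏ i, l i := hs.trans hs1
          gcongr
      _ = ∏ i, (l i ^ (1 - t) * (2 - l i) ^ t) := by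
          rw [Finset.prod_mul_distrib, Real.finsetProd_rpow _ _ (fun i _ => (hl i).1),
            Real.finsetProd_rpow _ _ (fun i _ => sub_nonneg.2 (hl i).2)]
      _ ≤ _ := by
          apply Finset.prod_le_prod
          · intro i _
            exact mul_nonneg (Real.rpow_nonneg (hl i).1 _)
              (Real.rpow_nonneg (sub_nonneg.2 (hl i).2) _)
          · intro i _
            exact Real.geom_mean_le_arith_mean2_weighted ht1 ht.1 (hl i).1
              (sub_nonneg.2 (hl i).2) (by ring)


theorem fderiv_good {E : Type*} [NormedAddCommGroup E] [InnerProductSpace ℝ E]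
    [FiniteDimensional ℝ E] (f : E → E) (N : E → ℝ)
    (hmono : ∀ z z', ‖f z - f z'‖ ^ 2 ≤ 2 * ⟪z - z', f z - f z'⟫)
    (hN : ∀ z, HasFDerivAt N ((2 : ℝ) • innerSL ℝ (f z)) z) (z : E)
    (A : E →L[ℝ] E) (hA : HasFDerivAt f A z) :
    (∀ v w, ⟪A v, w⟫ = ⟪v, A w⟫) ∧ (∀ v, 0 ≤ ⟪A v, v⟫) ∧ (∀ v, ⟪A v, v⟫ ≤ 2 * ‖v‖ ^ 2) := by
  have hkey : ∀ v, ‖A v‖ ^ 2 ≤ 2 * ⟪v, A v⟫ := by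
    intro v
    have h1 : HasDerivAt (fun t : ℝ => f (z + t • v)) (A v) 0 := by
      have h2 : HasDerivAt (fun t : ℝ => z + t • v) v 0 := by
        have := ((hasDerivAt_id (0:ℝ)).smul_const v).const_add z
        simpa using this
      have h3 : HasFDerivAt f A (z + (0:ℝ) • v) := by simpa using hA
      exact h3.comp_hasDerivAt (0:ℝ) h2
    have h4 := h1.tendsto_slope_zero
    simp only [zero_add, zero_smul, add_zero] at h4
    have h5 := (h4.norm.pow 2)
    have h6 := ((tendsto_const_nhds (x := v)).inner (𝕜 := ℝ) h4).const_mul 2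
    refine le_of_tendsto_of_tendsto h5 h6 ?_
    filter_upwards [self_mem_nhdsWithin] with h hh
    have hh0 : h ≠ 0 := hh
    have := hmono (z + h • v) z
    rw [add_sub_cancel_left, inner_smul_left, conj_trivial] at this
    rw [norm_smul, inner_smul_right, mul_pow, norm_inv, Real.norm_eq_abs, inv_pow, sq_abs]
    have hsq : 0 < (h ^ 2)⁻¹ := by positivity
    calc _ ≤ (h ^ 2)⁻¹ * (2 * (h * ⟪v, f (z + h • v) - f z⟫)) := by gcongr
      _ = _ := by field_simp
  refine ⟨?_, ?_, ?_⟩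
  · intro v w
    have h1 : HasFDerivAt (fun y => (2 : ℝ) • innerSL ℝ (f y)) 
        ((2:ℝ) • ((innerSL ℝ : E →L[ℝ] E →L[ℝ] ℝ).comp A)) z :=
      (((innerSL ℝ : E →L[ℝ] E →L[ℝ] ℝ).hasFDerivAt).comp z hA).const_smul (2:ℝ)
    have h2 := second_derivative_symmetric (𝕜 := ℝ) hN h1 v w
    have h3 : 2 * ⟪A v, w⟫ = 2 * ⟪A w, v⟫ := h2
    rw [real_inner_comm (A w) v]
    linarith
  · intro v
    have := hkey v
    rw [real_inner_comm]
    nlinarith [sq_nonneg ‖A v‖]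
  · intro v
    have h1 := hkey v
    have h2 := real_inner_le_norm v (A v)
    rw [real_inner_comm]
    have h3 : ‖A v‖ ≤ 2 * ‖v‖ := by
      rcases eq_or_lt_of_le (norm_nonneg (A v)) with h | h
      · rw [← h]; positivity
      · nlinarith
    nlinarith [norm_nonneg v]

theorem lip_null {E : Type*} [NormedAddCommGroup E] [InnerProductSpace ℝ E]
    [FiniteDimensional ℝ E] [MeasureSpace E] [BorelSpace E]
    [(volume : Measure E).IsAddHaarMeasure] (f : E → E) (K : ℝ≥0) (hf : LipschitzWith K f)
    (S : Set E) (hS : volume S = 0) : volume (f '' S) = 0 := by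
  have h := hf.hausdorffMeasure_image_le (d := Module.finrank ℝ E) (by positivity) S
  have e := Measure.isAddLeftInvariant_eq_smul (μH[(Module.finrank ℝ E : ℝ)] : Measure E)
    (volume : Measure E)
  have e' := Measure.isAddLeftInvariant_eq_smul (volume : Measure E)
    (μH[(Module.finrank ℝ E : ℝ)] : Measure E)
  have h0 : (μH[(Module.finrank ℝ E : ℝ)] : Measure E) S = 0 := by
    rw [e]; simp [hS]
  rw [h0, mul_zero] at h
  rw [e']
  simp [le_antisymm h bot_le]

theorem sigma_le {E : Type*} [NormedAddCommGroup E] [InnerProductSpace ℝ E]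
    [FiniteDimensional ℝ E] [MeasureSpace E] [BorelSpace E]
    [(volume : Measure E).IsAddHaarMeasure] (f : E → E) (K : ℝ≥0) (hf : LipschitzWith K f)
    (σ : Measure E) (hσ : ∀ B, MeasurableSet B → σ B ≤ volume (f '' B)) (B : Set E)
    (hB : MeasurableSet B) :
    σ B ≤ ∫⁻ z in B, ENNReal.ofReal |(fderiv ℝ f z).det| := by
  set D := {z | DifferentiableAt ℝ f z} with hD
  have hDm : MeasurableSet D := measurableSet_of_differentiableAt ℝ f
  have hD0 : volume Dᶜ = 0 := hf.ae_differentiableAt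
  have h1 : σ (B ∩ Dᶜ) = 0 := by
    refine le_antisymm ((hσ _ (hB.inter hDm.compl)).trans ?_) bot_le
    rw [lip_null f K hf _ (measure_mono_null inter_subset_right hD0)]
  calc σ B ≤ σ (B ∩ D) + σ (B ∩ Dᶜ) := by
        rw [← sdiff_eq, measure_inter_add_sdiff _ hDm]
    _ = σ (B ∩ D) := by rw [h1, add_zero]
    _ ≤ volume (f '' (B ∩ D)) := hσ _ (hB.inter hDm)
    _ ≤ ∫⁻ z in B ∩ D, ENNReal.ofReal |(fderiv ℝ f z).det| :=
        addHaar_image_le_lintegral_abs_det_fderiv volume (hB.inter hDm) fun z hz =>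
          (DifferentiableAt.hasFDerivAt hz.2).hasFDerivWithinAt
    _ ≤ _ := lintegral_mono_set inter_subset_left

theorem sigma_image {E : Type*} [NormedAddCommGroup E] [InnerProductSpace ℝ E]
    [FiniteDimensional ℝ E] [MeasureSpace E] [BorelSpace E] (Ω : Set E) (hΩ : MeasurableSet Ω)
    {Q : Type*} [MeasurableSpace Q] (π : Measure Q) (pr : Q → E) (hpr : Measurable pr) (mid : Q → E)
    (hmid : Measurable mid) (hm : π.map pr = volume.restrict Ω) (f : E → E) 
    (hf : ∀ᵐ p ∂π, f (mid p) = pr p) (B : Set E) (hB : MeasurableSet B) :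
    (π.map mid) B ≤ volume (f '' B) := by
  rw [Measure.map_apply hmid hB]
  calc π (mid ⁻¹' B) ≤ π (pr ⁻¹' (toMeasurable volume (f '' B))) := by
        apply measure_mono_ae
        filter_upwards [hf] with p hp hpB
        show pr p ∈ toMeasurable volume (f '' B)
        rw [← hp]
        exact subset_toMeasurable _ _ (mem_image_of_mem f hpB)
    _ = (volume.restrict Ω) (toMeasurable volume (f '' B)) := by
        rw [← hm, Measure.map_apply hpr (measurableSet_toMeasurable _ _)]
    _ ≤ volume (toMeasurable volume (f '' B)) := Measure.restrict_apply_le _ _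
    _ = _ := measure_toMeasurable _


theorem ii_bdd (s : ℝ → ℝ) (hs : Measurable s) (M : ℝ) (h0 : ∀ x, 0 ≤ s x) (hM : ∀ x, s x ≤ M)
    (a b : ℝ) : IntervalIntegrable s volume a b := by
  apply (intervalIntegrable_const (c := M)).mono_fun hs.aestronglyMeasurable
  refine Filter.Eventually.of_forall fun x => ?_
  show ‖s x‖ ≤ ‖M‖
  rw [Real.norm_of_nonneg (h0 x), Real.norm_of_nonneg ((h0 x).trans (hM x))]
  exact hM x

theorem U_sub (s : ℝ → ℝ) (hs : Measurable s) (M : ℝ) (h0 : ∀ x, 0 ≤ s x) (hM : ∀ x, s x ≤ M)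
    (a b : ℝ) : (∫ x in (0:ℝ)..b, s x) - (∫ x in (0:ℝ)..a, s x) = ∫ x in a..b, s x :=
  intervalIntegral.integral_interval_sub_left (ii_bdd s hs M h0 hM _ _) (ii_bdd s hs M h0 hM _ _)

theorem U_mono (s : ℝ → ℝ) (hs : Measurable s) (M : ℝ) (h0 : ∀ x, 0 ≤ s x) (hM : ∀ x, s x ≤ M) :
    Monotone (fun r => ∫ x in (0:ℝ)..r, s x) := by
  intro a b hab
  have := U_sub s hs M h0 hM a b
  have h2 : 0 ≤ ∫ x in a..b, s x := intervalIntegral.integral_nonneg_of_forall hab h0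
  show (∫ x in (0:ℝ)..a, s x) ≤ ∫ x in (0:ℝ)..b, s x
  linarith

theorem U_cont (s : ℝ → ℝ) (hs : Measurable s) (M : ℝ) (h0 : ∀ x, 0 ≤ s x) (hM : ∀ x, s x ≤ M) :
    Continuous (fun r => ∫ x in (0:ℝ)..r, s x) :=
  intervalIntegral.continuous_primitive (fun a b => ii_bdd s hs M h0 hM a b) 0

theorem m_Ico (s : ℝ → ℝ) (hs : Measurable s) (M : ℝ) (h0 : ∀ x, 0 ≤ s x) (hM : ∀ x, s x ≤ M)
    (a b : ℝ) (hab : a ≤ b) :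
    (volume.withDensity fun x => ENNReal.ofReal (s x)) (Ico a b) =
      ENNReal.ofReal ((∫ x in (0:ℝ)..b, s x) - ∫ x in (0:ℝ)..a, s x) := by
  rw [withDensity_apply _ measurableSet_Ico, U_sub s hs M h0 hM,
    intervalIntegral.integral_of_le hab, ← integral_Ico_eq_integral_Ioc,
    ofReal_integral_eq_lintegral_ofReal]
  · have := (ii_bdd s hs M h0 hM a b)
    rw [intervalIntegrable_iff_integrableOn_Ico_of_le hab] at this
    exact this
  · exact Filter.Eventually.of_forall h0

theorem m_Icc (s : ℝ → ℝ) (hs : Measurable s) (M : ℝ) (h0 : ∀ x, 0 ≤ s x) (hM : ∀ x, s x ≤ M)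
    (a b : ℝ) (hab : a ≤ b) :
    (volume.withDensity fun x => ENNReal.ofReal (s x)) (Icc a b) =
      ENNReal.ofReal ((∫ x in (0:ℝ)..b, s x) - ∫ x in (0:ℝ)..a, s x) := by
  rw [← m_Ico s hs M h0 hM a b hab]
  apply measure_congr
  have : (Ico a b : Set ℝ) =ᵐ[volume] Icc a b := Ico_ae_eq_Icc
  exact (withDensity_absolutelyContinuous volume _).ae_le this.symm

theorem push_cell (s : ℝ → ℝ) (hs : Measurable s) (M : ℝ) (h0 : ∀ x, 0 ≤ s x)
    (hM : ∀ x, s x ≤ M) (α α' : ℝ) (hα : α ≤ α') :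
    ((volume.withDensity fun x => ENNReal.ofReal (s x)).restrict (Ico α α')).map
      (fun r => ∫ x in (0:ℝ)..r, s x) =
      volume.restrict (Ico (∫ x in (0:ℝ)..α, s x) (∫ x in (0:ℝ)..α', s x)) := by
  have hUm := U_mono s hs M h0 hM
  have hUc := U_cont s hs M h0 hM
  have hIco := m_Ico s hs M h0 hM
  have hIcc := m_Icc s hs M h0 hM
  set m := volume.withDensity fun x => ENNReal.ofReal (s x) with hm
  set U : ℝ → ℝ := fun r => ∫ x in (0:ℝ)..r, s x with hU
  have hfin : IsFiniteMeasure (m.restrict (Ico α α')) := by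
    constructor
    rw [Measure.restrict_apply_univ, hIco _ _ hα]
    exact ENNReal.ofReal_lt_top
  have hfin2 : IsFiniteMeasure ((m.restrict (Ico α α')).map U) := by infer_instance
  show (m.restrict (Ico α α')).map U = volume.restrict (Ico (U α) (U α'))
  apply Measure.ext_of_Iic
  intro c
  rw [Measure.map_apply hUc.measurable measurableSet_Iic,
    Measure.restrict_apply (hUc.measurable measurableSet_Iic),
    Measure.restrict_apply measurableSet_Iic]
  by_cases hc : c < U α
  · have e1 : U ⁻¹' Iic c ∩ Ico α α' = ∅ := by
      ext r
      simp only [mem_inter_iff, mem_preimage, mem_Iic, mem_Ico, mem_empty_iff_false, iff_false]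
      rintro ⟨h1, h2, -⟩
      exact absurd (hUm h2) (by show ¬ (U α ≤ U r); linarith)
    have e2 : Iic c ∩ Ico (U α) (U α') = ∅ := by
      ext r
      simp only [mem_inter_iff, mem_Iic, mem_Ico, mem_empty_iff_false, iff_false]
      rintro ⟨h1, h2, -⟩
      linarith
    rw [e1, e2]; simp
  push Not at hc
  have hT : IsCompact (Icc α α' ∩ U ⁻¹' Iic c) :=
    isCompact_Icc.inter_right (isClosed_Iic.preimage hUc)
  obtain ⟨r, ⟨⟨hr1, hr2⟩, hr3⟩, hrmax⟩ := hT.exists_isGreatest ⟨α, ⟨le_rfl, hα⟩, hc⟩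
  have hr3' : U r ≤ c := hr3
  have hUr : U r = min c (U α') := by
    rcases le_or_gt (U α') c with h | h
    · have : α' ≤ r := hrmax ⟨⟨hα, le_rfl⟩, h⟩
      rw [min_eq_right h, le_antisymm hr2 this]
    · rw [min_eq_left h.le]
      obtain ⟨x, hx, hxc⟩ := intermediate_value_Icc hr2 hUc.continuousOn (show c ∈ Icc (U r) (U α') from ⟨hr3', h.le⟩)
      have : x ≤ r := hrmax ⟨⟨hr1.trans hx.1, hx.2⟩, hxc.le⟩
      rw [← hxc, le_antisymm this hx.1]
  have hUα : U α ≤ U r := hUm hr1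
  have e1 : m (U ⁻¹' Iic c ∩ Ico α α') = ENNReal.ofReal (U r - U α) := by
    apply le_antisymm
    · rw [← hIcc α r hr1]
      apply measure_mono
      rintro x ⟨hx1, hx2, hx3⟩
      exact ⟨hx2, hrmax ⟨⟨hx2, hx3.le⟩, hx1⟩⟩
    · rw [← hIco α r hr1]
      apply measure_mono
      rintro x ⟨hx1, hx2⟩
      exact ⟨(hUm hx2.le).trans hr3', hx1, hx2.trans_le hr2⟩
  rw [e1]
  apply le_antisymm
  · rw [← Real.volume_Ico]
    apply measure_mono
    rintro x ⟨hx1, hx2⟩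
    rw [hUr] at hx2
    exact ⟨(hx2.trans_le (min_le_left _ _)).le, hx1, hx2.trans_le (min_le_right _ _)⟩
  · rw [← Real.volume_Icc]
    apply measure_mono
    rintro x ⟨hx1, hx2, hx3⟩
    rw [hUr]
    exact ⟨hx2, le_min hx1 hx3.le⟩

theorem push_cells (s : ℝ → ℝ) (hs : Measurable s) (M : ℝ) (h0 : ∀ x, 0 ≤ s x)
    (hM : ∀ x, s x ≤ M) (h : ℝ) (hh : 0 < h) (P : ℤ → ℝ) (hP : Monotone P) (H : ℝ → ℝ)
    (hHm : Measurable H)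
    (hH : ∀ p : ℤ, ∀ r ∈ Ico (p * h) ((p + 1 : ℤ) * h), H r = P p + ∫ x in (0:ℝ)..r, s x) :
    (volume.withDensity fun x => ENNReal.ofReal (s x)).map H =
      volume.restrict (⋃ p : ℤ, Ico (P p + ∫ x in (0:ℝ)..(p * h), s x)
        (P p + ∫ x in (0:ℝ)..((p + 1 : ℤ) * h), s x)) := by
  have hUm := U_mono s hs M h0 hM
  have hUc := U_cont s hs M h0 hM
  have hcell := push_cell s hs M h0 hM
  set m := volume.withDensity fun x => ENNReal.ofReal (s x) with hm
  set U : ℝ → ℝ := fun r => ∫ x in (0:ℝ)..r, s x with hU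
  have hdis1 : Pairwise (Function.onFun Disjoint fun p : ℤ => Ico ((p:ℝ) * h) ((p + 1 : ℤ) * h)) := by
    have := pairwise_disjoint_Ico_zsmul h
    simpa [zsmul_eq_mul] using this
  have hun1 : ⋃ p : ℤ, Ico ((p:ℝ) * h) ((p + 1 : ℤ) * h) = univ := by
    have := iUnion_Ico_zsmul hh
    simpa [zsmul_eq_mul] using this
  have hdis2 : Pairwise (Function.onFun Disjoint fun p : ℤ =>
      Ico (P p + U (p * h)) (P p + U ((p + 1 : ℤ) * h))) := by
    have key : ∀ p q : ℤ, p < q → Disjoint (Ico (P p + U (p * h)) (P p + U ((p + 1 : ℤ) * h)))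
        (Ico (P q + U (q * h)) (P q + U ((q + 1 : ℤ) * h))) := by
      intro p q hpq
      rw [Set.disjoint_left]
      rintro x ⟨-, hx1⟩ ⟨hx2, -⟩
      have e1 : P p ≤ P q := hP hpq.le
      have e2 : U ((p + 1 : ℤ) * h) ≤ U (q * h) := by
        apply hUm
        gcongr
        exact_mod_cast hpq
      linarith
    intro p q hpq
    rcases lt_or_gt_of_ne hpq with h | h
    · exact key p q h
    · exact (key q p h).symm
  have hpc : ∀ p : ℤ, (m.restrict (Ico ((p:ℝ) * h) ((p + 1 : ℤ) * h))).map H =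
      volume.restrict (Ico (P p + U (p * h)) (P p + U ((p + 1 : ℤ) * h))) := by
    intro p
    have e1 : (m.restrict (Ico ((p:ℝ) * h) ((p + 1 : ℤ) * h))).map H =
        (m.restrict (Ico ((p:ℝ) * h) ((p + 1 : ℤ) * h))).map (fun r => P p + U r) := by
      apply Measure.map_congr
      filter_upwards [ae_restrict_mem measurableSet_Ico] with r hr
      exact hH p r hr
    have e2 : (m.restrict (Ico ((p:ℝ) * h) ((p + 1 : ℤ) * h))).map (fun r => P p + U r) =
      ((m.restrict (Ico ((p:ℝ) * h) ((p + 1 : ℤ) * h))).map U).map (fun r => P p + r) := by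
      rw [Measure.map_map (by fun_prop) hUc.measurable]; rfl
    rw [e1, e2]
    have hle : (p:ℝ) * h ≤ ((p + 1 : ℤ) : ℝ) * h := by
      gcongr
      exact_mod_cast (Int.le_add_one le_rfl)
    have e3 := hcell ((p:ℝ) * h) ((p + 1 : ℤ) * h) hle
    rw [show (m.restrict (Ico ((p:ℝ) * h) ((p + 1 : ℤ) * h))).map U = _ from e3]
    have e4 : Ico (U (p * h)) (U ((p + 1 : ℤ) * h)) = (fun r => P p + r) ⁻¹'
      (Ico (P p + U (p * h)) (P p + U ((p + 1 : ℤ) * h))) := by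
      simp
    show (volume.restrict (Ico (U (p * h)) (U ((p + 1 : ℤ) * h)))).map _ = _
    rw [e4, ← Measure.restrict_map (by fun_prop) measurableSet_Ico, map_add_left_eq_self]
  ext B hB
  rw [Measure.map_apply hHm hB, ← Measure.restrict_univ (μ := m), ← hun1,
    Measure.restrict_iUnion hdis1 (fun p => measurableSet_Ico),
    Measure.restrict_iUnion hdis2 (fun p => measurableSet_Ico),
    Measure.sum_apply _ (hHm hB), Measure.sum_apply _ hB]
  congr 1
  ext p
  rw [← hpc p, Measure.map_apply hHm hB]

theorem G_surj (J : ℝ → ℝ) (hJ : Measurable J) (c M : ℝ) (hc : 0 < c) (h0 : ∀ x, c ≤ J x)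
    (hM : ∀ x, J x ≤ M) : 
    (∀ a b, a ≤ b → c * (b - a) ≤ (∫ x in (0:ℝ)..b, J x) - ∫ x in (0:ℝ)..a, J x) ∧
    StrictMono (fun r => ∫ x in (0:ℝ)..r, J x) ∧
    Function.Surjective (fun r => ∫ x in (0:ℝ)..r, J x) := by
  have h00 : ∀ x, 0 ≤ J x := fun x => hc.le.trans (h0 x)
  have key : ∀ a b, a ≤ b → c * (b - a) ≤ (∫ x in (0:ℝ)..b, J x) - ∫ x in (0:ℝ)..a, J x := by
    intro a b hab
    rw [U_sub J hJ M h00 hM]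
    have := intervalIntegral.integral_mono_on hab (intervalIntegrable_const (c := c))
      (ii_bdd J hJ M h00 hM a b) (fun x _ => h0 x)
    rw [intervalIntegral.integral_const, smul_eq_mul, mul_comm] at this
    exact this
  refine ⟨key, fun a b hab => ?_, ?_⟩
  · have h1 := key a b hab.le
    have h2 : 0 < c * (b - a) := mul_pos hc (by linarith)
    show (∫ x in (0:ℝ)..a, J x) < ∫ x in (0:ℝ)..b, J x
    linarith
  · have hcont := U_cont J hJ M h00 hM
    apply hcont.surjective
    · apply Filter.tendsto_atTop_mono' _ (f₁ := fun r => c * r)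
      · filter_upwards [Filter.eventually_ge_atTop 0] with r hr
        have := key 0 r hr
        simp only [intervalIntegral.integral_same] at this
        linarith
      · exact Filter.Tendsto.const_mul_atTop hc Filter.tendsto_id
    · apply Filter.tendsto_atBot_mono' _ (f₁ := fun r => c * r)
      · filter_upwards [Filter.eventually_le_atBot 0] with r hr
        have := key r 0 hr
        simp only [intervalIntegral.integral_same] at this
        linarith
      · exact Filter.Tendsto.const_mul_atBot hc Filter.tendsto_id

theorem push_inv (J : ℝ → ℝ) (hJ : Measurable J) (c M : ℝ) (hc : 0 < c) (h0 : ∀ x, c ≤ J x)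
    (hM : ∀ x, J x ≤ M) : (volume.withDensity fun x => ENNReal.ofReal (J x)).map
      (fun r => ∫ x in (0:ℝ)..r, J x) = volume := by
  have h00 : ∀ x, 0 ≤ J x := fun x => hc.le.trans (h0 x)
  obtain ⟨-, hmono, hsurj⟩ := G_surj J hJ c M hc h0 hM
  rw [push_cells J hJ M h00 hM 1 one_pos (fun _ => 0) monotone_const _
    (U_cont J hJ M h00 hM).measurable (fun p r _ => by simp)]
  refine Eq.trans (congrArg _ ?_) Measure.restrict_univ
  rw [eq_univ_iff_forall]
  intro x
  obtain ⟨r, rfl⟩ := hsurj x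
  rw [mem_iUnion]
  refine ⟨⌊r⌋, ?_⟩
  simp only [zero_add, mul_one]
  exact ⟨hmono.monotone (Int.floor_le r), hmono (by push_cast; exact Int.lt_floor_add_one r)⟩

theorem line_push (s : ℝ → ℝ) (hs : Measurable s) (M : ℝ) (h0 : ∀ x, 0 ≤ s x)
    (hM : ∀ x, s x ≤ M) (h : ℝ) (hh : 0 < h) (P : ℤ → ℝ) (hP : Monotone P) (H : ℝ → ℝ)
    (hHm : Measurable H)
    (hH : ∀ p : ℤ, ∀ r ∈ Ico (p * h) ((p + 1 : ℤ) * h), H r = P p + ∫ x in (0:ℝ)..r, s x)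
    (J : ℝ → ℝ) (hJ : Measurable J) (c : ℝ) (hc : 0 < c) (hJ0 : ∀ x, c ≤ J x)
    (hJM : ∀ x, J x ≤ M) (a : ℝ → ℝ) (ham : Measurable a)
    (ha : ∀ r, ∫ x in (0:ℝ)..(a r), J x = H r) :
    (volume.withDensity fun x => ENNReal.ofReal (s x)).map a =
      (volume.withDensity fun x => ENNReal.ofReal (J x)).restrict
        ((fun r => ∫ x in (0:ℝ)..r, J x) ⁻¹'
          (⋃ p : ℤ, Ico (P p + ∫ x in (0:ℝ)..(p * h), s x)
            (P p + ∫ x in (0:ℝ)..((p + 1 : ℤ) * h), s x))) := by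
  have hJ00 : ∀ x, 0 ≤ J x := fun x => hc.le.trans (hJ0 x)
  obtain ⟨-, hmono, hsurj⟩ := G_surj J hJ c M hc hJ0 hJM
  have hcont := U_cont J hJ M hJ00 hJM
  have h1 := push_cells s hs M h0 hM h hh P hP H hHm hH
  have h2 := push_inv J hJ c M hc hJ0 hJM
  set G : ℝ → ℝ := fun r => ∫ x in (0:ℝ)..r, J x with hG
  set Q := ⋃ p : ℤ, Ico (P p + ∫ x in (0:ℝ)..(p * h), s x)
            (P p + ∫ x in (0:ℝ)..((p + 1 : ℤ) * h), s x) with hQ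
  have hQm : MeasurableSet Q := MeasurableSet.iUnion fun p => measurableSet_Ico
  have hemb : MeasurableEmbedding G := hcont.measurableEmbedding hmono.injective
  have e : ((volume.withDensity fun x => ENNReal.ofReal (s x)).map a).map G =
      ((volume.withDensity fun x => ENNReal.ofReal (J x)).restrict (G ⁻¹' Q)).map G := by
    rw [Measure.map_map hcont.measurable ham, ← Measure.restrict_map hcont.measurable hQm, h2, ← h1]
    congr 1
    ext r
    exact ha r
  rw [← hemb.comap_map ((volume.withDensity fun x => ENNReal.ofReal (s x)).map a), e,
    hemb.comap_map]


noncomputable def etaf (k : ℕ) (t : ℝ) : ℝ := min 1 (max 0 (2 ^ (k + 1) * (t * (1 - t)) - 1))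
noncomputable def thetaf (k : ℕ) (t : ℝ) : ℝ := etaf (k + 1) t - etaf k t
noncomputable def NNf (t : ℝ) : ℕ := ⌈1 / (t * (1 - t))⌉₊
noncomputable def flf (m : ℕ) (r : ℝ) : ℝ := (⌊2 ^ m * r⌋ : ℝ) / 2 ^ m
noncomputable def cf (d : ℕ) (t : ℝ) : ℝ := (t * (1 - t)) ^ d
noncomputable def Rf (m : ℕ → ℕ) (D : ℝ → ℝ → ℝ) (t r : ℝ) : ℝ :=
  ∑ k ∈ Finset.range (NNf t), thetaf k t * (D t r - D t (flf (m k) r))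

theorem u_nonneg {t : ℝ} (ht : t ∈ Icc (0:ℝ) 1) : 0 ≤ t * (1 - t) :=
  mul_nonneg ht.1 (by linarith [ht.2])

theorem u_le {t : ℝ} : t * (1 - t) ≤ 1 / 4 := by nlinarith [sq_nonneg (t - 1/2)]

theorem eta_nonneg (k : ℕ) (t : ℝ) : 0 ≤ etaf k t := le_min zero_le_one (le_max_left _ _)
theorem eta_le (k : ℕ) (t : ℝ) : etaf k t ≤ 1 := min_le_left _ _

theorem eta_zero (t : ℝ) : etaf 0 t = 0 := by
  unfold etaf
  have := @u_le t
  rw [max_eq_left (by norm_num; linarith)]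
  simp

theorem theta_nonneg (k : ℕ) {t : ℝ} (ht : t ∈ Icc (0:ℝ) 1) : 0 ≤ thetaf k t := by
  unfold thetaf etaf
  have := u_nonneg ht
  rw [sub_nonneg]
  gcongr
  · norm_num
  · omega

theorem theta_le (k : ℕ) (t : ℝ) : thetaf k t ≤ 1 := by
  unfold thetaf
  linarith [eta_nonneg k t, eta_le (k+1) t]

theorem eta_lip (k : ℕ) {s t : ℝ} (hs : s ∈ Icc (0:ℝ) 1) (ht : t ∈ Icc (0:ℝ) 1) :
    |etaf k t - etaf k s| ≤ 2 ^ (k + 1) * |t - s| := by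
  unfold etaf
  refine (abs_min_sub_min_le_max _ _ _ _).trans ?_
  refine max_le (by simp) ?_
  refine (abs_max_sub_max_le_max _ _ _ _).trans ?_
  refine max_le (by simp) ?_
  have e : (2:ℝ) ^ (k + 1) * (t * (1 - t)) - 1 - (2 ^ (k + 1) * (s * (1 - s)) - 1) =
    2 ^ (k + 1) * ((t - s) * (1 - t - s)) := by ring
  rw [e, abs_mul, abs_of_pos (by positivity : (0:ℝ) < 2 ^ (k+1)), abs_mul]
  gcongr
  have : |1 - t - s| ≤ 1 := by rw [abs_le]; constructor <;> linarith [hs.1, hs.2, ht.1, ht.2]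
  nlinarith [abs_nonneg (t - s)]

theorem theta_lip (k : ℕ) {s t : ℝ} (hs : s ∈ Icc (0:ℝ) 1) (ht : t ∈ Icc (0:ℝ) 1) :
    |thetaf k t - thetaf k s| ≤ 2 ^ (k + 3) * |t - s| := by
  have h1 := eta_lip k hs ht
  have h2 := eta_lip (k+1) hs ht
  have e : thetaf k t - thetaf k s = (etaf (k+1) t - etaf (k+1) s) - (etaf k t - etaf k s) := by
    unfold thetaf; ring
  rw [e]
  refine (abs_sub _ _).trans ?_
  have := abs_nonneg (t - s)
  have h3 : (0:ℝ) < 2 ^ k := by positivity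
  have : 0 ≤ 2 ^ k * |t - s| := by positivity
  rw [pow_succ] at *
  rw [pow_succ] at h2
  rw [show (2:ℝ)^(k+2) = 2^k*4 by ring]
  nlinarith

theorem theta_pos (k : ℕ) {t : ℝ} (ht : t ∈ Icc (0:ℝ) 1) (h : thetaf k t ≠ 0) :
    (1 / 2 : ℝ) ^ (k + 2) ≤ t * (1 - t) := by
  by_contra hc
  push Not at hc
  apply h
  have h2 : (0:ℝ) < 2 ^ (k+2) := by positivity
  have h3 : (2:ℝ) ^ (k+2) * (t * (1 - t)) < 1 := by
    have e : (2:ℝ) ^ (k+2) * (1/2) ^ (k+2) = 1 := by rw [← mul_pow]; norm_num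
    calc _ < (2:ℝ) ^ (k+2) * (1/2) ^ (k+2) := by gcongr
      _ = 1 := e
  have h4 : etaf (k+1) t = 0 := by
    unfold etaf
    rw [max_eq_left (by rw [show k + 1 + 1 = k + 2 by ring]; linarith)]
    simp
  have h5 := theta_nonneg k ht
  unfold thetaf at h5 ⊢
  linarith [eta_nonneg k t]

theorem theta_zero {t : ℝ} (ht : t ∈ Icc (0:ℝ) 1) (k : ℕ) (hk : NNf t ≤ k) : thetaf k t = 0 := by
  rcases (u_nonneg ht).eq_or_lt with h | h
  · by_contra hc
    have := theta_pos k ht hc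
    rw [← h] at this
    exact absurd this (not_le.2 (by positivity))
  · have h1 : ∀ j, NNf t ≤ j → etaf j t = 1 := by
      intro j hj
      unfold etaf
      have h2 : 1 / (t * (1 - t)) ≤ j := (Nat.le_ceil _).trans (by exact_mod_cast hj)
      have h3 : (j : ℝ) ≤ 2 ^ j := by exact_mod_cast Nat.lt_two_pow_self.le
      have h4 : 1 ≤ 2 ^ j * (t * (1 - t)) := by
        rw [div_le_iff₀ h] at h2
        nlinarith
      apply min_eq_left
      apply le_max_of_le_right
      rw [pow_succ]; linarith
    unfold thetaf
    rw [h1 k hk, h1 (k+1) (by omega), sub_self]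

theorem theta_sum {t : ℝ} (ht : t ∈ Ioo (0:ℝ) 1) :
    ∑ k ∈ Finset.range (NNf t), thetaf k t = 1 := by
  have h : 0 < t * (1 - t) := mul_pos ht.1 (by linarith [ht.2])
  unfold thetaf
  rw [Finset.sum_range_sub (fun k => etaf k t), eta_zero]
  unfold etaf
  have h2 : 1 / (t * (1 - t)) ≤ NNf t := Nat.le_ceil _
  have h3 : (NNf t : ℝ) ≤ 2 ^ (NNf t) := by exact_mod_cast Nat.lt_two_pow_self.le
  have h4 : 1 ≤ 2 ^ (NNf t) * (t * (1 - t)) := by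
    rw [div_le_iff₀ h] at h2
    nlinarith
  rw [sub_zero]
  apply min_eq_left
  apply le_max_of_le_right
  rw [pow_succ]; linarith

theorem Rf_eq (m : ℕ → ℕ) (D : ℝ → ℝ → ℝ) {t : ℝ} (ht : t ∈ Icc (0:ℝ) 1) (r : ℝ) (K : ℕ)
    (hK : NNf t ≤ K) :
    Rf m D t r = ∑ k ∈ Finset.range K, thetaf k t * (D t r - D t (flf (m k) r)) := by
  unfold Rf
  apply Finset.sum_subset (by simpa using hK)
  intro k _ hk
  rw [theta_zero ht k (by simpa using hk), zero_mul]

theorem fl_le (m : ℕ) (r : ℝ) : flf m r ≤ r ∧ r - flf m r ≤ (1/2) ^ m := by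
  unfold flf
  have h : (0:ℝ) < 2 ^ m := by positivity
  constructor
  · rw [div_le_iff₀ h, mul_comm]; exact Int.floor_le _
  · have := (Int.lt_floor_add_one ((2:ℝ) ^ m * r)).le
    rw [one_div, inv_pow, sub_le_iff_le_add, ← one_div, ← add_div, le_div_iff₀ h]
    linarith

theorem fl_mono (m : ℕ) : Monotone (flf m) := by
  intro a b hab
  unfold flf
  gcongr

theorem fl_cell (m n : ℕ) (hmn : m ≤ n) (p : ℤ) (r : ℝ)
    (hr : r ∈ Ico (p * (1/2:ℝ)^n) ((p + 1 : ℤ) * (1/2:ℝ)^n)) :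
    flf m r = flf m (p * (1/2:ℝ)^n) := by
  unfold flf
  congr 2
  obtain ⟨j, rfl⟩ := Nat.exists_eq_add_of_le hmn
  have h1 : (2:ℝ) ^ m * (p * (1/2:ℝ)^(m+j)) = p / ((2 ^ j : ℕ) : ℝ) := by
    push_cast
    rw [pow_add, one_div, inv_pow, inv_pow]; field_simp
  have h2 : (2:ℝ) ^ m * r = (2 ^ (m + j) * r) / ((2 ^ j : ℕ) : ℝ) := by
    push_cast
    rw [pow_add]; field_simp
  have h3 : ⌊(2:ℝ) ^ (m + j) * r⌋ = p := by
    rw [Int.floor_eq_iff]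
    have hp : (0:ℝ) < 2 ^ (m+j) := by positivity
    obtain ⟨ha, hb⟩ := hr
    rw [one_div, inv_pow, ← div_eq_mul_inv] at ha hb
    rw [div_le_iff₀ hp] at ha
    rw [lt_div_iff₀ hp] at hb
    push_cast at hb
    constructor <;> linarith
  rw [h1, h2, Int.floor_div_natCast, Int.floor_div_natCast, h3, Int.floor_intCast]

theorem half_sum (K : ℕ) : ∑ k ∈ Finset.range K, (1/2:ℝ) ^ (k + 1) ≤ 1 := by
  have : ∑ k ∈ Finset.range K, (1/2:ℝ) ^ (k + 1) = 1 - (1/2) ^ K := by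
    induction K with
    | zero => simp
    | succ n ih => rw [Finset.sum_range_succ, ih]; ring
  rw [this]
  have : (0:ℝ) < (1/2) ^ K := by positivity
  linarith

theorem Rf_bounds (d : ℕ) (m : ℕ → ℕ) (D : ℝ → ℝ → ℝ) (M ε : ℝ) (hM : 0 ≤ M) (hε : 0 ≤ ε)
    (hm : ∀ k, M * (1/2) ^ (m k) * (2 ^ (k+3) + 1) ≤ ε * (1/2) ^ (k+1) * (((1/2) ^ (k+2)) ^ d) ^ 2)
    (hD0 : ∀ t ∈ Icc (0:ℝ) 1, Monotone (D t))
    (hD1 : ∀ t ∈ Icc (0:ℝ) 1, ∀ a b, a ≤ b → D t b - D t a ≤ M * (b - a))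
    (hD2 : ∀ t ∈ Icc (0:ℝ) 1, ∀ s ∈ Icc (0:ℝ) 1, ∀ a b, a ≤ b →
      |(D t b - D t a) - (D s b - D s a)| ≤ M * |t - s| * (b - a)) (r : ℝ) :
    (∀ t ∈ Icc (0:ℝ) 1, 0 ≤ Rf m D t r ∧ Rf m D t r ≤ ε * cf d t ^ 2) ∧
    (∀ t ∈ Icc (0:ℝ) 1, ∀ s ∈ Icc (0:ℝ) 1, cf d s ≤ cf d t →
      |Rf m D t r - Rf m D s r| ≤ ε * |t - s| * cf d t ^ 2) := by
  have hI0 : ∀ t ∈ Icc (0:ℝ) 1, ∀ k, 0 ≤ D t r - D t (flf (m k) r) := fun t ht k =>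
    sub_nonneg.2 (hD0 t ht (fl_le _ _).1)
  have hI1 : ∀ t ∈ Icc (0:ℝ) 1, ∀ k, D t r - D t (flf (m k) r) ≤ M * (1/2) ^ (m k) := fun t ht k =>
    (hD1 t ht _ _ (fl_le _ _).1).trans (by gcongr; exact (fl_le _ _).2)
  have hcc : ∀ t ∈ Icc (0:ℝ) 1, ∀ k, thetaf k t ≠ 0 → (((1/2:ℝ) ^ (k+2)) ^ d) ^ 2 ≤ cf d t ^ 2 := by
    intro t ht k hk
    unfold cf
    gcongr
    exact theta_pos k ht hk
  constructor
  · intro t ht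
    refine ⟨Finset.sum_nonneg fun k _ => mul_nonneg (theta_nonneg k ht) (hI0 t ht k), ?_⟩
    have : Rf m D t r ≤ ∑ k ∈ Finset.range (NNf t), (1/2:ℝ) ^ (k + 1) * (ε * cf d t ^ 2) := by
      apply Finset.sum_le_sum
      intro k _
      by_cases hk : thetaf k t = 0
      · rw [hk, zero_mul]; positivity
      have h1 := hm k
      have h2 := hcc t ht k hk
      calc _ ≤ 1 * (M * (1/2) ^ (m k)) := by
            gcongr
            · exact hI0 t ht k
            · exact theta_le k t
            · exact hI1 t ht k
        _ ≤ M * (1/2) ^ (m k) * (2 ^ (k+3) + 1) := by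
            rw [one_mul]
            apply le_mul_of_one_le_right (by positivity)
            have : (0:ℝ) < 2 ^ (k+3) := by positivity
            linarith
        _ ≤ _ := h1
        _ ≤ ε * (1/2) ^ (k+1) * (cf d t ^ 2) := by gcongr
        _ = _ := by ring
    refine this.trans ?_
    rw [← Finset.sum_mul]
    have := half_sum (NNf t)
    have h0 : 0 ≤ ε * cf d t ^ 2 := by positivity
    nlinarith
  · intro t ht s hs hcs
    have hc0 : 0 ≤ cf d s := pow_nonneg (u_nonneg hs) d
    rw [Rf_eq m D ht r (max (NNf t) (NNf s)) (le_max_left _ _),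
      Rf_eq m D hs r (max (NNf t) (NNf s)) (le_max_right _ _), ← Finset.sum_sub_distrib]
    refine (Finset.abs_sum_le_sum_abs _ _).trans ?_
    have : ∀ k, |thetaf k t * (D t r - D t (flf (m k) r)) - thetaf k s * (D s r - D s (flf (m k) r))|
        ≤ (1/2:ℝ) ^ (k + 1) * (ε * |t - s| * cf d t ^ 2) := by
      intro k
      by_cases hk : thetaf k t = 0 ∧ thetaf k s = 0
      · rw [hk.1, hk.2, zero_mul, zero_mul, sub_zero, abs_zero]; positivity
      have h2 : (((1/2:ℝ) ^ (k+2)) ^ d) ^ 2 ≤ cf d t ^ 2 := by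
        by_cases hkt : thetaf k t = 0
        · have : thetaf k s ≠ 0 := fun h => hk ⟨hkt, h⟩
          refine (hcc s hs k this).trans ?_
          gcongr
        · exact hcc t ht k hkt
      have h1 := hm k
      have e : thetaf k t * (D t r - D t (flf (m k) r)) - thetaf k s * (D s r - D s (flf (m k) r)) =
        (thetaf k t - thetaf k s) * (D t r - D t (flf (m k) r)) +
        thetaf k s * ((D t r - D t (flf (m k) r)) - (D s r - D s (flf (m k) r))) := by ring
      rw [e]
      refine (abs_add_le _ _).trans ?_
      rw [abs_mul, abs_mul, abs_of_nonneg (hI0 t ht k), abs_of_nonneg (theta_nonneg k hs)]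
      calc _ ≤ (2 ^ (k+3) * |t - s|) * (M * (1/2) ^ (m k)) + 1 * (M * |t - s| * (1/2) ^ (m k)) := by
            gcongr
            · exact hI0 t ht k
            · exact theta_lip k hs ht
            · exact hI1 t ht k
            · exact theta_le k s
            · exact (hD2 t ht s hs _ _ (fl_le _ _).1).trans (by gcongr; exact (fl_le _ _).2)
        _ = |t - s| * (M * (1/2) ^ (m k) * (2 ^ (k+3) + 1)) := by ring
        _ ≤ |t - s| * (ε * (1/2) ^ (k+1) * (((1/2) ^ (k+2)) ^ d) ^ 2) := by gcongr
        _ ≤ |t - s| * (ε * (1/2) ^ (k+1) * (cf d t ^ 2)) := by gcongr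
        _ = _ := by ring
    refine (Finset.sum_le_sum fun k _ => this k).trans ?_
    rw [← Finset.sum_mul]
    have := half_sum (max (NNf t) (NNf s))
    have h0 : 0 ≤ ε * |t - s| * cf d t ^ 2 := by positivity
    nlinarith

theorem cf_le (d : ℕ) {t : ℝ} (ht : t ∈ Icc (0:ℝ) 1) : 0 ≤ cf d t ∧ cf d t ≤ 1 :=
  ⟨pow_nonneg (u_nonneg ht) d, pow_le_one₀ (u_nonneg ht) (u_le.trans (by norm_num))⟩

theorem a_lip (d : ℕ) (G R : ℝ → ℝ → ℝ) (a : ℝ → ℝ) (M ε r : ℝ) (hM : 0 ≤ M) (hε : 0 ≤ ε)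
    (hG1 : ∀ t ∈ Icc (0:ℝ) 1, ∀ x y, x ≤ y → cf d t * (y - x) ≤ G t y - G t x)
    (hG2 : ∀ t ∈ Icc (0:ℝ) 1, ∀ s ∈ Icc (0:ℝ) 1, ∀ x y, x ≤ y →
      |(G t y - G t x) - (G s y - G s x)| ≤ M * |t - s| * (y - x))
    (hR0 : ∀ t ∈ Icc (0:ℝ) 1, 0 ≤ R t r ∧ R t r ≤ ε * cf d t ^ 2)
    (hR1 : ∀ t ∈ Icc (0:ℝ) 1, ∀ s ∈ Icc (0:ℝ) 1, cf d s ≤ cf d t →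
      |R t r - R s r| ≤ ε * |t - s| * cf d t ^ 2)
    (ha : ∀ t ∈ Icc (0:ℝ) 1, G t (a t) = G t r - R t r)
    (ha0 : ∀ t ∈ Icc (0:ℝ) 1, cf d t = 0 → a t = r) :
    ∀ t ∈ Icc (0:ℝ) 1, ∀ s ∈ Icc (0:ℝ) 1, |a s - a t| ≤ ε * (1 + M) * |s - t| := by
  have hle : ∀ t ∈ Icc (0:ℝ) 1, a t ≤ r ∧ r - a t ≤ ε * cf d t := by
    intro t ht
    rcases (cf_le d ht).1.eq_or_lt with h | h
    · rw [ha0 t ht h.symm, ← h]; simp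
    · have e := ha t ht
      have h1 : a t ≤ r := by
        by_contra hc
        push Not at hc
        have := hG1 t ht r (a t) hc.le
        have h2 : 0 < cf d t * (a t - r) := mul_pos h (by linarith)
        linarith [(hR0 t ht).1]
      refine ⟨h1, ?_⟩
      have := hG1 t ht (a t) r h1
      have h3 := (hR0 t ht).2
      have : cf d t * (r - a t) ≤ cf d t * (ε * cf d t) := by nlinarith
      exact le_of_mul_le_mul_left this h
  have key : ∀ t ∈ Icc (0:ℝ) 1, ∀ s ∈ Icc (0:ℝ) 1, cf d s ≤ cf d t →
      |a s - a t| ≤ ε * (1 + M) * |s - t| := by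
    intro t ht s hs hc
    rcases (cf_le d ht).1.eq_or_lt with h | h
    · have : cf d s = 0 := le_antisymm (h ▸ hc) (cf_le d hs).1
      rw [ha0 t ht h.symm, ha0 s hs this, sub_self, abs_zero]; positivity
    · have h1 := (hle s hs)
      have h2 := hG2 t ht s hs (a s) r h1.1
      have h3 := hR1 t ht s hs hc
      have h4 : |G t (a s) - G t (a t)| ≤ ε * |t - s| * cf d t ^ 2 + M * |t - s| * (r - a s) := by
        have e : G t (a s) - G t (a t) = (R t r - R s r) - ((G t r - G t (a s)) - (G s r - G s (a s))) := by
          rw [ha t ht, ha s hs]; ring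
        rw [e]
        exact (abs_sub _ _).trans (add_le_add h3 h2)
      have h5 : cf d t * |a s - a t| ≤ |G t (a s) - G t (a t)| := by
        rcases le_total (a s) (a t) with hh | hh
        · have := hG1 t ht _ _ hh
          rw [abs_sub_comm, abs_of_nonneg (by linarith), abs_sub_comm]
          exact this.trans (le_abs_self _)
        · have := hG1 t ht _ _ hh
          rw [abs_of_nonneg (by linarith)]
          exact this.trans (le_abs_self _)
      have h6 : cf d t * |a s - a t| ≤ cf d t * (ε * (1 + M) * |s - t|) := by
        rw [abs_sub_comm s t]
        have hT := abs_nonneg (t - s)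
        calc _ ≤ ε * |t - s| * cf d t ^ 2 + M * |t - s| * (r - a s) := h5.trans h4
          _ ≤ ε * |t - s| * cf d t ^ 2 + M * |t - s| * (ε * cf d t) := by
            gcongr
            exact h1.2.trans (by gcongr)
          _ = cf d t * (ε * (cf d t + M) * |t - s|) := by ring
          _ ≤ _ := by
            gcongr
            exact (cf_le d ht).2
      exact le_of_mul_le_mul_left h6 h
  intro t ht s hs
  rcases le_total (cf d s) (cf d t) with h | h
  · exact key t ht s hs h
  · rw [abs_sub_comm (a s), abs_sub_comm s]
    exact key s hs t ht h

theorem exists_grid (δ : ℕ → ℝ) (hδ : ∀ k, 0 < δ k) :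
    ∃ m : ℕ → ℕ, Monotone m ∧ ∀ k, (1/2:ℝ) ^ (m k) ≤ δ k := by
  choose m0 hm0 using fun k => exists_pow_lt_of_lt_one (hδ k) (by norm_num : (1/2:ℝ) < 1)
  refine ⟨fun k => ∑ j ∈ Finset.range (k+1), m0 j, ?_, fun k => ?_⟩
  · intro a b hab
    apply Finset.sum_le_sum_of_subset
    simpa using hab
  · refine le_trans ?_ (hm0 k).le
    apply pow_le_pow_of_le_one (by norm_num) (by norm_num)
    exact Finset.single_le_sum (f := m0) (fun _ _ => Nat.zero_le _) (by simp)


theorem meas_ii {Y : Type*} [MeasurableSpace Y] (F : ℝ → Y → ℝ)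
    (hF : Measurable (fun p : ℝ × Y => F p.1 p.2)) :
    Measurable fun p : ℝ × Y => ∫ x in (0:ℝ)..p.1, F x p.2 := by
  have key : ∀ T : Set (ℝ × ℝ), MeasurableSet T →
      Measurable fun p : ℝ × Y => ∫ x, (T.indicator (fun _ => F x p.2)) (x, p.1) := by
    intro T hT
    have h1 : Measurable (fun q : (ℝ × Y) × ℝ =>
        (T.indicator (fun _ => F q.2 q.1.2)) (q.2, q.1.1)) := by
      have e : (fun q : (ℝ × Y) × ℝ =>
        (T.indicator (fun _ => F q.2 q.1.2)) (q.2, q.1.1)) =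
        ((fun q : (ℝ × Y) × ℝ => (q.2, q.1.1)) ⁻¹' T).indicator (fun q => F q.2 q.1.2) := by
        ext q
        rfl
      rw [e]
      apply Measurable.indicator
      · exact hF.comp (measurable_snd.prodMk (measurable_snd.comp measurable_fst))
      · exact (measurable_snd.prodMk (measurable_fst.comp measurable_fst)) hT
    exact (h1.stronglyMeasurable.integral_prod_right' (ν := volume)).measurable
  have e : (fun p : ℝ × Y => ∫ x in (0:ℝ)..p.1, F x p.2) = fun p : ℝ × Y =>
      (∫ x, (({q : ℝ × ℝ | 0 < q.1 ∧ q.1 ≤ q.2}).indicator (fun _ => F x p.2)) (x, p.1)) -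
      ∫ x, (({q : ℝ × ℝ | q.2 < q.1 ∧ q.1 ≤ 0}).indicator (fun _ => F x p.2)) (x, p.1) := by
    ext p
    unfold intervalIntegral
    rw [← integral_indicator measurableSet_Ioc, ← integral_indicator measurableSet_Ioc]
    congr 1
  rw [e]
  apply (key _ _).sub (key _ _)
  · exact (measurableSet_lt measurable_const measurable_fst).inter
      (measurableSet_le measurable_fst measurable_snd)
  · exact (measurableSet_lt measurable_snd measurable_fst).inter
      (measurableSet_le measurable_fst measurable_const)

theorem meas_sum {Y : Type*} [MeasurableSpace Y] (n : Y → ℕ) (hn : Measurable n)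
    (f : ℕ → Y → ℝ) (hf : ∀ k, Measurable (f k)) :
    Measurable fun y => ∑ k ∈ Finset.range (n y), f k y := by
  have : Measurable fun p : ℕ × Y => ∑ k ∈ Finset.range p.1, f k p.2 := by
    apply measurable_from_prod_countable_right
    intro j
    exact Finset.measurable_sum (Finset.range j) fun k _ => hf k
  exact this.comp (hn.prodMk measurable_id)

theorem meas_NN : Measurable NNf := by
  unfold NNf
  exact Nat.measurable_ceil.comp (by fun_prop)

theorem meas_theta (k : ℕ) : Measurable (thetaf k) := by
  unfold thetaf etaf
  fun_prop

theorem meas_fl (k : ℕ) : Measurable (flf k) := by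
  unfold flf
  have : Measurable fun r : ℝ => ((⌊(2:ℝ) ^ k * r⌋ : ℤ) : ℝ) :=
    measurable_from_top.comp (Int.measurable_floor.comp (by fun_prop))
  exact this.div_const _

theorem J_lip (J : ℝ → ℝ → ℝ) (hJm : ∀ t, Measurable (J t)) (M : ℝ)
    (h0 : ∀ t ∈ Icc (0:ℝ) 1, ∀ x, 0 ≤ J t x) (hM : ∀ t ∈ Icc (0:ℝ) 1, ∀ x, J t x ≤ M)
    (hl : ∀ t ∈ Icc (0:ℝ) 1, ∀ s ∈ Icc (0:ℝ) 1, ∀ x, |J t x - J s x| ≤ M * |t - s|)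
    (t : ℝ) (ht : t ∈ Icc (0:ℝ) 1) (s : ℝ) (hs : s ∈ Icc (0:ℝ) 1) (a b : ℝ) (hab : a ≤ b) :
    |((∫ x in (0:ℝ)..b, J t x) - ∫ x in (0:ℝ)..a, J t x) -
      ((∫ x in (0:ℝ)..b, J s x) - ∫ x in (0:ℝ)..a, J s x)| ≤ M * |t - s| * (b - a) := by
  rw [U_sub _ (hJm t) M (h0 t ht) (hM t ht), U_sub _ (hJm s) M (h0 s hs) (hM s hs),
    ← intervalIntegral.integral_sub (ii_bdd _ (hJm t) M (h0 t ht) (hM t ht) _ _)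
      (ii_bdd _ (hJm s) M (h0 s hs) (hM s hs) _ _)]
  have := intervalIntegral.norm_integral_le_of_norm_le_const (a := a) (b := b)
    (f := fun x => J t x - J s x) (C := M * |t - s|) (fun x _ => hl t ht s hs x)
  rwa [abs_of_nonneg (by linarith : 0 ≤ b - a)] at this

theorem lines_core {W : Type*} [MeasurableSpace W] (ν : Measure W) [SFinite ν] (d : ℕ) (hd : d ≠ 0)
    (s : ℝ × W → ℝ) (hs : Measurable s) (J : ℝ × W → ℝ → ℝ)
    (hJ : Measurable fun p : (ℝ × W) × ℝ => J p.1 p.2) (M : ℝ) (hM0 : 0 ≤ M)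
    (hs0 : ∀ z, 0 ≤ s z) (hsJ : ∀ z, ∀ t ∈ Icc (0:ℝ) 1, s z ≤ J z t)
    (hJM : ∀ z, ∀ t ∈ Icc (0:ℝ) 1, J z t ≤ M)
    (hJc : ∀ z, ∀ t ∈ Icc (0:ℝ) 1, cf d t ≤ J z t)
    (hJl : ∀ z, ∀ t ∈ Icc (0:ℝ) 1, ∀ t' ∈ Icc (0:ℝ) 1, |J z t - J z t'| ≤ M * |t - t'|)
    (ε : ℝ) (hε : 0 < ε) :
    ∃ a : ℝ × W → ℝ → ℝ, Measurable (fun p : (ℝ × W) × ℝ => a p.1 p.2) ∧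
      (∀ z, a z 0 = z.1) ∧ (∀ z, a z 1 = z.1) ∧
      (∀ z, ∀ t ∈ Icc (0:ℝ) 1, ∀ t' ∈ Icc (0:ℝ) 1, |a z t' - a z t| ≤ ε * (1 + M) * |t' - t|) ∧
      ∃ F : Set ((ℝ × W) × ℝ), MeasurableSet F ∧ ∀ t ∈ Ioo (0:ℝ) 1,
        (((volume : Measure ℝ).prod ν).withDensity fun z => ENNReal.ofReal (s z)).map
          (fun z => (a z t, z.2)) =
        (((volume : Measure ℝ).prod ν).withDensity fun z => ENNReal.ofReal (J z t)).restrict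
          {z | (z, t) ∈ F} := by
  -- grid choice
  obtain ⟨m, hmm, hm⟩ := exists_grid
    (fun k => ε * (1/2) ^ (k+1) * (((1/2) ^ (k+2)) ^ d) ^ 2 / ((M + 1) * (2 ^ (k+3) + 1)))
    (fun k => by positivity)
  have hm' : ∀ k, M * (1/2) ^ (m k) * (2 ^ (k+3) + 1) ≤
      ε * (1/2) ^ (k+1) * (((1/2) ^ (k+2)) ^ d) ^ 2 := by
    intro k
    have h1 := hm k
    rw [le_div_iff₀ (by positivity)] at h1
    refine le_trans ?_ h1
    have : (0:ℝ) ≤ (1/2) ^ m k * (2 ^ (k+3) + 1) := by positivity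
    nlinarith
  -- abbreviations
  obtain ⟨G, hG⟩ : ∃ G : W → ℝ → ℝ → ℝ, G = fun w t r => ∫ x in (0:ℝ)..r, J (x, w) t := ⟨_, rfl⟩
  obtain ⟨U, hU⟩ : ∃ U : W → ℝ → ℝ, U = fun w r => ∫ x in (0:ℝ)..r, s (x, w) := ⟨_, rfl⟩
  have hGe : ∀ w t r, G w t r = ∫ x in (0:ℝ)..r, J (x, w) t := fun w t r => by rw [hG]
  have hUe : ∀ w r, U w r = ∫ x in (0:ℝ)..r, s (x, w) := fun w r => by rw [hU]
  have hGm : Measurable fun p : ℝ × (W × ℝ) => G p.2.1 p.2.2 p.1 := by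
    simp only [hGe]
    exact meas_ii (fun x (y : W × ℝ) => J (x, y.1) y.2)
      (hJ.comp (by fun_prop : Measurable fun p : ℝ × (W × ℝ) => ((p.1, p.2.1), p.2.2)))
  have hUm : Measurable fun p : ℝ × W => U p.2 p.1 := by
    simp only [hUe]
    exact meas_ii (fun x (y : W) => s (x, y)) (hs.comp (by fun_prop))
  have hsw : ∀ w, Measurable fun x => s (x, w) := fun w => hs.comp (by fun_prop)
  have hJw : ∀ w t, Measurable fun x => J (x, w) t := fun w t =>
    hJ.comp (by fun_prop : Measurable fun x : ℝ => ((x, w), t))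
  have hIoo : ∀ {t : ℝ}, t ∈ Ioo (0:ℝ) 1 → t ∈ Icc (0:ℝ) 1 := fun h => Ioo_subset_Icc_self h
  have hc0 : ∀ t ∈ Ioo (0:ℝ) 1, 0 < cf d t := fun t ht =>
    pow_pos (mul_pos ht.1 (by linarith [ht.2])) d
  have h0I : (0:ℝ) ∈ Icc (0:ℝ) 1 := by simp
  have hsM : ∀ z, s z ≤ M := fun z => (hsJ z 0 h0I).trans (hJM z 0 h0I)
  have hJ0 : ∀ z, ∀ t ∈ Icc (0:ℝ) 1, 0 ≤ J z t := fun z t ht => (hs0 z).trans (hsJ z t ht)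
  have hcpos : ∀ t, t ∈ Icc (0:ℝ) 1 → t ∉ Ioo (0:ℝ) 1 → t = 0 ∨ t = 1 := by
    intro t ht h
    by_contra hc
    push Not at hc
    exact h ⟨lt_of_le_of_ne ht.1 (Ne.symm hc.1), lt_of_le_of_ne ht.2 hc.2⟩
  have hR01 : ∀ D t r, t = 0 ∨ t = 1 → Rf m D t r = 0 := by
    rintro D t r (rfl | rfl) <;> simp [Rf, NNf]
  -- G properties
  have hG1 : ∀ w, ∀ t ∈ Icc (0:ℝ) 1, ∀ x y, x ≤ y → cf d t * (y - x) ≤ G w t y - G w t x := by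
    intro w t ht x y hxy
    rw [hGe, hGe, U_sub _ (hJw w t) M (fun x => hJ0 _ t ht) (fun x => hJM _ t ht)]
    have := intervalIntegral.integral_mono_on hxy (intervalIntegrable_const (c := cf d t))
      (ii_bdd _ (hJw w t) M (fun x => hJ0 _ t ht) (fun x => hJM _ t ht) x y) (fun x _ => hJc _ t ht)
    rw [intervalIntegral.integral_const, smul_eq_mul, mul_comm] at this
    exact this
  have hG2 : ∀ w, ∀ t ∈ Icc (0:ℝ) 1, ∀ t' ∈ Icc (0:ℝ) 1, ∀ x y, x ≤ y →
      |(G w t y - G w t x) - (G w t' y - G w t' x)| ≤ M * |t - t'| * (y - x) := by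
    intro w t ht t' ht' x y hxy
    rw [hGe, hGe, hGe, hGe]
    exact J_lip (fun t x => J (x, w) t) (hJw w) M (fun t ht x => hJ0 _ t ht)
      (fun t ht x => hJM _ t ht) (fun t ht s hs x => hJl _ t ht s hs) t ht t' ht' x y hxy
  have hG3 : ∀ w, ∀ t ∈ Icc (0:ℝ) 1, ∀ x y, x ≤ y → G w t y - G w t x ≤ M * (y - x) := by
    intro w t ht x y hxy
    rw [hGe, hGe, U_sub _ (hJw w t) M (fun x => hJ0 _ t ht) (fun x => hJM _ t ht)]
    have := intervalIntegral.integral_mono_on hxy 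
      (ii_bdd _ (hJw w t) M (fun x => hJ0 _ t ht) (fun x => hJM _ t ht) x y) 
      (intervalIntegrable_const (c := M)) (fun x _ => hJM _ t ht)
    rw [intervalIntegral.integral_const, smul_eq_mul, mul_comm] at this
    exact this
  have hUmono : ∀ w, Monotone (U w) := by
    intro w
    have := U_mono _ (hsw w) M (fun x => hs0 _) (fun x => hsM _)
    rw [hU]; exact this
  have hUG : ∀ w, ∀ t ∈ Icc (0:ℝ) 1, ∀ x y, x ≤ y → U w y - U w x ≤ G w t y - G w t x := by
    intro w t ht x y hxy
    rw [hGe, hGe, hUe, hUe, U_sub _ (hJw w t) M (fun x => hJ0 _ t ht) (fun x => hJM _ t ht),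
      U_sub _ (hsw w) M (fun x => hs0 _) (fun x => hsM _)]
    exact intervalIntegral.integral_mono_on hxy 
      (ii_bdd _ (hsw w) M (fun x => hs0 _) (fun x => hsM _) x y) 
      (ii_bdd _ (hJw w t) M (fun x => hJ0 _ t ht) (fun x => hJM _ t ht) x y) 
      (fun x _ => hsJ _ t ht)
  obtain ⟨D, hD⟩ : ∃ D : W → ℝ → ℝ → ℝ, D = fun w t r => G w t r - U w r := ⟨_, rfl⟩
  have hDe : ∀ w t r, D w t r = G w t r - U w r := fun w t r => by rw [hD]
  have hDm : Measurable fun p : ℝ × (W × ℝ) => D p.2.1 p.2.2 p.1 := by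
    simp only [hDe]
    exact hGm.sub (hUm.comp (by fun_prop : Measurable fun p : ℝ × (W × ℝ) => (p.1, p.2.1)))
  have hDmono : ∀ w, ∀ t ∈ Icc (0:ℝ) 1, Monotone (D w t) := by
    intro w t ht x y hxy
    rw [hDe, hDe]; linarith [hUG w t ht x y hxy]
  have hRb : ∀ w r, _ := fun w r => Rf_bounds d m (D w) M ε hM0 hε.le hm' (hDmono w)
    (fun t ht x y hxy => by
      rw [hDe, hDe]; linarith [hG3 w t ht x y hxy, hUmono w hxy])
    (fun t ht t' ht' x y hxy => by
      rw [hDe, hDe, hDe, hDe]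
      have := hG2 w t ht t' ht' x y hxy
      convert this using 2
      ring) r
  have hGs : ∀ w, ∀ t ∈ Ioo (0:ℝ) 1, StrictMono (G w t) ∧ Function.Surjective (G w t) := by
    intro w t ht
    have := (G_surj _ (hJw w t) (cf d t) M (hc0 t ht) (fun x => hJc _ t (hIoo ht))
      (fun x => hJM _ t (hIoo ht))).2
    rw [hG]; exact this
  have hex : ∀ (z : ℝ × W) (t : ℝ), ∃ b,
      (t ∈ Ioo (0:ℝ) 1 → G z.2 t b = G z.2 t z.1 - Rf m (D z.2) t z.1) ∧
      (t ∉ Ioo (0:ℝ) 1 → b = z.1) := by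
    intro z t
    by_cases ht : t ∈ Ioo (0:ℝ) 1
    · obtain ⟨b, hb⟩ := (hGs z.2 t ht).2 (G z.2 t z.1 - Rf m (D z.2) t z.1)
      exact ⟨b, fun _ => hb, fun h => absurd ht h⟩
    · exact ⟨z.1, fun h => absurd h ht, fun _ => rfl⟩
  choose a ha1 ha2 using hex
  have hRm : Measurable fun p : (ℝ × W) × ℝ => Rf m (D p.1.2) p.2 p.1.1 := by
    unfold Rf
    apply meas_sum _ (meas_NN.comp measurable_snd)
    intro k
    apply ((meas_theta k).comp measurable_snd).mul
    apply Measurable.sub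
    · exact hDm.comp (by fun_prop : Measurable fun p : (ℝ × W) × ℝ => (p.1.1, (p.1.2, p.2)))
    · exact hDm.comp ((((meas_fl (m k)).comp (measurable_fst.comp measurable_fst)).prodMk
        (by fun_prop)) : Measurable fun p : (ℝ × W) × ℝ => (flf (m k) p.1.1, (p.1.2, p.2)))
  have hGm' : Measurable fun p : (ℝ × W) × ℝ => G p.1.2 p.2 p.1.1 :=
    hGm.comp (by fun_prop : Measurable fun p : (ℝ × W) × ℝ => (p.1.1, (p.1.2, p.2)))
  have hIm : MeasurableSet {p : (ℝ × W) × ℝ | p.2 ∈ Ioo (0:ℝ) 1} := measurable_snd measurableSet_Ioo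
  have ham : Measurable fun p : (ℝ × W) × ℝ => a p.1 p.2 := by
    apply measurable_of_Iic
    intro c
    have e : (fun p : (ℝ × W) × ℝ => a p.1 p.2) ⁻¹' Iic c =
        ({p : (ℝ × W) × ℝ | p.2 ∈ Ioo (0:ℝ) 1} ∩
          {p | G p.1.2 p.2 p.1.1 - Rf m (D p.1.2) p.2 p.1.1 ≤ G p.1.2 p.2 c}) ∪
        ({p : (ℝ × W) × ℝ | p.2 ∈ Ioo (0:ℝ) 1}ᶜ ∩ {p | p.1.1 ≤ c}) := by
      ext p
      simp only [mem_preimage, mem_Iic, mem_union, mem_inter_iff, mem_ofPred_eq, mem_compl_iff]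
      by_cases ht : p.2 ∈ Ioo (0:ℝ) 1
      · rw [← ha1 p.1 p.2 ht, (hGs p.1.2 p.2 ht).1.le_iff_le]
        tauto
      · rw [ha2 p.1 p.2 ht]; tauto
    rw [e]
    apply MeasurableSet.union
    · apply hIm.inter
      apply measurableSet_le (hGm'.sub hRm)
      exact hGm.comp (by fun_prop : Measurable fun p : (ℝ × W) × ℝ => (c, (p.1.2, p.2)))
    · exact hIm.compl.inter (measurableSet_le (by fun_prop) measurable_const)
  refine ⟨a, ham, fun z => ha2 z 0 (by simp), fun z => ha2 z 1 (by simp), ?_, ?_⟩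
  · intro z
    apply a_lip d (G z.2) (Rf m (D z.2)) (a z) M ε z.1 hM0 hε.le (hG1 z.2) (hG2 z.2) (hRb z.2 z.1).1
      (hRb z.2 z.1).2
    · intro t ht
      by_cases h : t ∈ Ioo (0:ℝ) 1
      · exact ha1 z t h
      · rw [ha2 z t h, hR01 _ _ _ (hcpos t ht h), sub_zero]
    · intro t ht h
      apply ha2
      intro h2
      exact (hc0 t h2).ne' h
  -- the set F
  obtain ⟨P, hP⟩ : ∃ P : W → ℝ → ℤ → ℝ, P = fun w t (p : ℤ) => ∑ k ∈ Finset.range (NNf t),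
    thetaf k t * D w t (flf (m k) (p * (1/2:ℝ) ^ m (NNf t))) := ⟨_, rfl⟩
  have hPe : ∀ w t (p : ℤ), P w t p = ∑ k ∈ Finset.range (NNf t),
    thetaf k t * D w t (flf (m k) (p * (1/2:ℝ) ^ m (NNf t))) := fun w t p => by rw [hP]
  have hhm : Measurable fun t : ℝ => (1/2:ℝ) ^ m (NNf t) :=
    (measurable_from_top (f := fun n : ℕ => (1/2:ℝ) ^ m n)).comp meas_NN
  have hhp : ∀ p : ℤ, Measurable fun t : ℝ => (p:ℝ) * (1/2:ℝ) ^ m (NNf t) := fun p =>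
    measurable_const.mul hhm
  have hPm : ∀ p : ℤ, Measurable fun q : (ℝ × W) × ℝ => P q.1.2 q.2 p := by
    intro p
    simp only [hPe]
    apply meas_sum _ (meas_NN.comp measurable_snd)
    intro k
    apply ((meas_theta k).comp measurable_snd).mul
    exact hDm.comp ((((meas_fl (m k)).comp ((hhp p).comp measurable_snd)).prodMk
        (by fun_prop)) : Measurable fun q : (ℝ × W) × ℝ =>
          (flf (m k) (p * (1/2:ℝ) ^ m (NNf q.2)), (q.1.2, q.2)))
  have hUpm : ∀ p : ℤ, Measurable fun q : (ℝ × W) × ℝ => U q.1.2 (p * (1/2:ℝ) ^ m (NNf q.2)) := by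
    intro p
    exact hUm.comp (((hhp p).comp measurable_snd).prodMk (measurable_snd.comp measurable_fst))
  refine ⟨⋃ p : ℤ, {q | P q.1.2 q.2 p + U q.1.2 (p * (1/2:ℝ) ^ m (NNf q.2)) ≤ G q.1.2 q.2 q.1.1} ∩
    {q | G q.1.2 q.2 q.1.1 < P q.1.2 q.2 p + U q.1.2 ((p + 1 : ℤ) * (1/2:ℝ) ^ m (NNf q.2))}, ?_, ?_⟩
  · apply MeasurableSet.iUnion
    intro p
    exact (measurableSet_le ((hPm p).add (hUpm p)) hGm').inter
      (measurableSet_lt hGm' ((hPm p).add (hUpm (p+1))))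
  intro t ht
  set Ft : Set (ℝ × W) := {z | (z, t) ∈ ⋃ p : ℤ,
    {q : (ℝ × W) × ℝ | P q.1.2 q.2 p + U q.1.2 (p * (1/2:ℝ) ^ m (NNf q.2)) ≤ G q.1.2 q.2 q.1.1} ∩
    {q | G q.1.2 q.2 q.1.1 < P q.1.2 q.2 p + U q.1.2 ((p + 1 : ℤ) * (1/2:ℝ) ^ m (NNf q.2))}} with hFt
  have hFtm : MeasurableSet Ft := by
    apply (by fun_prop : Measurable fun z : ℝ × W => (z, t))
    apply MeasurableSet.iUnion
    intro p
    exact (measurableSet_le ((hPm p).add (hUpm p)) hGm').inter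
      (measurableSet_lt hGm' ((hPm p).add (hUpm (p+1))))
  have hatm : Measurable fun z : ℝ × W => a z t :=
    ham.comp (by fun_prop : Measurable fun z : ℝ × W => (z, t))
  have hline : ∀ w, ((volume : Measure ℝ).withDensity fun x => ENNReal.ofReal (s (x, w))).map
      (fun x => a (x, w) t) =
      (volume.withDensity fun x => ENNReal.ofReal (J (x, w) t)).restrict {x | (x, w) ∈ Ft} := by
    intro w
    have hRmw : Measurable fun r => G w t r - Rf m (D w) t r :=
      (hGm'.sub hRm).comp (by fun_prop : Measurable fun x : ℝ => ((x, w), t))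
    have := line_push (fun x => s (x, w)) (hsw w) M (fun x => hs0 _) (fun x => hsM _)
      ((1/2:ℝ) ^ m (NNf t)) (by positivity) (P w t)
      (by
        intro p q hpq
        rw [hPe, hPe]
        apply Finset.sum_le_sum
        intro k _
        apply mul_le_mul_of_nonneg_left _ (theta_nonneg k (hIoo ht))
        apply hDmono w t (hIoo ht)
        apply fl_mono
        gcongr)
      (fun r => G w t r - Rf m (D w) t r) hRmw
      (by
        intro p r hr
        rw [← hUe, hPe]
        have e : ∀ k ∈ Finset.range (NNf t), thetaf k t * D w t (flf (m k) (p * (1/2:ℝ) ^ m (NNf t)))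
            = thetaf k t * D w t (flf (m k) r) := by
          intro k hk
          rw [fl_cell (m k) (m (NNf t)) (hmm (Finset.mem_range.1 hk).le) p r hr]
        rw [Finset.sum_congr rfl e]
        unfold Rf
        have e2 : ∑ k ∈ Finset.range (NNf t), thetaf k t * (D w t r - D w t (flf (m k) r)) =
          D w t r - ∑ k ∈ Finset.range (NNf t), thetaf k t * D w t (flf (m k) r) := by
          simp only [mul_sub, Finset.sum_sub_distrib]
          rw [← Finset.sum_mul, theta_sum ht, one_mul]
        rw [e2, hDe w t r]; ring)
      (fun x => J (x, w) t) (hJw w t) (cf d t) (hc0 t ht) (fun x => hJc _ t (hIoo ht))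
      (fun x => hJM _ t (hIoo ht)) (fun x => a (x, w) t) (hatm.comp (by fun_prop))
      (fun r => by rw [← hGe]; exact ha1 (r, w) t ht)
    rw [this]
    congr 1
    ext x
    simp only [hFt, mem_preimage, mem_iUnion, mem_Ico, mem_ofPred_eq, mem_inter_iff, hGe, hUe]
  have hmap : Measurable fun z : ℝ × W => (a z t, z.2) := hatm.prodMk measurable_snd
  have hsm' : Measurable fun z => ENNReal.ofReal (s z) := hs.ennreal_ofReal
  have hJm' : Measurable fun z => ENNReal.ofReal (J z t) :=
    (hJ.comp (by fun_prop : Measurable fun z : ℝ × W => (z, t))).ennreal_ofReal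
  have hind : ∀ (f : ℝ × W → ℝ≥0∞) (hf : Measurable f) (B : Set (ℝ × W)) (hB : MeasurableSet B),
      (((volume : Measure ℝ).prod ν).withDensity f) B =
        ∫⁻ w, ((volume : Measure ℝ).withDensity fun x => f (x, w)) {x | (x, w) ∈ B} ∂ν := by
    intro f hf B hB
    rw [withDensity_apply _ hB, ← lintegral_indicator hB, lintegral_prod_symm' _ (hf.indicator hB)]
    congr 1
    ext w
    have hBw : MeasurableSet {x : ℝ | (x, w) ∈ B} := (by fun_prop : Measurable fun x : ℝ => (x, w)) hB
    rw [withDensity_apply _ hBw, ← lintegral_indicator hBw]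
    rfl
  ext B hB
  rw [Measure.map_apply hmap hB, Measure.restrict_apply hB, hind _ hsm' _ (hmap hB),
    hind _ hJm' _ (hB.inter hFtm)]
  congr 1
  ext w
  have hBw : MeasurableSet {x : ℝ | (x, w) ∈ B} := (by fun_prop : Measurable fun x : ℝ => (x, w)) hB
  have h1 : _ = _ := congrArg (fun μ : Measure ℝ => μ {x : ℝ | (x, w) ∈ B}) (hline w)
  beta_reduce at h1
  have haw : Measurable fun x : ℝ => a (x, w) t :=
    hatm.comp (by fun_prop : Measurable fun x : ℝ => (x, w))
  rw [Measure.map_apply haw hBw, Measure.restrict_apply hBw] at h1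
  exact h1


theorem g_lip {E : Type*} [NormedAddCommGroup E] [NormedSpace ℝ E] (f : E → E)
    (hlip : LipschitzWith 2 f) : LipschitzWith 4 (fun z => (2:ℝ) • z - f z) := by
  apply LipschitzWith.of_dist_le_mul
  intro x y
  have h := hlip.dist_le_mul x y
  rw [dist_eq_norm, dist_eq_norm] at *
  rw [show (2:ℝ) • x - f x - ((2:ℝ) • y - f y) = (2:ℝ) • (x - y) - (f x - f y) by module]
  refine (norm_sub_le _ _).trans ?_
  rw [norm_smul, Real.norm_ofNat]
  push_cast at h ⊢
  linarith

theorem aff_meas {F Y : Type*} [NormedAddCommGroup F] [NormedSpace ℝ F] [MeasurableSpace F]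
    [BorelSpace F] [MeasurableSpace Y] (D : F → ℝ) (hD : Continuous D) (A : Y → F)
    (hAm : Measurable A) (c : F) :
    Measurable fun p : Y × ℝ => D ((1 - 2 * p.2) • A p.1 + (2 * p.2) • c) := by
  have h2 : Continuous fun p : F × ℝ => D ((1 - 2 * p.2) • p.1 + (2 * p.2) • c) :=
    hD.comp (by fun_prop)
  have h3 : Measurable fun p : Y × ℝ => (A p.1, p.2) :=
    (hAm.comp measurable_fst).prodMk measurable_snd
  exact h2.measurable.comp h3

theorem Jdet_meas {E : Type*} [NormedAddCommGroup E] [InnerProductSpace ℝ E]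
    [FiniteDimensional ℝ E] [MeasurableSpace E] [BorelSpace E] (A : E → (E →L[ℝ] E))
    (hAm : Measurable A) : Measurable fun p : E × ℝ => Jdet (A p.1) p.2 := by
  exact aff_meas (fun B : E →L[ℝ] E => B.det) ContinuousLinearMap.continuous_det A hAm _

theorem density_data {E : Type*} [NormedAddCommGroup E] [InnerProductSpace ℝ E]
    [FiniteDimensional ℝ E] [MeasureSpace E] [BorelSpace E]
    [(volume : Measure E).IsAddHaarMeasure] (f : E → E) (N : E → ℝ)
    (hmono : ∀ z z', ‖f z - f z'‖ ^ 2 ≤ 2 * ⟪z - z', f z - f z'⟫)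
    (hlip : LipschitzWith 2 f)
    (hN : ∀ z, HasFDerivAt N ((2 : ℝ) • innerSL ℝ (f z)) z)
    (σ : Measure E) [IsFiniteMeasure σ]
    (hσ0 : ∀ B, MeasurableSet B → σ B ≤ volume (f '' B))
    (hσ1 : ∀ B, MeasurableSet B → σ B ≤ volume ((fun z => (2:ℝ) • z - f z) '' B)) :
    ∃ (s : E → ℝ) (j : E → ℝ → ℝ), Measurable s ∧ Measurable (fun p : E × ℝ => j p.1 p.2) ∧
      (∀ z, 0 ≤ s z) ∧ (∀ z, ∀ t ∈ Icc (0:ℝ) 1, s z ≤ j z t) ∧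
      (∀ z, ∀ t ∈ Icc (0:ℝ) 1, cf (Module.finrank ℝ E) t ≤ j z t) ∧
      (∀ z, ∀ t ∈ Icc (0:ℝ) 1, j z t ≤ 2 ^ (Module.finrank ℝ E)) ∧
      (∀ z, ∀ t ∈ Icc (0:ℝ) 1, ∀ t' ∈ Icc (0:ℝ) 1, |j z t - j z t'| ≤
        (Module.finrank ℝ E) * 2 ^ (Module.finrank ℝ E) * (2 * |t - t'|)) ∧
      σ = volume.withDensity (fun z => ENNReal.ofReal (s z)) ∧
      (∀ᵐ z ∂(volume : Measure E), ∃ A, HasFDerivAt f A z ∧ ∀ t, j z t = Jdet A t) := by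
  classical
  set Dd := {z | DifferentiableAt ℝ f z} with hDd
  have hDm : MeasurableSet Dd := measurableSet_of_differentiableAt ℝ f
  have hD0 : ∀ᵐ z ∂(volume : Measure E), z ∈ Dd := hlip.ae_differentiableAt
  obtain ⟨A, hAdef⟩ : ∃ A : E → (E →L[ℝ] E), A = fun z => if z ∈ Dd then fderiv ℝ f z else
    ContinuousLinearMap.id ℝ E := ⟨_, rfl⟩
  have hA1 : ∀ z ∈ Dd, HasFDerivAt f (A z) z := by
    intro z hz
    rw [hAdef]; simp only [hz, if_true]
    exact DifferentiableAt.hasFDerivAt hz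
  have hAm : Measurable A := by
    rw [hAdef]
    exact Measurable.ite hDm (measurable_fderiv ℝ f) measurable_const
  have hAg : ∀ z, (∀ v w, ⟪A z v, w⟫ = ⟪v, A z w⟫) ∧ (∀ v, 0 ≤ ⟪A z v, v⟫) ∧
      (∀ v, ⟪A z v, v⟫ ≤ 2 * ‖v‖ ^ 2) := by
    intro z
    by_cases hz : z ∈ Dd
    · exact fderiv_good f N hmono hN z (A z) (hA1 z hz)
    · have : A z = ContinuousLinearMap.id ℝ E := by rw [hAdef]; simp [hz]
      rw [this]
      refine ⟨fun v w => rfl, fun v => ?_, fun v => ?_⟩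
      · simp only [ContinuousLinearMap.id_apply, real_inner_self_eq_norm_sq]; positivity
      · simp only [ContinuousLinearMap.id_apply, real_inner_self_eq_norm_sq]
        nlinarith [sq_nonneg ‖v‖]
  have hJf : ∀ z, _ := fun z => Jdet_facts (A z) (hAg z).1 (hAg z).2.1 (hAg z).2.2
  have hdet0 : ∀ z, 0 ≤ (A z).det := by
    intro z
    have := (hJf z).1 0 (by simp)
    simp only [Jdet, mul_zero, sub_zero, one_smul, zero_smul, add_zero, zero_mul] at this
    exact le_trans (by positivity) this
  have hdet1 : ∀ z, 0 ≤ ((2:ℝ) • ContinuousLinearMap.id ℝ E - A z).det := by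
    intro z
    have := (hJf z).1 1 (by simp)
    simp only [Jdet, sub_self, mul_zero, mul_one] at this
    rw [show (1 - 2 : ℝ) • A z + (2:ℝ) • ContinuousLinearMap.id ℝ E =
      (2:ℝ) • ContinuousLinearMap.id ℝ E - A z by module] at this
    exact le_trans (by positivity) this
  have hcd : Continuous (fun B : E →L[ℝ] E => B.det) := ContinuousLinearMap.continuous_det
  -- sigma
  have hlip1 : LipschitzWith 4 (fun z => (2:ℝ) • z - f z) := g_lip f hlip
  have hb0 := sigma_le f 2 hlip σ hσ0
  have hb1 := sigma_le _ 4 hlip1 σ hσ1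
  have hac : σ ≪ volume := by
    refine Measure.AbsolutelyContinuous.mk fun B hB h0 => ?_
    refine le_antisymm ((hb0 B hB).trans ?_) bot_le
    rw [Measure.restrict_eq_zero.2 h0]; simp
  have hrn := Measure.withDensity_rnDeriv_eq σ volume hac
  have hrm := Measure.measurable_rnDeriv σ volume
  have hset : ∀ B, MeasurableSet B → ∫⁻ z in B, σ.rnDeriv volume z = σ B := by
    intro B hB
    rw [← withDensity_apply _ hB, hrn]
  have hle0 : ∀ᵐ z ∂(volume : Measure E), σ.rnDeriv volume z ≤ ENNReal.ofReal |(fderiv ℝ f z).det| :=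
    ae_le_of_forall_setLIntegral_le_of_sigmaFinite hrm
      fun B hB _ => by rw [hset B hB]; exact hb0 B hB
  have hle1 : ∀ᵐ z ∂(volume : Measure E), σ.rnDeriv volume z ≤
      ENNReal.ofReal |(fderiv ℝ (fun z => (2:ℝ) • z - f z) z).det| :=
    ae_le_of_forall_setLIntegral_le_of_sigmaFinite hrm
      fun B hB _ => by rw [hset B hB]; exact hb1 B hB
  obtain ⟨s0, hs0⟩ : ∃ s0 : E → ℝ, s0 = fun z => (σ.rnDeriv volume z).toReal := ⟨_, rfl⟩
  have hs0m : Measurable s0 := by rw [hs0]; exact hrm.ennreal_toReal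
  set T : Set E := {z | s0 z ≤ (A z).det} ∩
    {z | s0 z ≤ ((2:ℝ) • ContinuousLinearMap.id ℝ E - A z).det} with hT
  have hd0m : Measurable fun z => (A z).det := hcd.measurable.comp hAm
  have hd1m : Measurable fun z => ((2:ℝ) • ContinuousLinearMap.id ℝ E - A z).det :=
    ((hcd.comp (continuous_const.sub continuous_id)).measurable).comp hAm
  have hTm : MeasurableSet T :=
    (measurableSet_le hs0m hd0m).inter (measurableSet_le hs0m hd1m)
  have hTae : ∀ᵐ z ∂(volume : Measure E), z ∈ T := by
    filter_upwards [hD0, hle0, hle1] with z hz h0 h1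
    have hf := hA1 z hz
    rw [hf.fderiv, abs_of_nonneg (hdet0 z)] at h0
    have hg : HasFDerivAt (fun z => (2:ℝ) • z - f z) ((2:ℝ) • ContinuousLinearMap.id ℝ E - A z) z :=
      ((hasFDerivAt_id z).const_smul (2:ℝ)).sub hf
    rw [hg.fderiv, abs_of_nonneg (hdet1 z)] at h1
    constructor
    · show s0 z ≤ _
      rw [hs0]
      exact ENNReal.toReal_le_of_le_ofReal (hdet0 z) h0
    · show s0 z ≤ _
      rw [hs0]
      exact ENNReal.toReal_le_of_le_ofReal (hdet1 z) h1
  have hs0n : ∀ z, 0 ≤ s0 z := by intro z; rw [hs0]; exact ENNReal.toReal_nonneg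
  have hind0 : ∀ z, 0 ≤ T.indicator s0 z := fun z => indicator_nonneg (fun z _ => hs0n z) z
  refine ⟨T.indicator s0, fun z t => Jdet (A z) t, hs0m.indicator hTm, ?_, hind0, ?_,
    fun z => (hJf z).1, fun z => (hJf z).2.1, fun z => (hJf z).2.2.1, ?_, ?_⟩
  · exact Jdet_meas A hAm
  · intro z
    apply (hJf z).2.2.2 _ (hind0 z)
    · by_cases hz : z ∈ T
      · rw [indicator_of_mem hz]; exact hz.1
      · rw [indicator_of_notMem hz]; exact hdet0 z
    · by_cases hz : z ∈ T
      · rw [indicator_of_mem hz]; exact hz.2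
      · rw [indicator_of_notMem hz]; exact hdet1 z
  · rw [← hrn]
    apply withDensity_congr_ae
    filter_upwards [hTae, Measure.rnDeriv_lt_top σ volume] with z hz hlt
    rw [indicator_of_mem hz, hs0]
    have := ENNReal.ofReal_toReal hlt.ne
    exact this.symm
  · filter_upwards [hD0] with z hz
    exact ⟨A z, hA1 z hz, fun t => rfl⟩


noncomputable def Xmap {E : Type*} [NormedAddCommGroup E] [NormedSpace ℝ E] (f : E → E) (t : ℝ)
    (z : E) : E := (1 - 2 * t) • f z + (2 * t) • z

theorem Xmap_lip {E : Type*} [NormedAddCommGroup E] [NormedSpace ℝ E] (f : E → E)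
    (hlip : LipschitzWith 2 f) (t : ℝ) (ht : t ∈ Icc (0:ℝ) 1) (z z' : E) :
    ‖Xmap f t z - Xmap f t z'‖ ≤ 4 * ‖z - z'‖ := by
  have h := hlip.dist_le_mul z z'
  rw [dist_eq_norm, dist_eq_norm] at h
  push_cast at h
  have e : Xmap f t z - Xmap f t z' = (1 - 2 * t) • (f z - f z') + (2 * t) • (z - z') := by
    unfold Xmap; module
  rw [e]
  refine (norm_add_le _ _).trans ?_
  rw [norm_smul, norm_smul, Real.norm_eq_abs, Real.norm_eq_abs,
    abs_of_nonneg (by linarith [ht.1] : 0 ≤ 2 * t)]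
  have h1 : |1 - 2 * t| ≤ 1 := by rw [abs_le]; constructor <;> linarith [ht.1, ht.2]
  have h2 := norm_nonneg (z - z')
  have h3 := norm_nonneg (f z - f z')
  nlinarith [ht.2, mul_nonneg (sub_nonneg.2 ht.2) h2]

theorem Xmap_inj {E : Type*} [NormedAddCommGroup E] [InnerProductSpace ℝ E] (f : E → E)
    (hmono : ∀ z z', ‖f z - f z'‖ ^ 2 ≤ 2 * ⟪z - z', f z - f z'⟫) (t : ℝ)
    (ht : t ∈ Ioo (0:ℝ) 1) : Function.Injective (Xmap f t) := by
  intro z z' hzz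
  have e : Xmap f t z - Xmap f t z' = (1 - 2 * t) • (f z - f z') + (2 * t) • (z - z') := by
    unfold Xmap; module
  rw [hzz, sub_self] at e
  have h := hmono z z'
  have e1 : (0:ℝ) = (1 - 2 * t) * ⟪z - z', f z - f z'⟫ + 2 * t * ‖z - z'‖ ^ 2 := by
    have := congrArg (fun x => ⟪z - z', x⟫) e
    simpa only [inner_zero_right, inner_add_right, inner_smul_right, real_inner_self_eq_norm_sq] using this
  have h2 : 0 ≤ ⟪z - z', f z - f z'⟫ := by nlinarith [sq_nonneg ‖f z - f z'‖]
  have h4 := sq_nonneg ‖(z - z') - (f z - f z')‖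
  have h3 : ⟪z - z', f z - f z'⟫ ≤ 2 * ‖z - z'‖ ^ 2 := by
    have hn : ‖f z - f z'‖ ≤ 2 * ‖z - z'‖ := by
      have hc := real_inner_le_norm (z - z') (f z - f z')
      by_contra hcon
      push Not at hcon
      have := norm_nonneg (z - z')
      nlinarith
    have hc := real_inner_le_norm (z - z') (f z - f z')
    nlinarith [norm_nonneg (z - z')]
  have h5 : ‖z - z'‖ ^ 2 = 0 := by
    have := sq_nonneg ‖z - z'‖
    rcases le_total t (1/2) with h | h
    · have : 0 ≤ (1 - 2 * t) * ⟪z - z', f z - f z'⟫ := mul_nonneg (by linarith) h2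
      have h6 : 2 * t * ‖z - z'‖ ^ 2 ≤ 0 := by linarith
      nlinarith [ht.1]
    · have : (2 * t - 1) * ⟪z - z', f z - f z'⟫ ≤ (2 * t - 1) * (2 * ‖z - z'‖ ^ 2) :=
        mul_le_mul_of_nonneg_left h3 (by linarith)
      nlinarith [ht.2]
  have h6 : ‖z - z'‖ = 0 := by simpa using h5
  exact sub_eq_zero.1 (norm_eq_zero.1 h6)

theorem area_X {E : Type*} [NormedAddCommGroup E] [InnerProductSpace ℝ E]
    [FiniteDimensional ℝ E] [MeasureSpace E] [BorelSpace E]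
    [(volume : Measure E).IsAddHaarMeasure] (f : E → E)
    (hmono : ∀ z z', ‖f z - f z'‖ ^ 2 ≤ 2 * ⟪z - z', f z - f z'⟫)
    (hlip : LipschitzWith 2 f) (j : E → ℝ → ℝ)
    (hj0 : ∀ z, ∀ t ∈ Icc (0:ℝ) 1, cf (Module.finrank ℝ E) t ≤ j z t)
    (hjd : ∀ᵐ z ∂(volume : Measure E), ∃ A, HasFDerivAt f A z ∧ ∀ t, j z t = Jdet A t)
    (t : ℝ) (ht : t ∈ Ioo (0:ℝ) 1) (B : Set E) (hB : MeasurableSet B) :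
    volume (Xmap f t '' B) = (volume.withDensity fun z => ENNReal.ofReal (j z t)) B := by
  have htI : t ∈ Icc (0:ℝ) 1 := Ioo_subset_Icc_self ht
  set Dd := {z | DifferentiableAt ℝ f z} with hDd
  have hDm : MeasurableSet Dd := measurableSet_of_differentiableAt ℝ f
  have hD0 : volume Ddᶜ = 0 := hlip.ae_differentiableAt
  have hXl : LipschitzWith 4 (Xmap f t) := by
    apply LipschitzWith.of_dist_le_mul
    intro x y
    rw [dist_eq_norm, dist_eq_norm]
    exact Xmap_lip f hlip t htI x y
  have hXd : ∀ z A, HasFDerivAt f A z → HasFDerivAt (Xmap f t)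
      ((1 - 2 * t) • A + (2 * t) • ContinuousLinearMap.id ℝ E) z := by
    intro z A hA
    exact (hA.const_smul (1 - 2 * t)).add ((hasFDerivAt_id z).const_smul (2 * t))
  have h1 : volume (Xmap f t '' B) = volume (Xmap f t '' (B ∩ Dd)) := by
    apply le_antisymm
    · calc volume (Xmap f t '' B) ≤ volume (Xmap f t '' (B ∩ Dd) ∪ Xmap f t '' (B ∩ Ddᶜ)) := by
            apply measure_mono
            rw [← image_union, ← inter_union_distrib_left, union_compl_self, inter_univ]
        _ ≤ volume (Xmap f t '' (B ∩ Dd)) + volume (Xmap f t '' (B ∩ Ddᶜ)) := measure_union_le _ _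
        _ = _ := by
            rw [lip_null (Xmap f t) 4 hXl _ (measure_mono_null inter_subset_right hD0), add_zero]
    · exact measure_mono (image_mono inter_subset_left)
  have h2 := lintegral_abs_det_fderiv_eq_addHaar_image volume (hB.inter hDm)
    (fun z hz => (hXd z _ (DifferentiableAt.hasFDerivAt hz.2)).hasFDerivWithinAt)
    ((Xmap_inj f hmono t ht).injOn (s := B ∩ Dd))
  rw [h1, ← h2, withDensity_apply _ hB]
  have h3 : volume.restrict B = (volume : Measure E).restrict (B ∩ Dd) := by
    apply Measure.restrict_congr_set
    have : Dd =ᵐ[volume] (univ : Set E) := by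
      rw [ae_eq_univ]; exact hD0
    have := (Filter.EventuallyEq.refl (ae (volume : Measure E)) B).inter this
    rw [inter_univ] at this
    exact this.symm
  rw [h3]
  apply lintegral_congr_ae
  filter_upwards [ae_restrict_of_ae hjd] with z ⟨A, hA, hj⟩
  have hp : 0 ≤ Jdet A t := by
    rw [← hj]
    exact le_trans (cf_le _ htI).1 (hj0 z t htI)
  rw [hA.fderiv, hj]
  unfold Jdet at hp ⊢
  rw [abs_of_nonneg hp]

theorem lines_E {E : Type*} [NormedAddCommGroup E] [MeasureSpace E] {W : Type*} [MeasureSpace W]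
    [SFinite (volume : Measure W)] (e : E ≃ᵐ ℝ × W) (he : MeasurePreserving e)
    (hen : ∀ a a' w, ‖e.symm (a, w) - e.symm (a', w)‖ ≤ |a - a'|)
    (d : ℕ) (hd : d ≠ 0) (s : E → ℝ) (hs : Measurable s) (j : E → ℝ → ℝ)
    (hj : Measurable fun p : E × ℝ => j p.1 p.2) (M : ℝ) (hM0 : 0 ≤ M)
    (hs0 : ∀ z, 0 ≤ s z) (hsJ : ∀ z, ∀ t ∈ Icc (0:ℝ) 1, s z ≤ j z t)
    (hJM : ∀ z, ∀ t ∈ Icc (0:ℝ) 1, j z t ≤ M)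
    (hJc : ∀ z, ∀ t ∈ Icc (0:ℝ) 1, cf d t ≤ j z t)
    (hJl : ∀ z, ∀ t ∈ Icc (0:ℝ) 1, ∀ t' ∈ Icc (0:ℝ) 1, |j z t - j z t'| ≤ M * |t - t'|)
    (ε : ℝ) (hε : 0 < ε) :
    ∃ b : E → ℝ → E, Measurable (fun p : E × ℝ => b p.1 p.2) ∧
      (∀ z, b z 0 = z) ∧ (∀ z, b z 1 = z) ∧
      (∀ z, ∀ t ∈ Icc (0:ℝ) 1, ∀ t' ∈ Icc (0:ℝ) 1, ‖b z t' - b z t‖ ≤ ε * |t' - t|) ∧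
      ∃ F : Set (E × ℝ), MeasurableSet F ∧ ∀ t ∈ Ioo (0:ℝ) 1,
        ((volume : Measure E).withDensity fun z => ENNReal.ofReal (s z)).map (fun z => b z t) =
        ((volume : Measure E).withDensity fun z => ENNReal.ofReal (j z t)).restrict
          {z | (z, t) ∈ F} := by
  have hem := e.measurable
  have hesm := e.symm.measurable
  obtain ⟨a, ham, ha0, ha1, hal, F, hFm, hF⟩ := lines_core (volume : Measure W) d hd
    (fun p => s (e.symm p)) (hs.comp hesm) (fun p t => j (e.symm p) t)
    (hj.comp ((hesm.comp measurable_fst).prodMk measurable_snd)) M hM0 (fun z => hs0 _)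
    (fun z => hsJ _) (fun z => hJM _) (fun z => hJc _) (fun z => hJl _) (ε / (1 + M)) (by positivity)
  have hew : ∀ (q : E → ℝ), Measurable q → ∀ B, MeasurableSet B →
      ((volume : Measure E).withDensity fun z => ENNReal.ofReal (q z)) (e ⁻¹' B) =
      (((volume : Measure ℝ).prod (volume : Measure W)).withDensity
        fun p => ENNReal.ofReal (q (e.symm p))) B := by
    intro q hq B hB
    rw [withDensity_apply _ hB, withDensity_apply _ (hem hB)]
    have := he.setLIntegral_comp_preimage hB (f := fun p => ENNReal.ofReal (q (e.symm p)))
      (hq.comp hesm).ennreal_ofReal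
    simp only [MeasurableEquiv.symm_apply_apply] at this
    exact this
  have ham' : ∀ t, Measurable fun z : ℝ × W => (a z t, z.2) := fun t =>
    (ham.comp (by fun_prop : Measurable fun z : ℝ × W => (z, t))).prodMk measurable_snd
  have hbm : Measurable (fun p : E × ℝ => e.symm (a (e p.1) p.2, (e p.1).2)) :=
    hesm.comp ((ham.comp ((hem.comp measurable_fst).prodMk measurable_snd)).prodMk
      (measurable_snd.comp (hem.comp measurable_fst)))
  refine ⟨fun z t => e.symm (a (e z) t, (e z).2), hbm, fun z => ?_, fun z => ?_, ?_,
    (fun p : E × ℝ => (e p.1, p.2)) ⁻¹' F,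
    ((hem.comp measurable_fst).prodMk measurable_snd) hFm, ?_⟩
  · simp only [ha0, Prod.mk.eta, MeasurableEquiv.symm_apply_apply]
  · simp only [ha1, Prod.mk.eta, MeasurableEquiv.symm_apply_apply]
  · intro z t ht t' ht'
    refine (hen _ _ _).trans ?_
    have := hal (e z) t ht t' ht'
    rwa [div_mul_cancel₀ _ (by positivity)] at this
  · intro t ht
    have hFt : MeasurableSet {z : ℝ × W | (z, t) ∈ F} :=
      (by fun_prop : Measurable fun z : ℝ × W => (z, t)) hFm
    ext B hB
    have hbt : Measurable fun z : E => e.symm (a (e z) t, (e z).2) := hesm.comp ((ham' t).comp hem)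
    have hFt' : MeasurableSet {z : E | (z, t) ∈ (fun p : E × ℝ => (e p.1, p.2)) ⁻¹' F} := hem hFt
    rw [Measure.map_apply hbt hB, Measure.restrict_apply hB]
    have h1 := congrArg (fun μ : Measure (ℝ × W) => μ (e.symm ⁻¹' B)) (hF t ht)
    beta_reduce at h1
    rw [Measure.map_apply (ham' t) (hesm hB), Measure.restrict_apply (hesm hB),
      ← hew s hs _ ((ham' t) (hesm hB)),
      ← hew (fun z => j z t) (hj.comp (by fun_prop : Measurable fun z : E => (z, t))) _
        ((hesm hB).inter hFt)] at h1
    have e1 : e ⁻¹' (e.symm ⁻¹' B ∩ {z : ℝ × W | (z, t) ∈ F}) =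
        B ∩ {z : E | (z, t) ∈ (fun p : E × ℝ => (e p.1, p.2)) ⁻¹' F} := by
      ext z
      simp
    rw [e1] at h1
    exact h1


theorem push_S {E : Type*} [NormedAddCommGroup E] [InnerProductSpace ℝ E]
    [FiniteDimensional ℝ E] [MeasureSpace E] [BorelSpace E]
    [(volume : Measure E).IsAddHaarMeasure] (f : E → E)
    (hmono : ∀ z z', ‖f z - f z'‖ ^ 2 ≤ 2 * ⟪z - z', f z - f z'⟫)
    (hlip : LipschitzWith 2 f) (j : E → ℝ → ℝ)
    (hj0 : ∀ z, ∀ t ∈ Icc (0:ℝ) 1, cf (Module.finrank ℝ E) t ≤ j z t)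
    (hjd : ∀ᵐ z ∂(volume : Measure E), ∃ A, HasFDerivAt f A z ∧ ∀ t, j z t = Jdet A t)
    (σ : Measure E) [SFinite σ] (b : E → ℝ → E) (hbm : Measurable (fun p : E × ℝ => b p.1 p.2))
    (F : Set (E × ℝ)) (hFm : MeasurableSet F)
    (hF : ∀ t ∈ Ioo (0:ℝ) 1, σ.map (fun z => b z t) =
        ((volume : Measure E).withDensity fun z => ENNReal.ofReal (j z t)).restrict
          {z | (z, t) ∈ F}) :
    ∃ S : Set (E × ℝ), MeasurableSet S ∧
      (σ.prod ((volume : Measure ℝ).restrict (Icc (0:ℝ) 1))).map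
        (fun p : E × ℝ => (Xmap f p.2 (b p.1 p.2), p.2)) =
      ((volume : Measure E).prod ((volume : Measure ℝ).restrict (Icc (0:ℝ) 1))).restrict S := by
  haveI : ProperSpace E := FiniteDimensional.proper ℝ E
  have hXc : Continuous fun p : E × ℝ => Xmap f p.2 p.1 := by
    unfold Xmap
    have := hlip.continuous
    fun_prop
  have hΦc : Continuous fun p : E × ℝ => (Xmap f p.2 p.1, p.2) := hXc.prodMk continuous_snd
  set T : Set (E × ℝ) := F ∩ {p | p.2 ∈ Ioo (0:ℝ) 1} with hT
  have hTm : MeasurableSet T := hFm.inter (measurable_snd measurableSet_Ioo)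
  have hinj : InjOn (fun p : E × ℝ => (Xmap f p.2 p.1, p.2)) T := by
    rintro ⟨z, t⟩ ⟨-, ht⟩ ⟨z', t'⟩ - h
    simp only [Prod.mk.injEq] at h
    obtain ⟨h1, rfl⟩ := h
    rw [Xmap_inj f hmono t ht h1]
  have hSm : MeasurableSet ((fun p : E × ℝ => (Xmap f p.2 p.1, p.2)) '' T) :=
    hTm.image_of_continuousOn_injOn hΦc.continuousOn hinj
  refine ⟨_, hSm, ?_⟩
  set S := (fun p : E × ℝ => (Xmap f p.2 p.1, p.2)) '' T with hS
  have hym : Measurable fun p : E × ℝ => (Xmap f p.2 (b p.1 p.2), p.2) :=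
    hΦc.measurable.comp (hbm.prodMk measurable_snd)
  ext B hB
  rw [Measure.map_apply hym hB, Measure.restrict_apply hB, Measure.prod_apply_symm (hym hB),
    Measure.prod_apply_symm (hB.inter hSm), Measure.restrict_congr_set Ioo_ae_eq_Icc.symm]
  apply setLIntegral_congr_fun measurableSet_Ioo
  intro t ht
  beta_reduce
  have hXt : Measurable fun z : E => (Xmap f t z, t) :=
    hΦc.measurable.comp (by fun_prop : Measurable fun z : E => (z, t))
  have hbt : Measurable fun z : E => b z t :=
    hbm.comp (by fun_prop : Measurable fun z : E => (z, t))
  have hFt : MeasurableSet {z : E | (z, t) ∈ F} := (by fun_prop : Measurable fun z : E => (z, t)) hFm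
  have h1 := congrArg (fun μ : Measure E => μ ((fun z : E => (Xmap f t z, t)) ⁻¹' B)) (hF t ht)
  beta_reduce at h1
  rw [Measure.map_apply hbt (hXt hB), Measure.restrict_apply (hXt hB),
    ← area_X f hmono hlip j hj0 hjd t ht _ ((hXt hB).inter hFt)] at h1
  refine Eq.trans ?_ (h1.trans ?_)
  · rfl
  · congr 1
    ext x
    constructor
    · rintro ⟨z, ⟨hz1, hz2⟩, rfl⟩
      exact ⟨hz1, (z, t), ⟨hz2, ht⟩, rfl⟩
    · rintro ⟨hx, ⟨z, t'⟩, ⟨hz1, -⟩, hz⟩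
      simp only [Prod.mk.injEq] at hz
      obtain ⟨h2, rfl⟩ := hz
      refine ⟨z, ⟨?_, hz1⟩, h2⟩
      show (Xmap f t' z, t') ∈ B
      rw [h2]; exact hx

theorem y_lip {E : Type*} [NormedAddCommGroup E] [NormedSpace ℝ E] (f : E → E)
    (hlip : LipschitzWith 2 f) (ε : ℝ) (b : ℝ → E) (z : E) (hb0 : b 0 = z)
    (hb : ∀ t ∈ Icc (0:ℝ) 1, ∀ t' ∈ Icc (0:ℝ) 1, ‖b t' - b t‖ ≤ ε * |t' - t|) (hε : 0 ≤ ε)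
    (s : ℝ) (hs : s ∈ Icc (0:ℝ) 1) (t : ℝ) (ht : t ∈ Icc (0:ℝ) 1) :
    ‖Xmap f s (b s) - Xmap f t (b t)‖ ≤ (‖(2:ℝ) • (z - f z)‖ + 10 * ε) * |s - t| := by
  have h1 := Xmap_lip f hlip s hs (b s) (b t)
  have h2 := hb t ht s hs
  have h3 : ‖b t - z‖ ≤ ε := by
    have := hb 0 (by simp) t ht
    rw [hb0, sub_zero, abs_of_nonneg ht.1] at this
    nlinarith [ht.2]
  have h4 : ‖(2:ℝ) • (b t - f (b t))‖ ≤ ‖(2:ℝ) • (z - f z)‖ + 6 * ε := by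
    have h := hlip.dist_le_mul (b t) z
    rw [dist_eq_norm, dist_eq_norm] at h
    push_cast at h
    have e : (2:ℝ) • (b t - f (b t)) = (2:ℝ) • (z - f z) + ((2:ℝ) • (b t - z) - (2:ℝ) • (f (b t) - f z)) := by
      module
    rw [e]
    refine (norm_add_le _ _).trans ?_
    gcongr
    refine (norm_sub_le _ _).trans ?_
    rw [norm_smul, norm_smul, Real.norm_ofNat]
    linarith
  have e : Xmap f s (b s) - Xmap f t (b t) = (Xmap f s (b s) - Xmap f s (b t)) +
      (s - t) • ((2:ℝ) • (b t - f (b t))) := by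
    unfold Xmap; module
  rw [e]
  refine (norm_add_le _ _).trans ?_
  rw [norm_smul, Real.norm_eq_abs]
  have := abs_nonneg (s - t)
  nlinarith

theorem assemble {d : ℕ} (hd : d ≠ 0) (Ω₀ Ω₁ : Set (EuclideanSpace ℝ (Fin d)))
    {W : Type} [MeasureSpace W] [SFinite (volume : Measure W)]
    (e : EuclideanSpace ℝ (Fin d) ≃ᵐ ℝ × W) (he : MeasurePreserving e)
    (hen : ∀ a a' w, ‖e.symm (a, w) - e.symm (a', w)‖ ≤ |a - a'|)
    (f : EuclideanSpace ℝ (Fin d) → EuclideanSpace ℝ (Fin d))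
    (N : EuclideanSpace ℝ (Fin d) → ℝ)
    (hmono : ∀ z z', ‖f z - f z'‖ ^ 2 ≤ 2 * ⟪z - z', f z - f z'⟫)
    (hlip : LipschitzWith 2 f)
    (hN : ∀ z, HasFDerivAt N ((2 : ℝ) • innerSL ℝ (f z)) z)
    (σ : Measure (EuclideanSpace ℝ (Fin d))) [IsFiniteMeasure σ]
    (hσ0 : ∀ B, MeasurableSet B → σ B ≤ volume (f '' B))
    (hσ1 : ∀ B, MeasurableSet B → σ B ≤ volume ((fun z => (2:ℝ) • z - f z) '' B))
    (h0 : σ.map f = volume.restrict Ω₀)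
    (h1 : σ.map (fun z => (2:ℝ) • z - f z) = volume.restrict Ω₁)
    (hmemTwo : MemLp (fun z => ‖(2:ℝ) • (z - f z)‖) 2 σ) (ε : ℝ) (hε : 0 < ε) :
    sInf (shapeActionSet Ω₀ Ω₁) ≤
      ENNReal.ofReal (∫ z, (‖(2:ℝ) • (z - f z)‖ + 10 * ε) ^ 2 ∂σ) := by
  obtain ⟨s, j, hsm, hjm, hs0, hsj, hjc, hjM, hjl, hσ, hjd⟩ :=
    density_data f N hmono hlip hN σ hσ0 hσ1
  have hfr : Module.finrank ℝ (EuclideanSpace ℝ (Fin d)) = d := by simp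
  have hjc' := hjc
  rw [hfr] at hjc' hjM hjl
  obtain ⟨b, hbm, hb0, hb1, hbl, F, hFm, hF⟩ := lines_E e he hen d hd s hsm j hjm
    (2 ^ d + d * 2 ^ d * 2) (by positivity) hs0 hsj
    (fun z t ht => (hjM z t ht).trans (by
      have : (0:ℝ) ≤ d * 2 ^ d * 2 := by positivity
      linarith)) hjc'
    (fun z t ht t' ht' => (hjl z t ht t' ht').trans (by
      have h1 : (0:ℝ) ≤ 2 ^ d := by positivity
      have h2 := abs_nonneg (t - t')
      nlinarith [mul_nonneg h1 h2])) ε hε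
  rw [← hσ] at hF
  obtain ⟨S, hSm, hS⟩ := push_S f hmono hlip j hjc hjd σ b hbm F hFm hF
  have hfm : Measurable f := hlip.continuous.measurable
  have hkm : Measurable fun z => ‖(2:ℝ) • (z - f z)‖₊ + (10 * ε).toNNReal := by fun_prop
  have hke : ∀ z, ((‖(2:ℝ) • (z - f z)‖₊ + (10 * ε).toNNReal : ℝ≥0) : ℝ) =
      ‖(2:ℝ) • (z - f z)‖ + 10 * ε := by
    intro z
    rw [NNReal.coe_add, coe_nnnorm, Real.coe_toNNReal _ (by positivity)]
  have hXc : Continuous fun p : EuclideanSpace ℝ (Fin d) × ℝ => Xmap f p.2 p.1 := by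
    unfold Xmap
    have := hlip.continuous
    fun_prop
  have key := lagrange_to_euler Ω₀ Ω₁ σ (fun z t => Xmap f t (b z t))
    (hXc.measurable.comp (hbm.prodMk measurable_snd))
    (fun z => ‖(2:ℝ) • (z - f z)‖₊ + (10 * ε).toNNReal) hkm
    (Filter.Eventually.of_forall fun z s hs t ht => by
      rw [hke]
      exact y_lip f hlip ε (b z) z (hb0 z) (hbl z) hε.le s hs t ht)
    (by
      simp only [hke]
      exact (hmemTwo.add (memLp_const (10 * ε))).integrable_sq)
    (by
      rw [← h0]; congr 1; ext1 z
      simp only [Xmap, hb0]; simp)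
    (by
      rw [← h1]; congr 1; ext1 z
      simp only [Xmap, hb1]; module)
    S hSm hS
  simpa only [hke] using key


noncomputable def splitE (n : ℕ) : EuclideanSpace ℝ (Fin (n+1)) ≃ᵐ ℝ × (Fin n → ℝ) :=
  (MeasurableEquiv.toLp 2 (Fin (n+1) → ℝ)).symm.trans
    (MeasurableEquiv.piFinSuccAbove (fun _ => ℝ) 0)

theorem splitE_mp (n : ℕ) : MeasurePreserving (splitE n) := by
  have h1 := EuclideanSpace.volume_preserving_symm_measurableEquiv_toLp (Fin (n+1))
  have h2 := volume_preserving_piFinSuccAbove (fun _ : Fin (n+1) => ℝ) 0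
  exact h2.comp h1

theorem splitE_norm (n : ℕ) (a a' : ℝ) (w : Fin n → ℝ) :
    ‖(splitE n).symm (a, w) - (splitE n).symm (a', w)‖ ≤ |a - a'| := by
  have h : ∀ a, (splitE n).symm (a, w) = WithLp.toLp 2 (Fin.cons a w : Fin (n+1) → ℝ) := by
    intro a
    apply (splitE n).injective
    rw [MeasurableEquiv.apply_symm_apply]
    rfl
  rw [h, h, EuclideanSpace.norm_eq, Fin.sum_univ_succ]
  simp [Real.sqrt_sq_eq_abs]

theorem duality {E : Type*} [NormedAddCommGroup E] [InnerProductSpace ℝ E]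
    [FiniteDimensional ℝ E] [MeasureSpace E] [BorelSpace E]
    [(volume : Measure E).IsAddHaarMeasure] (Ω₀ Ω₁ : Set E)
    (h₀meas : MeasurableSet Ω₀) (h₁meas : MeasurableSet Ω₁) (R : ℝ)
    (h₀R : Ω₀ ⊆ Metric.closedBall 0 R) (h₁R : Ω₁ ⊆ Metric.closedBall 0 R)
    (φ ψ : C(E, ℝ)) (π : Measure (E × E))
    (h0 : π.map Prod.fst = volume.restrict Ω₀) (h1 : π.map Prod.snd = volume.restrict Ω₁) :
    (∀ᵐ p ∂π, p.1 ∈ Metric.closedBall (0 : E) R ∧ p.2 ∈ Metric.closedBall (0 : E) R) ∧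
    IsFiniteMeasure π ∧
    Integrable (fun p : E × E => φ p.1 + ψ p.2) π ∧
    ∫ p, (φ p.1 + ψ p.2) ∂π = (∫ x in Ω₀, φ x) + ∫ x in Ω₁, ψ x := by
  haveI : ProperSpace E := FiniteDimensional.proper ℝ E
  have hb0 : ∀ᵐ p ∂π, p.1 ∈ Metric.closedBall (0 : E) R := by
    have : ∀ᵐ x ∂(π.map Prod.fst), x ∈ Metric.closedBall (0 : E) R := by
      rw [h0]; filter_upwards [ae_restrict_mem h₀meas] with x hx using h₀R hx
    exact ae_of_ae_map measurable_fst.aemeasurable this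
  have hb1 : ∀ᵐ p ∂π, p.2 ∈ Metric.closedBall (0 : E) R := by
    have : ∀ᵐ x ∂(π.map Prod.snd), x ∈ Metric.closedBall (0 : E) R := by
      rw [h1]; filter_upwards [ae_restrict_mem h₁meas] with x hx using h₁R hx
    exact ae_of_ae_map measurable_snd.aemeasurable this
  have hfin : IsFiniteMeasure π := by
    refine ⟨?_⟩
    have : π univ = (π.map Prod.fst) univ := by
      rw [Measure.map_apply measurable_fst MeasurableSet.univ, preimage_univ]
    rw [this, h0, Measure.restrict_apply_univ]
    exact (measure_mono h₀R).trans_lt (isCompact_closedBall _ _).measure_lt_top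
  have hi0 : Integrable φ (π.map Prod.fst) := by
    rw [h0]
    exact (φ.continuous.continuousOn.integrableOn_compact (isCompact_closedBall 0 R)).mono_set h₀R
  have hi1 : Integrable ψ (π.map Prod.snd) := by
    rw [h1]
    exact (ψ.continuous.continuousOn.integrableOn_compact (isCompact_closedBall 0 R)).mono_set h₁R
  have hj0 : Integrable (fun p : E × E => φ p.1) π := hi0.comp_measurable measurable_fst
  have hj1 : Integrable (fun p : E × E => ψ p.2) π := hi1.comp_measurable measurable_snd
  refine ⟨hb0.and hb1, hfin, hj0.add hj1, ?_⟩
  rw [integral_add hj0 hj1, ← h0, ← h1, integral_map measurable_fst.aemeasurable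
    hi0.aestronglyMeasurable, integral_map measurable_snd.aemeasurable hi1.aestronglyMeasurable]

theorem shape_zero (Ω₀ Ω₁ : Set (EuclideanSpace ℝ (Fin 0))) (h₀meas : MeasurableSet Ω₀)
    (hvol : volume Ω₀ = volume Ω₁) (hpos : 0 < volume Ω₀) :
    sInf (shapeActionSet Ω₀ Ω₁) = 0 := by
  have h0 : Ω₀.Nonempty := nonempty_of_measure_ne_zero hpos.ne'
  have h1 : Ω₁.Nonempty := nonempty_of_measure_ne_zero (hvol ▸ hpos.ne')
  have e0 : Ω₀ = univ := Subsingleton.eq_univ_of_nonempty h0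
  have e1 : Ω₁ = univ := Subsingleton.eq_univ_of_nonempty h1
  subst e0; subst e1
  haveI : IsFiniteMeasure (volume : Measure (EuclideanSpace ℝ (Fin 0))) :=
    ⟨(Set.toFinite univ).isCompact.measure_lt_top⟩
  have := lagrange_to_euler (univ : Set (EuclideanSpace ℝ (Fin 0))) univ
    (volume : Measure (EuclideanSpace ℝ (Fin 0))) (fun l _ => l) measurable_fst
    (fun _ => 0) measurable_const (by simp) (by simp) (by simp) (by simp) univ MeasurableSet.univ
    (by simp [spaceTime])
  simpa using this

theorem integral_expand {X : Type*} [MeasurableSpace X] {σ : Measure X} [IsFiniteMeasure σ]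
    {q : X → ℝ} (h1 : Integrable q σ) (h2 : Integrable (fun z => q z ^ 2) σ) (ε : ℝ) :
    ∫ z, (q z + 10 * ε) ^ 2 ∂σ =
      (∫ z, q z ^ 2 ∂σ) + (20 * ε) * (∫ z, q z ∂σ) + 100 * ε ^ 2 * σ.real univ := by
  have h : ∀ z, (q z + 10 * ε) ^ 2 = q z ^ 2 + ((20 * ε) * q z + 100 * ε ^ 2) :=
    fun z => by ring
  have h3 : Integrable (fun z => (20 * ε) * q z) σ := h1.const_mul _
  have h4 : Integrable (fun z => (20 * ε) * q z + 100 * ε ^ 2) σ :=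
    h3.add (integrable_const _)
  simp_rw [h]
  rw [integral_add h2 h4, integral_add h3 (integrable_const _), integral_const_mul,
    integral_const, smul_eq_mul]
  ring

theorem shape_le (n : ℕ) (Ω₀ Ω₁ : Set (EuclideanSpace ℝ (Fin (n+1))))
    (h₀meas : MeasurableSet Ω₀) (h₁meas : MeasurableSet Ω₁) (R : ℝ) (hR : 0 ≤ R)
    (φ ψ : C(EuclideanSpace ℝ (Fin (n+1)), ℝ))
    (π : Measure (EuclideanSpace ℝ (Fin (n+1)) × EuclideanSpace ℝ (Fin (n+1))))
    [IsFiniteMeasure π]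
    (h0 : π.map Prod.fst = volume.restrict Ω₀) (h1 : π.map Prod.snd = volume.restrict Ω₁)
    (hle : ∀ x ∈ Metric.closedBall 0 R, ∀ y ∈ Metric.closedBall 0 R,
      φ x + ψ y ≤ ‖x - y‖ ^ 2)
    (hae : ∀ᵐ p ∂π, p.1 ∈ Metric.closedBall (0 : EuclideanSpace ℝ (Fin (n+1))) R ∧
      p.2 ∈ Metric.closedBall (0 : EuclideanSpace ℝ (Fin (n+1))) R ∧
      φ p.1 + ψ p.2 = ‖p.1 - p.2‖ ^ 2) :
    sInf (shapeActionSet Ω₀ Ω₁) ≤ ENNReal.ofReal (∫ p, ‖p.1 - p.2‖ ^ 2 ∂π) := by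
  obtain ⟨f, N, hmono, hlip, hN, hf⟩ := potential R hR φ ψ hle
  let mid : EuclideanSpace ℝ (Fin (n+1)) × EuclideanSpace ℝ (Fin (n+1)) →
    EuclideanSpace ℝ (Fin (n+1)) := fun p => (1/2 : ℝ) • (p.1 + p.2)
  have hmc : Continuous mid := by fun_prop
  have hmid : Measurable mid := hmc.measurable
  have hfc : Continuous f := hlip.continuous
  have hgc : Continuous fun z => (2:ℝ) • z - f z := by fun_prop
  have hf0 : ∀ᵐ p ∂π, f (mid p) = p.1 := by
    filter_upwards [hae] with p hp using hf _ hp.1 _ hp.2.1 hp.2.2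
  have hf1 : ∀ᵐ p ∂π, (fun z => (2:ℝ) • z - f z) (mid p) = p.2 := by
    filter_upwards [hf0] with p hp
    beta_reduce
    rw [hp]
    simp only [mid, smul_smul]
    norm_num
  set σ := π.map mid with hσ
  haveI : IsFiniteMeasure σ := Measure.isFiniteMeasure_map _ _
  have hσ0 := sigma_image Ω₀ h₀meas π Prod.fst measurable_fst mid hmid h0 f hf0
  have hσ1 := sigma_image Ω₁ h₁meas π Prod.snd measurable_snd mid hmid h1 (fun z => (2:ℝ) • z - f z) hf1
  have g0 : σ.map f = volume.restrict Ω₀ := by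
    rw [hσ, Measure.map_map hfc.measurable hmid, ← h0]
    exact Measure.map_congr hf0
  have g1 : σ.map (fun z => (2:ℝ) • z - f z) = volume.restrict Ω₁ := by
    rw [hσ, Measure.map_map hgc.measurable hmid, ← h1]
    exact Measure.map_congr hf1
  have hqc : Continuous fun z => ‖(2:ℝ) • (z - f z)‖ := by fun_prop
  have hq : ∀ᵐ p ∂π, ‖(2:ℝ) • (mid p - f (mid p))‖ = ‖p.1 - p.2‖ := by
    filter_upwards [hf0, hf1] with p hp0 hp1
    beta_reduce at hp1
    rw [norm_sub_rev p.1 p.2]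
    congr 1
    rw [← hp1, smul_sub, hp0, two_smul ℝ p.1]; abel
  have hqb : ∀ᵐ z ∂σ, ‖‖(2:ℝ) • (z - f z)‖‖ ≤ 2 * R := by
    rw [hσ, ae_map_iff hmid.aemeasurable
      (measurableSet_le hqc.norm.measurable measurable_const)]
    filter_upwards [hq, hae] with p hp ha
    rw [hp, norm_norm]
    have a1 := mem_closedBall_zero_iff.1 ha.1
    have a2 := mem_closedBall_zero_iff.1 ha.2.1
    linarith [norm_sub_le p.1 p.2]
  have hmemTwo : MemLp (fun z => ‖(2:ℝ) • (z - f z)‖) 2 σ :=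
    MemLp.of_bound hqc.aestronglyMeasurable _ hqb
  have hV : ∫ z, ‖(2:ℝ) • (z - f z)‖ ^ 2 ∂σ = ∫ p, ‖p.1 - p.2‖ ^ 2 ∂π := by
    have hq2 : Continuous fun z => ‖(2:ℝ) • (z - f z)‖ ^ 2 := hqc.pow 2
    rw [hσ, integral_map hmid.aemeasurable hq2.aestronglyMeasurable]
    apply integral_congr_ae
    filter_upwards [hq] with p hp
    rw [hp]
  have hi2 : Integrable (fun z => ‖(2:ℝ) • (z - f z)‖ ^ 2) σ := hmemTwo.integrable_sq
  have hi1 : Integrable (fun z => ‖(2:ℝ) • (z - f z)‖) σ := hmemTwo.integrable (by norm_num)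
  have key : ∀ ε : ℝ, 0 < ε → sInf (shapeActionSet Ω₀ Ω₁) ≤
      ENNReal.ofReal ((∫ p, ‖p.1 - p.2‖ ^ 2 ∂π) +
        (20 * ε) * (∫ z, ‖(2:ℝ) • (z - f z)‖ ∂σ) + 100 * ε ^ 2 * σ.real univ) := by
    intro ε hε
    refine (assemble (Nat.succ_ne_zero n) Ω₀ Ω₁ (splitE n) (splitE_mp n) (splitE_norm n)
      f N hmono hlip hN σ hσ0 hσ1 g0 g1 hmemTwo ε hε).trans (le_of_eq ?_)
    congr 1
    rw [integral_expand hi1 hi2 ε, hV]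
  have hlim : Filter.Tendsto (fun ε : ℝ => ENNReal.ofReal ((∫ p, ‖p.1 - p.2‖ ^ 2 ∂π) +
        (20 * ε) * (∫ z, ‖(2:ℝ) • (z - f z)‖ ∂σ) + 100 * ε ^ 2 * σ.real univ))
      (nhdsWithin 0 (Ioi 0)) (nhds (ENNReal.ofReal (∫ p, ‖p.1 - p.2‖ ^ 2 ∂π))) := by
    apply ENNReal.tendsto_ofReal
    have hc : Continuous fun ε : ℝ => (∫ p, ‖p.1 - p.2‖ ^ 2 ∂π) +
        (20 * ε) * (∫ z, ‖(2:ℝ) • (z - f z)‖ ∂σ) + 100 * ε ^ 2 * σ.real univ := by fun_prop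
    have := (hc.tendsto 0).mono_left (nhdsWithin_le_nhds (s := Ioi 0))
    simpa using this
  refine ge_of_tendsto hlim ?_
  filter_upwards [self_mem_nhdsWithin] with ε hε using key ε hε

theorem shape_distance_eq_wasserstein
    (d : ℕ) (Ω₀ Ω₁ : Set (EuclideanSpace ℝ (Fin d)))
    (h₀meas : MeasurableSet Ω₀) (h₁meas : MeasurableSet Ω₁)
    (h₀bdd : Bornology.IsBounded Ω₀) (h₁bdd : Bornology.IsBounded Ω₁)
    (hvol : volume Ω₀ = volume Ω₁) (hpos : 0 < volume Ω₀) :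
    sInf (shapeActionSet Ω₀ Ω₁) = W2sq (volume.restrict Ω₀) (volume.restrict Ω₁) := by
  obtain ⟨R, hR⟩ := (h₀bdd.union h₁bdd).subset_closedBall 0
  have h₀R : Ω₀ ⊆ Metric.closedBall 0 R := subset_union_left.trans hR
  have h₁R : Ω₁ ⊆ Metric.closedBall 0 R := subset_union_right.trans hR
  have hR0 : 0 ≤ R := by
    obtain ⟨x, hx⟩ := nonempty_of_measure_ne_zero hpos.ne'
    exact (norm_nonneg x).trans (mem_closedBall_zero_iff.1 (h₀R hx))
  obtain ⟨π, φ, ψ, hfin, h0, h1, hle, hae⟩ :=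
    kanto_E Ω₀ Ω₁ h₀meas h₁meas R h₀R h₁R hvol hpos
  obtain ⟨-, -, hi, hV⟩ := duality Ω₀ Ω₁ h₀meas h₁meas R h₀R h₁R φ ψ π h0 h1
  have hV' : ∫ p, ‖p.1 - p.2‖ ^ 2 ∂π = (∫ x in Ω₀, φ x) + ∫ x in Ω₁, ψ x := by
    rw [← hV]
    apply integral_congr_ae
    filter_upwards [hae] with p hp using hp.2.2.symm
  have hi' : Integrable (fun p : EuclideanSpace ℝ (Fin d) × EuclideanSpace ℝ (Fin d) =>
      ‖p.1 - p.2‖ ^ 2) π := by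
    refine hi.congr ?_
    filter_upwards [hae] with p hp using hp.2.2
  have hW : W2sq (volume.restrict Ω₀) (volume.restrict Ω₁) =
      ENNReal.ofReal (∫ p, ‖p.1 - p.2‖ ^ 2 ∂π) := by
    apply le_antisymm
    · refine sInf_le ⟨π, h0, h1, ?_⟩
      exact ofReal_integral_eq_lintegral_ofReal hi' (ae_of_all _ fun p => by positivity)
    · refine le_sInf ?_
      rintro C ⟨π', h0', h1', rfl⟩
      obtain ⟨hb, hfin', hi2, hV2⟩ := duality Ω₀ Ω₁ h₀meas h₁meas R h₀R h₁R φ ψ π' h0' h1'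
      rw [hV', ← hV2]
      have hc : Continuous fun p : EuclideanSpace ℝ (Fin d) × EuclideanSpace ℝ (Fin d) =>
        ‖p.1 - p.2‖ ^ 2 := by fun_prop
      have hi3 : Integrable (fun p : EuclideanSpace ℝ (Fin d) × EuclideanSpace ℝ (Fin d) =>
          ‖p.1 - p.2‖ ^ 2) π' := by
        refine Integrable.of_bound hc.aestronglyMeasurable ((2 * R) ^ 2) ?_
        filter_upwards [hb] with p hp
        rw [Real.norm_of_nonneg (by positivity)]
        have a1 := mem_closedBall_zero_iff.1 hp.1
        have a2 := mem_closedBall_zero_iff.1 hp.2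
        gcongr
        linarith [norm_sub_le p.1 p.2]
      rw [← ofReal_integral_eq_lintegral_ofReal hi3 (ae_of_all _ fun p => by positivity)]
      apply ENNReal.ofReal_le_ofReal
      apply integral_mono_ae hi2 hi3
      filter_upwards [hb] with p hp using hle _ hp.1 _ hp.2
  rw [hW]
  apply le_antisymm
  · cases d with
    | zero => rw [shape_zero Ω₀ Ω₁ h₀meas hvol hpos]; exact zero_le
    | succ n => exact shape_le n Ω₀ Ω₁ h₀meas h₁meas R hR0 φ ψ π h0 h1 hle hae
  · refine le_sInf ?_
    rintro A ⟨ρ, v, hadm, rfl⟩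
    have hai := action_integrable hadm.1 hadm.2.1 hadm.2.2.1 hadm.2.2.2.2.1
    rw [← ofReal_integral_eq_lintegral_ofReal hai, hV']
    · exact ENNReal.ofReal_le_ofReal (dir1 hadm R h₀meas h₁meas h₀R h₁R φ ψ hle)
    · filter_upwards [hadm.2.2.1] with q hq
      rcases hq with hq | hq <;> simp [hq]
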